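/- Let n ≥ 2 and p = 2. Let f : ℝ^{n+1}\{0} → (0,∞) be a positive C¹ function homogeneous of degree −2. Write M_f = max_{S^n} f, m_f = min_{S^n} f, and G_f = sup_{x ∈ S^n} |∇_{S^n} f(x)|, where ∇_{S^n} f(x) = ∇f(x) − ⟨∇f(x), x⟩ x. Suppose ( 1 + (n/(n−1)) · M_f/m_f ) · exp( (nπ/(n−1)) · G_f/m_f ) · G_f ≤ γ_{n,1} · m_f. Then there exists a unique λ > 0 for which there is a function u : ℝ^{n+1} → ℝ, convex on ℝ^{n+1}, positive on ℝ^{n+1}\{0}, homogeneous of degree 1, of class C² on ℝ^{n+1}\{0}, satisfying Δu = λ f u on ℝ^{n+1}\{0}; moreover for this λ the solution u is unique up to multiplication by a positive constant. -/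

import Mathlib

open MeasureTheory Metric Set
open scoped RealInnerProductSpace

/-- The Euclidean Laplacian of `u : ℝ^m → ℝ`, as the sum of second partial
derivatives along the standard coordinate directions. -/
noncomputable def laplacian {m : ℕ} (u : EuclideanSpace ℝ (Fin m) → ℝ)
    (x : EuclideanSpace ℝ (Fin m)) : ℝ :=
  ∑ i, fderiv ℝ (fun y => fderiv ℝ u y (EuclideanSpace.single i 1)) x (EuclideanSpace.single i 1)

/-- The tangential (spherical) gradient `∇_{Sⁿ} g(x) = ∇g(x) - ⟨∇g(x), x⟩ x`. -/
noncomputable def sphereGrad {m : ℕ} (g : EuclideanSpace ℝ (Fin m) → ℝ)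
    (x : EuclideanSpace ℝ (Fin m)) : EuclideanSpace ℝ (Fin m) :=
  gradient g x - ⟪gradient g x, x⟫ • x

/-- `ω_n`, the total surface measure of the unit sphere `Sⁿ ⊂ ℝ^{n+1}`. -/
noncomputable def omega_n (n : ℕ) : ℝ :=
  ((volume : Measure (EuclideanSpace ℝ (Fin (n + 1)))).toSphere Set.univ).toReal

/-- The constant `γ_{n,α}` of the paper, computed with the fixed unit vector
`e = EuclideanSpace.single 0 1` (the value does not depend on this choice). -/
noncomputable def gammaConst (n : ℕ) (α : ℝ) : ℝ :=
  omega_n n / (n * (n + 1)) *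
    (∫ y : EuclideanSpace ℝ (Fin (n + 1)),
      (‖y - EuclideanSpace.single (0 : Fin (n + 1)) (1 : ℝ)‖ ^ (n + 1))⁻¹ * ‖y‖⁻¹ *
        Real.arccos ⟪‖y‖⁻¹ • y, EuclideanSpace.single (0 : Fin (n + 1)) (1 : ℝ)⟫ ^ α)⁻¹

/-- A convex, positive, degree-one homogeneous, `C²` (away from `0`) solution of
`Δu = λ f u` away from the origin. -/
def IsL2Solution (n : ℕ) (f : EuclideanSpace ℝ (Fin (n + 1)) → ℝ) (lam : ℝ)
    (u : EuclideanSpace ℝ (Fin (n + 1)) → ℝ) : Prop :=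
  ConvexOn ℝ Set.univ u ∧
  (∀ y : EuclideanSpace ℝ (Fin (n + 1)), y ≠ 0 → 0 < u y) ∧
  (∀ t : ℝ, 0 < t → ∀ y : EuclideanSpace ℝ (Fin (n + 1)), y ≠ 0 → u (t • y) = t * u y) ∧
  ContDiffOn ℝ 2 u {(0 : EuclideanSpace ℝ (Fin (n + 1)))}ᶜ ∧
  (∀ y : EuclideanSpace ℝ (Fin (n + 1)), y ≠ 0 → laplacian u y = lam * f y * u y)

section SecondDerivative

variable {E : Type*} [NormedAddCommGroup E] [NormedSpace ℝ E]

lemma differentiableAt_fderiv_of_contDiffAt_two {u : E → ℝ} {x : E} (hu : ContDiffAt ℝ 2 u x) :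
    DifferentiableAt ℝ (fderiv ℝ u) x :=
  (hu.fderiv_right (m := 1) (by norm_num)).differentiableAt (by norm_num)

lemma hasDerivAt_comp_line {u : E → ℝ} {x v : E} {s : ℝ}
    (hu : DifferentiableAt ℝ u (x + s • v)) :
    HasDerivAt (fun t : ℝ => u (x + t • v)) (fderiv ℝ u (x + s • v) v) s := by
  have h1 : HasDerivAt (fun t : ℝ => x + t • v) v s := by
    simpa using ((hasDerivAt_id s).smul_const v).const_add x
  exact hu.hasFDerivAt.comp_hasDerivAt s h1

lemma hasDerivAt_fderiv_comp_line {u : E → ℝ} {x v w : E} {s : ℝ}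
    (hu : ContDiffAt ℝ 2 u (x + s • v)) :
    HasDerivAt (fun t : ℝ => fderiv ℝ u (x + t • v) w)
      (fderiv ℝ (fderiv ℝ u) (x + s • v) v w) s := by
  have h1 : HasDerivAt (fun t : ℝ => x + t • v) v s := by
    simpa using ((hasDerivAt_id s).smul_const v).const_add x
  have h2 := (differentiableAt_fderiv_of_contDiffAt_two hu).hasFDerivAt.comp_hasDerivAt s h1
  exact ((ContinuousLinearMap.apply ℝ ℝ w).hasFDerivAt.comp_hasDerivAt s h2)

end SecondDerivative

section Laplacian

variable {m : ℕ}

lemma laplacian_eq_sum_single {u : EuclideanSpace ℝ (Fin m) → ℝ} {x : EuclideanSpace ℝ (Fin m)}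
    (hu : ContDiffAt ℝ 2 u x) :
    laplacian u x = ∑ i, fderiv ℝ (fderiv ℝ u) x (EuclideanSpace.single i 1)
      (EuclideanSpace.single i 1) := by
  unfold laplacian
  refine Finset.sum_congr rfl fun i _ => ?_
  have h := (differentiableAt_fderiv_of_contDiffAt_two hu).hasFDerivAt
  have h2 := (ContinuousLinearMap.apply ℝ ℝ (EuclideanSpace.single i (1 : ℝ))).hasFDerivAt.comp x h
  have h3 := h2.fderiv
  simp only [Function.comp_def, ContinuousLinearMap.apply_apply] at h3
  rw [h3]; rfl

lemma laplacian_eq_sum {ι : Type*} [Fintype ι] {u : EuclideanSpace ℝ (Fin m) → ℝ}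
    {x : EuclideanSpace ℝ (Fin m)} (hu : ContDiffAt ℝ 2 u x)
    (b : OrthonormalBasis ι ℝ (EuclideanSpace ℝ (Fin m))) :
    laplacian u x = ∑ i, fderiv ℝ (fderiv ℝ u) x (b i) (b i) := by
  have h1 := congrFun (InnerProductSpace.laplacian_eq_iteratedFDeriv_orthonormalBasis u b) x
  have h2 := congrFun (InnerProductSpace.laplacian_eq_iteratedFDeriv_orthonormalBasis u
    (EuclideanSpace.basisFun (Fin m) ℝ)) x
  rw [laplacian_eq_sum_single hu]
  simp only [iteratedFDeriv_two_apply] at h1 h2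
  rw [h1] at h2
  simpa using h2.symm

lemma contDiffAt_log_norm {x : EuclideanSpace ℝ (Fin m)} (hx : x ≠ 0) {k : WithTop ℕ∞} :
    ContDiffAt ℝ k (fun z : EuclideanSpace ℝ (Fin m) => Real.log ‖z‖) x :=
  (contDiffAt_norm ℝ hx).log (norm_ne_zero_iff.2 hx)

lemma hasFDerivAt_log_norm {x : EuclideanSpace ℝ (Fin m)} (hx : x ≠ 0) :
    HasFDerivAt (fun z : EuclideanSpace ℝ (Fin m) => Real.log ‖z‖)
      ((‖x‖ ^ 2)⁻¹ • innerSL ℝ x) x := by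
  have h1 : HasFDerivAt (fun z : EuclideanSpace ℝ (Fin m) => ‖z‖ ^ 2) (2 • innerSL ℝ x) x :=
    (hasStrictFDerivAt_norm_sq x).hasFDerivAt
  have hx2 : ‖x‖ ^ 2 ≠ 0 := by positivity
  have h2 := (h1.log hx2).const_mul (1 / 2 : ℝ)
  have h3 : (fun z : EuclideanSpace ℝ (Fin m) => 1 / 2 * Real.log (‖z‖ ^ 2))
      = fun z => Real.log ‖z‖ := by
    ext z; rw [Real.log_pow]; push_cast; ring
  rw [h3] at h2
  refine h2.congr_fderiv ?_
  ext v; simp; ring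

lemma fderiv_radial_mul {w : EuclideanSpace ℝ (Fin m) → ℝ} {τ : ℝ → ℝ}
    (hτ : Differentiable ℝ τ) {x : EuclideanSpace ℝ (Fin m)} (hx : x ≠ 0)
    (hw : DifferentiableAt ℝ w x) (v : EuclideanSpace ℝ (Fin m)) :
    fderiv ℝ (fun z => τ (Real.log ‖z‖) * w z) x v =
      deriv τ (Real.log ‖x‖) * (⟪x, v⟫ * (‖x‖ ^ 2)⁻¹) * w x
        + τ (Real.log ‖x‖) * fderiv ℝ w x v := by
  have h1 := (hτ (Real.log ‖x‖)).hasDerivAt.comp_hasFDerivAt x (hasFDerivAt_log_norm hx)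
  have h2 := (h1.mul hw.hasFDerivAt).fderiv
  simp only [Function.comp_def] at h2
  have h3 : (fun z => τ (Real.log ‖z‖) * w z) = (fun z => τ (Real.log ‖z‖)) * w := rfl
  rw [h3, h2]
  simp
  ring

/-- The Laplacian of the product of a function homogeneous of degree `s` and a function of
`log ‖y‖`. -/
lemma laplacian_radial_mul {n : ℕ} {w : EuclideanSpace ℝ (Fin (n + 1)) → ℝ} {τ : ℝ → ℝ} {s : ℝ}
    (hτ : ContDiff ℝ 2 τ) (hw : ContDiffOn ℝ 2 w {0}ᶜ)
    (hs : ∀ y ≠ 0, fderiv ℝ w y y = s * w y) {x : EuclideanSpace ℝ (Fin (n + 1))} (hx : x ≠ 0) :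
    laplacian (fun z => τ (Real.log ‖z‖) * w z) x =
      τ (Real.log ‖x‖) * laplacian w x +
        (deriv (deriv τ) (Real.log ‖x‖) + (n - 1 + 2 * s) * deriv τ (Real.log ‖x‖)) *
          (‖x‖ ^ 2)⁻¹ * w x := by
  have hwat : ∀ y ≠ 0, ContDiffAt ℝ 2 w y := fun y hy =>
    hw.contDiffAt (isOpen_compl_singleton.mem_nhds hy)
  have hx2 : ‖x‖ ^ 2 ≠ 0 := by positivity
  have hF : ContDiffAt ℝ 2 (fun z => τ (Real.log ‖z‖) * w z) x :=
    (hτ.contDiffAt.comp x (contDiffAt_log_norm hx)).mul (hwat x hx)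
  have hτ1 : Differentiable ℝ τ := hτ.differentiable (by norm_num)
  have hτ2 : Differentiable ℝ (deriv τ) :=
    ((contDiff_succ_iff_deriv (n := 1)).1 hτ).2.2.differentiable (by norm_num)
  have key : ∀ v : EuclideanSpace ℝ (Fin (n + 1)), ‖v‖ = 1 →
      fderiv ℝ (fderiv ℝ (fun z => τ (Real.log ‖z‖) * w z)) x v v =
        deriv (deriv τ) (Real.log ‖x‖) * (⟪x, v⟫ * (‖x‖ ^ 2)⁻¹) ^ 2 * w x
        + deriv τ (Real.log ‖x‖) * ((‖x‖ ^ 2)⁻¹ - 2 * (⟪x, v⟫ * (‖x‖ ^ 2)⁻¹) ^ 2) * w x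
        + 2 * deriv τ (Real.log ‖x‖) * (‖x‖ ^ 2)⁻¹ * (⟪x, v⟫ * fderiv ℝ w x v)
        + τ (Real.log ‖x‖) * fderiv ℝ (fderiv ℝ w) x v v := by
    intro v hv
    have hx0 : x + (0 : ℝ) • v = x := by simp
    have A := hasDerivAt_fderiv_comp_line (s := 0) (v := v) (w := v) (x := x) (by rwa [hx0])
    have hline : HasDerivAt (fun t : ℝ => x + t • v) v 0 := by
      simpa using ((hasDerivAt_id (0:ℝ)).smul_const v).const_add x
    have hlog : HasDerivAt (fun t : ℝ => Real.log ‖x + t • v‖) ((‖x‖ ^ 2)⁻¹ * ⟪x, v⟫) 0 := by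
      have := (hasFDerivAt_log_norm (x := x + (0:ℝ) • v) (by rwa [hx0])).comp_hasDerivAt 0 hline
      simpa [Function.comp_def] using this
    have hinn : HasDerivAt (fun t : ℝ => ⟪x + t • v, v⟫) 1 0 := by
      have h1 : (fun t : ℝ => ⟪x + t • v, v⟫) = fun t : ℝ => ⟪x, v⟫ + t * 1 := by
        ext t; rw [inner_add_left, real_inner_smul_left, real_inner_self_eq_norm_sq, hv]; ring
      rw [h1]
      simpa using ((hasDerivAt_id (0:ℝ)).mul_const 1).const_add ⟪x, v⟫
    have hnsq : HasDerivAt (fun t : ℝ => ‖x + t • v‖ ^ 2) (2 * ⟪x, v⟫) 0 := by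
      have := (hasStrictFDerivAt_norm_sq (x + (0:ℝ) • v)).hasFDerivAt.comp_hasDerivAt 0 hline
      simpa [Function.comp_def] using this
    have hw0 : HasDerivAt (fun t : ℝ => w (x + t • v)) (fderiv ℝ w x v) 0 := by
      have := hasDerivAt_comp_line (u := w) (x := x) (v := v) (s := 0)
        (by rw [hx0]; exact (hwat x hx).differentiableAt (by norm_num))
      rwa [hx0] at this
    have hw1 : HasDerivAt (fun t : ℝ => fderiv ℝ w (x + t • v) v)
        (fderiv ℝ (fderiv ℝ w) x v v) 0 := by
      have := hasDerivAt_fderiv_comp_line (u := w) (x := x) (v := v) (w := v) (s := 0)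
        (by rw [hx0]; exact hwat x hx)
      rwa [hx0] at this
    have hτ0 : HasDerivAt (fun t : ℝ => τ (Real.log ‖x + t • v‖))
        (deriv τ (Real.log ‖x‖) * ((‖x‖ ^ 2)⁻¹ * ⟪x, v⟫)) 0 := by
      have := (hτ1 (Real.log ‖x + (0:ℝ) • v‖)).hasDerivAt.comp (0:ℝ) hlog
      rwa [hx0] at this
    have hτd : HasDerivAt (fun t : ℝ => deriv τ (Real.log ‖x + t • v‖))
        (deriv (deriv τ) (Real.log ‖x‖) * ((‖x‖ ^ 2)⁻¹ * ⟪x, v⟫)) 0 := by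
      have := (hτ2 (Real.log ‖x + (0:ℝ) • v‖)).hasDerivAt.comp (0:ℝ) hlog
      rwa [hx0] at this
    have hinv := hnsq.fun_inv (by simpa using hx)
    have B := ((hτd.fun_mul (hinn.fun_mul hinv)).fun_mul hw0).fun_add (hτ0.fun_mul hw1)
    have hev : (fun t : ℝ => fderiv ℝ (fun z => τ (Real.log ‖z‖) * w z) (x + t • v) v) =ᶠ[nhds 0]
        fun t : ℝ => deriv τ (Real.log ‖x + t • v‖) * (⟪x + t • v, v⟫ * (‖x + t • v‖ ^ 2)⁻¹)
          * w (x + t • v) + τ (Real.log ‖x + t • v‖) * fderiv ℝ w (x + t • v) v := by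
      have hc : ContinuousAt (fun t : ℝ => x + t • v) 0 := hline.continuousAt
      have : ∀ᶠ t : ℝ in nhds 0, x + t • v ≠ 0 :=
        hc.eventually_ne (by rwa [hx0])
      filter_upwards [this] with t ht
      exact fderiv_radial_mul hτ1 ht ((hwat _ ht).differentiableAt (by norm_num)) v
    have C := A.unique (B.congr_of_eventuallyEq hev)
    rw [hx0] at C
    rw [C]
    field_simp
    ring
  set b := EuclideanSpace.basisFun (Fin (n + 1)) ℝ
  rw [laplacian_eq_sum hF b, laplacian_eq_sum (hwat x hx) b]
  rw [Finset.sum_congr rfl fun i _ => key (b i) (b.orthonormal.1 i)]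
  have e1 : ∑ i, ⟪x, b i⟫ ^ 2 = ‖x‖ ^ 2 := by
    have := b.sum_sq_norm_inner_left x
    simpa using this
  have e2 : ∑ i, ⟪x, b i⟫ * fderiv ℝ w x (b i) = s * w x := by
    have h := congrArg (fderiv ℝ w x) (b.sum_repr' x)
    rw [map_sum] at h
    rw [← hs x hx, ← h]
    refine Finset.sum_congr rfl fun i _ => ?_
    rw [map_smul, smul_eq_mul, real_inner_comm]
  have e3 : ∑ i : Fin (n + 1), (1 : ℝ) = n + 1 := by simp
  simp only [Finset.sum_add_distrib, ← Finset.mul_sum, mul_pow, ← Finset.sum_mul,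
    Finset.sum_sub_distrib, e1, e2]
  simp only [Finset.sum_const, Finset.card_univ, Fintype.card_fin, nsmul_eq_mul]
  push_cast
  field_simp
  ring

end Laplacian

section RieszIntegrability

variable {m : ℕ}

lemma integrableOn_ball_norm_rpow (hm : 1 ≤ m) {b : ℝ} (hb : b < m) (δ : ℝ) :
    IntegrableOn (fun y : EuclideanSpace ℝ (Fin m) => ‖y‖ ^ (-b)) (ball 0 δ) := by
  refine integrableOn_ball_of_norm_le_rpow (C := 1) (α := b) (by simpa using hm) (by simpa using hb)
    ?_ ?_
  · refine ae_of_all _ fun y => ?_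
    rw [Real.norm_of_nonneg (by positivity), one_mul]
  · exact (measurable_norm.pow_const _).aestronglyMeasurable

lemma integrableOn_ball_norm_sub_rpow (hm : 1 ≤ m) {b : ℝ} (hb : b < m) (δ : ℝ)
    (x : EuclideanSpace ℝ (Fin m)) :
    IntegrableOn (fun y => ‖x - y‖ ^ (-b)) (ball x δ) := by
  have h := (integrableOn_ball_norm_rpow hm hb δ).integrable_indicator measurableSet_ball
  have h2 := h.comp_sub_left x
  rw [← integrable_indicator_iff measurableSet_ball]
  refine h2.congr (ae_of_all _ fun y => ?_)
  simp only [indicator, mem_ball, dist_eq_norm, sub_zero, norm_sub_rev y x]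

/-- The product of two power singularities is integrable away from one of them. -/
lemma integrableOn_compl_ball_riesz (hm : 1 ≤ m) {a b δ : ℝ} (hb0 : 0 ≤ b)
    (hb : b < m) (hab : m < a + b) {x : EuclideanSpace ℝ (Fin m)} (hδ : 0 < δ) :
    IntegrableOn (fun y => ‖x - y‖ ^ (-a) * ‖y‖ ^ (-b)) (ball x δ)ᶜ := by
  set K : ℝ := ‖x‖ / δ + 1
  have hK : 0 < K := by positivity
  have i1 : Integrable ((ball (0 : EuclideanSpace ℝ (Fin m)) δ).indicator
      fun y => ‖y‖ ^ (-b)) :=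
    (integrableOn_ball_norm_rpow hm hb δ).integrable_indicator measurableSet_ball
  have i2 : Integrable (fun y : EuclideanSpace ℝ (Fin m) => (1 + ‖y‖) ^ (-(a + b))) :=
    integrable_one_add_norm (by simpa using hab)
  have i3 := ((i1.const_mul (δ ^ (-a))).add
    (i2.const_mul (K ^ a * ((1 + δ) / δ) ^ (a + b)))).integrableOn (s := (ball x δ)ᶜ)
  refine i3.mono' ?_ ?_
  · exact (((measurable_const.sub measurable_id).norm.pow_const _).mul
      (measurable_norm.pow_const _)).aestronglyMeasurable
  · refine (ae_restrict_iff' measurableSet_ball.compl).2 (ae_of_all _ fun y hy => ?_)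
    have hxy : δ ≤ ‖x - y‖ := by
      simpa [dist_eq_norm, norm_sub_rev y x] using hy
    rw [Real.norm_of_nonneg (by positivity)]
    simp only [Pi.add_apply]
    by_cases h0 : y ∈ ball (0 : EuclideanSpace ℝ (Fin m)) δ
    · rw [indicator_of_mem h0]
      have : ‖x - y‖ ^ (-a) ≤ δ ^ (-a) :=
        Real.rpow_le_rpow_of_nonpos hδ hxy (by linarith)
      have h2 : ‖x - y‖ ^ (-a) * ‖y‖ ^ (-b) ≤ δ ^ (-a) * ‖y‖ ^ (-b) := by gcongr
      have h3 : 0 ≤ K ^ a * ((1 + δ) / δ) ^ (a + b) * (1 + ‖y‖) ^ (-(a + b)) := by positivity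
      linarith
    · rw [indicator_of_notMem h0, mul_zero, zero_add]
      have hy0 : δ ≤ ‖y‖ := by simpa using h0
      have hypos : 0 < ‖y‖ := hδ.trans_le hy0
      have h1 : ‖y‖ / K ≤ ‖x - y‖ := by
        rw [div_le_iff₀ hK]
        have : ‖y‖ ≤ ‖x‖ + ‖x - y‖ := by
          have := norm_sub_le x (x - y); simpa using this
        have h5 : ‖x‖ ≤ ‖x - y‖ * (‖x‖ / δ) := by
          rw [mul_div_assoc', le_div_iff₀ hδ, mul_comm]; gcongr
        simp only [K]; nlinarith
      have h2 : ‖x - y‖ ^ (-a) ≤ (‖y‖ / K) ^ (-a) :=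
        Real.rpow_le_rpow_of_nonpos (by positivity) h1 (by linarith)
      have h3 : (‖y‖ / K) ^ (-a) = K ^ a * ‖y‖ ^ (-a) := by
        rw [Real.div_rpow hypos.le hK.le, Real.rpow_neg hK.le, div_inv_eq_mul, mul_comm]
      have h4 : ‖y‖ ^ (-(a + b)) ≤ ((1 + δ) / δ) ^ (a + b) * (1 + ‖y‖) ^ (-(a + b)) := by
        have e : (1 + ‖y‖) / ((1 + δ) / δ) ≤ ‖y‖ := by
          rw [div_le_iff₀ (by positivity), mul_div_assoc', le_div_iff₀ hδ]; nlinarith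
        have := Real.rpow_le_rpow_of_nonpos (z := -(a + b)) (by positivity) e (by linarith)
        refine this.trans (le_of_eq ?_)
        rw [Real.div_rpow (by positivity) (by positivity), Real.rpow_neg (x := (1 + δ) / δ) (by positivity),
          div_inv_eq_mul, mul_comm]
      calc ‖x - y‖ ^ (-a) * ‖y‖ ^ (-b) ≤ (K ^ a * ‖y‖ ^ (-a)) * ‖y‖ ^ (-b) := by
            rw [← h3]; gcongr
        _ = K ^ a * ‖y‖ ^ (-(a + b)) := by
            rw [mul_assoc, ← Real.rpow_add hypos]; ring_nf
        _ ≤ _ := by rw [mul_assoc]; gcongr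

/-- The product of two integrable power singularities with enough decay is integrable. -/
lemma integrable_riesz (hm : 1 ≤ m) {a b : ℝ} (hb0 : 0 ≤ b) (ha : a < m)
    (hb : b < m) (hab : m < a + b) {x : EuclideanSpace ℝ (Fin m)} (hx : x ≠ 0) :
    Integrable (fun y => ‖x - y‖ ^ (-a) * ‖y‖ ^ (-b)) := by
  have hδ : 0 < ‖x‖ / 2 := by positivity
  rw [← integrableOn_univ, ← union_compl_self (ball x (‖x‖ / 2))]
  refine IntegrableOn.union ?_ (integrableOn_compl_ball_riesz hm hb0 hb hab hδ)
  refine ((integrableOn_ball_norm_sub_rpow hm ha (‖x‖ / 2) x).mul_const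
    ((‖x‖ / 2) ^ (-b))).mono' ?_ ?_
  · exact (((measurable_const.sub measurable_id).norm.pow_const _).mul
      (measurable_norm.pow_const _)).aestronglyMeasurable
  · refine (ae_restrict_iff' measurableSet_ball).2 (ae_of_all _ fun y hy => ?_)
    rw [Real.norm_of_nonneg (by positivity)]
    have h1 : ‖x‖ / 2 ≤ ‖y‖ := by
      have : ‖x - y‖ < ‖x‖ / 2 := by simpa [dist_eq_norm, norm_sub_rev y x] using hy
      have := norm_sub_norm_le x y
      linarith
    have := Real.rpow_le_rpow_of_nonpos (z := -b) hδ h1 (by linarith)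
    gcongr

/-- A point of norm `r` can be moved to any other such point by a linear isometry. -/
lemma exists_linearIsometryEquiv_apply_eq {V : Type*} [NormedAddCommGroup V]
    [InnerProductSpace ℝ V] {x y : V} (h : ‖x‖ = ‖y‖) :
    ∃ R : V ≃ₗᵢ[ℝ] V, R x = y :=
  ⟨(ℝ ∙ (x - y))ᗮ.reflection, Submodule.reflection_sub h⟩

lemma integral_riesz_eq {a b : ℝ} {x x' : EuclideanSpace ℝ (Fin m)} (h : ‖x‖ = ‖x'‖) :
    ∫ y, ‖x - y‖ ^ (-a) * ‖y‖ ^ (-b) = ∫ y, ‖x' - y‖ ^ (-a) * ‖y‖ ^ (-b) := by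
  obtain ⟨R, rfl⟩ := exists_linearIsometryEquiv_apply_eq h
  rw [← R.measurePreserving.integral_comp R.toHomeomorph.measurableEmbedding
    (fun y => ‖R x - y‖ ^ (-a) * ‖y‖ ^ (-b))]
  refine integral_congr_ae (ae_of_all _ fun y => ?_)
  simp only [← map_sub, LinearIsometryEquiv.norm_map]

end RieszIntegrability

section IntegrationByParts

variable {m : ℕ}

lemma integral_mul_fderiv_eq_neg {A B : EuclideanSpace ℝ (Fin m) → ℝ} (hA : ContDiff ℝ 1 A)
    (hB : ContDiff ℝ 1 B) (hBc : HasCompactSupport B) (v : EuclideanSpace ℝ (Fin m)) :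
    ∫ y, A y * fderiv ℝ B y v = -∫ y, fderiv ℝ A y v * B y := by
  have hA' : Continuous fun y => fderiv ℝ A y v :=
    (hA.continuous_fderiv one_ne_zero).clm_apply continuous_const
  have hB' : Continuous fun y => fderiv ℝ B y v :=
    (hB.continuous_fderiv one_ne_zero).clm_apply continuous_const
  have hBc' : HasCompactSupport fun y => fderiv ℝ B y v := hBc.fderiv_apply ℝ v
  refine integral_mul_fderiv_eq_neg_fderiv_mul_of_integrable ?_ ?_ ?_
    (fun y _ => hA.differentiable one_ne_zero y) (fun y _ => hB.differentiable one_ne_zero y)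
  · exact (hA'.mul hB.continuous).integrable_of_hasCompactSupport hBc.mul_left
  · exact (hA.continuous.mul hB').integrable_of_hasCompactSupport hBc'.mul_left
  · exact (hA.continuous.mul hB.continuous).integrable_of_hasCompactSupport hBc.mul_left

lemma contDiff_fderiv_apply_const {k l : WithTop ℕ∞} {A : EuclideanSpace ℝ (Fin m) → ℝ}
    (hA : ContDiff ℝ l A) (hk : k + 1 ≤ l) (v : EuclideanSpace ℝ (Fin m)) :
    ContDiff ℝ k fun y => fderiv ℝ A y v :=
  (hA.fderiv_right hk).clm_apply contDiff_const

lemma fderiv_fderiv_apply_comm {A : EuclideanSpace ℝ (Fin m) → ℝ} (hA : ContDiff ℝ 2 A)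
    (v w y : EuclideanSpace ℝ (Fin m)) :
    fderiv ℝ (fun z => fderiv ℝ A z v) y w = fderiv ℝ (fun z => fderiv ℝ A z w) y v := by
  have hd : DifferentiableAt ℝ (fderiv ℝ A) y := differentiableAt_fderiv_of_contDiffAt_two
    hA.contDiffAt
  rw [fderiv_clm_apply hd (differentiableAt_const _), fderiv_clm_apply hd (differentiableAt_const _)]
  simpa using (hA.contDiffAt (x := y)).isSymmSndFDerivAt (by simp) w v

/-- Integrating by parts four times. -/
lemma integral_fderiv_fderiv_mul_swap {A B : EuclideanSpace ℝ (Fin m) → ℝ} (hA : ContDiff ℝ 4 A)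
    (hB : ContDiff ℝ 2 B) (hBc : HasCompactSupport B) (v w : EuclideanSpace ℝ (Fin m)) :
    ∫ y, fderiv ℝ (fun z => fderiv ℝ A z v) y v * fderiv ℝ (fun z => fderiv ℝ B z w) y w =
      ∫ y, fderiv ℝ (fun z => fderiv ℝ A z w) y w * fderiv ℝ (fun z => fderiv ℝ B z v) y v := by
  have hBv (v) : ContDiff ℝ 1 fun z => fderiv ℝ B z v :=
    contDiff_fderiv_apply_const hB (by norm_num) v
  have hBvc (v) : HasCompactSupport fun z => fderiv ℝ B z v := hBc.fderiv_apply ℝ v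
  have hAv (v) : ContDiff ℝ 3 fun z => fderiv ℝ A z v :=
    contDiff_fderiv_apply_const hA (by norm_num) v
  have hAvw (v w) : ContDiff ℝ 2 fun y => fderiv ℝ (fun z => fderiv ℝ A z v) y w :=
    contDiff_fderiv_apply_const (hAv v) (by norm_num) w
  have hA2 : ContDiff ℝ 2 A := hA.of_le (by norm_num)
  have hAv2 (v) : ContDiff ℝ 2 fun z => fderiv ℝ A z v := (hAv v).of_le (by norm_num)
  have half (v w) : ∫ y, fderiv ℝ (fun z => fderiv ℝ A z v) y v *
        fderiv ℝ (fun z => fderiv ℝ B z w) y w =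
      ∫ y, fderiv ℝ (fun z => fderiv ℝ A z v) y w * fderiv ℝ (fun z => fderiv ℝ B z v) y w := by
    simp_rw [fderiv_fderiv_apply_comm hB v w]
    rw [integral_mul_fderiv_eq_neg ((hAvw v v).of_le (by norm_num)) (hBv w) (hBvc w),
      integral_mul_fderiv_eq_neg ((hAvw v w).of_le (by norm_num)) (hBv w) (hBvc w)]
    congr 2 with y
    rw [fderiv_fderiv_apply_comm (hAv2 v) v w y]
  rw [half v w, half w v]
  simp_rw [fderiv_fderiv_apply_comm hA2 w v, fderiv_fderiv_apply_comm hB w v]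

lemma integral_mul_fderiv_fderiv {A B : EuclideanSpace ℝ (Fin m) → ℝ} (hA : ContDiff ℝ 2 A)
    (hB : ContDiff ℝ 2 B) (hBc : HasCompactSupport B) (v : EuclideanSpace ℝ (Fin m)) :
    ∫ y, A y * fderiv ℝ (fun z => fderiv ℝ B z v) y v =
      ∫ y, fderiv ℝ (fun z => fderiv ℝ A z v) y v * B y := by
  rw [integral_mul_fderiv_eq_neg (hA.of_le (by norm_num))
    (contDiff_fderiv_apply_const hB (by norm_num) v) (hBc.fderiv_apply ℝ v),
    integral_mul_fderiv_eq_neg (contDiff_fderiv_apply_const hA (by norm_num) v)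
      (hB.of_le (by norm_num)) hBc, neg_neg]

end IntegrationByParts

section Regularization

variable {n : ℕ}

/-- The regularised power `(‖x - y‖² + ε²)^p`. -/
noncomputable def regPow (ε p : ℝ) (x : EuclideanSpace ℝ (Fin (n + 1))) (y : EuclideanSpace ℝ (Fin (n + 1))) : ℝ :=
  (‖y - x‖ ^ 2 + ε ^ 2) ^ p

lemma contDiff_regPow {ε : ℝ} (hε : 0 < ε) (p : ℝ) (x : EuclideanSpace ℝ (Fin (n + 1))) {k : WithTop ℕ∞} :
    ContDiff ℝ k (regPow ε p x) := by
  unfold regPow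
  refine ContDiff.rpow_const_of_ne ?_ fun y => by positivity
  exact ((contDiff_id.sub contDiff_const).norm_sq ℝ).add contDiff_const

lemma fderiv_regPow {ε : ℝ} (hε : 0 < ε) (p : ℝ) (x y v : EuclideanSpace ℝ (Fin (n + 1))) :
    fderiv ℝ (regPow ε p x) y v = 2 * p * ⟪y - x, v⟫ * regPow ε (p - 1) x y := by
  have h1 : HasFDerivAt (fun y : EuclideanSpace ℝ (Fin (n + 1)) => ‖y - x‖ ^ 2 + ε ^ 2)
      (2 • innerSL ℝ (y - x)) y := by
    have := (hasStrictFDerivAt_norm_sq (y - x)).hasFDerivAt.comp y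
      ((hasFDerivAt_id y).sub_const x)
    simpa [Function.comp_def] using this.add_const (ε ^ 2)
  have h2 := (h1.rpow_const (p := p) (Or.inl (by positivity))).fderiv
  unfold regPow
  rw [h2]
  simp only [_root_.smul_apply, smul_eq_mul, innerSL_apply_apply, nsmul_eq_mul]
  push_cast
  ring

lemma fderiv_fderiv_regPow {ε : ℝ} (hε : 0 < ε) (p : ℝ) (x y v : EuclideanSpace ℝ (Fin (n + 1))) :
    fderiv ℝ (fun z => fderiv ℝ (regPow ε p x) z v) y v =
      2 * p * (‖v‖ ^ 2 * regPow ε (p - 1) x y +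
        2 * (p - 1) * ⟪y - x, v⟫ ^ 2 * regPow ε (p - 2) x y) := by
  simp only [fderiv_regPow hε]
  have h1 : HasFDerivAt (fun z : EuclideanSpace ℝ (Fin (n + 1)) => 2 * p * ⟪z - x, v⟫)
      ((2 * p) • innerSL ℝ v) y := by
    have : (fun z : EuclideanSpace ℝ (Fin (n + 1)) => 2 * p * ⟪z - x, v⟫) =
        fun z => ((2 * p) • innerSL ℝ v) z - ((2 * p) • innerSL ℝ v) x := by
      ext z
      rw [← map_sub, _root_.smul_apply, innerSL_apply_apply, real_inner_comm,
        smul_eq_mul]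
    rw [this]
    exact (ContinuousLinearMap.hasFDerivAt _).sub_const _
  have h2 : HasFDerivAt (regPow ε (p - 1) x) (fderiv ℝ (regPow ε (p - 1) x) y) y :=
    ((contDiff_regPow hε (p - 1) x (k := 1)).differentiable one_ne_zero y).hasFDerivAt
  have h3 := (h1.mul h2).fderiv
  simp only [Pi.mul_def] at h3
  rw [h3]
  simp only [_root_.add_apply, _root_.smul_apply, smul_eq_mul,
    fderiv_regPow hε, innerSL_apply_apply, real_inner_self_eq_norm_sq]
  rw [show p - 1 - 1 = p - 2 by ring]
  ring

lemma regPow_add_one {ε : ℝ} (hε : 0 < ε) (p : ℝ) (x y : EuclideanSpace ℝ (Fin (n + 1))) :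
    regPow ε (p + 1) x y = (‖y - x‖ ^ 2 + ε ^ 2) * regPow ε p x y := by
  unfold regPow
  rw [Real.rpow_add_one (by positivity), mul_comm]

/-- The regularised Newtonian kernel. -/
noncomputable def regKer (ε : ℝ) (x : EuclideanSpace ℝ (Fin (n + 1))) :
    EuclideanSpace ℝ (Fin (n + 1)) → ℝ :=
  regPow ε (-((n : ℝ) - 1) / 2) x

/-- The approximate identity `-(n-1)⁻¹ Δ (regKer ε x)`. -/
noncomputable def approxId (ε : ℝ) (x : EuclideanSpace ℝ (Fin (n + 1))) :
    EuclideanSpace ℝ (Fin (n + 1)) → ℝ :=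
  fun y => (n + 1) * ε ^ 2 * regPow ε (-((n : ℝ) + 3) / 2) x y

lemma laplacian_regKer {ε : ℝ} (hε : 0 < ε) (x y : EuclideanSpace ℝ (Fin (n + 1))) :
    laplacian (regKer ε x) y = -((n : ℝ) - 1) * approxId ε x y := by
  unfold laplacian regKer approxId
  simp only [fderiv_fderiv_regPow hε]
  have hs : ∑ i : Fin (n + 1), ⟪y - x, EuclideanSpace.single i (1 : ℝ)⟫ ^ 2 = ‖y - x‖ ^ 2 := by
    rw [EuclideanSpace.real_norm_sq_eq]
    simp [EuclideanSpace.inner_single_right]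
  simp only [PiLp.norm_single, norm_one, one_pow, one_mul]
  rw [← Finset.mul_sum, Finset.sum_add_distrib, ← Finset.sum_mul, ← Finset.mul_sum, hs]
  rw [show -((n : ℝ) - 1) / 2 - 1 = -((n : ℝ) + 3) / 2 + 1 by ring, regPow_add_one hε,
    show -((n : ℝ) - 1) / 2 - 2 = -((n : ℝ) + 3) / 2 by ring]
  simp
  ring

lemma abs_fderiv_fderiv_regKer_le (hn : 1 ≤ n) {ε : ℝ} (hε : 0 < ε) {x y v : EuclideanSpace ℝ (Fin (n + 1))}
    (hv : ‖v‖ = 1) (hxy : y ≠ x) :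
    |fderiv ℝ (fun z => fderiv ℝ (regKer ε x) z v) y v| ≤
      (n - 1) * n * (‖y - x‖ ^ (n + 1))⁻¹ := by
  unfold regKer
  have hn' : (1 : ℝ) ≤ n := by exact_mod_cast hn
  have hd : 0 < ‖y - x‖ := norm_pos_iff.2 (sub_ne_zero.2 hxy)
  rw [fderiv_fderiv_regPow hε, show -((n : ℝ) - 1) / 2 - 1 = -((n : ℝ) + 3) / 2 + 1 by ring,
    show -((n : ℝ) - 1) / 2 - 2 = -((n : ℝ) + 3) / 2 by ring, hv]
  have hi : ⟪y - x, v⟫ ^ 2 ≤ ‖y - x‖ ^ 2 := by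
    have := abs_real_inner_le_norm (y - x) v
    rw [hv, mul_one] at this
    exact sq_le_sq' (by linarith [abs_le.1 this]) (abs_le.1 this).2
  have hq : regPow ε (-((n : ℝ) + 3) / 2 + 1) x y ≤ (‖y - x‖ ^ (n + 1))⁻¹ := by
    unfold regPow
    have e : (‖y - x‖ ^ (n + 1))⁻¹ = (‖y - x‖ ^ 2) ^ (-((n : ℝ) + 3) / 2 + 1) := by
      rw [← Real.rpow_natCast, ← Real.rpow_natCast, ← Real.rpow_neg hd.le, ← Real.rpow_mul hd.le]
      congr 1; push_cast; ring
    rw [e]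
    refine Real.rpow_le_rpow_of_nonpos (by positivity) (by nlinarith) (by linarith)
  have hr := regPow_add_one hε (-((n : ℝ) + 3) / 2) x y
  have hr0 : 0 ≤ regPow ε (-((n : ℝ) + 3) / 2) x y := by unfold regPow; positivity
  have h0 : 0 ≤ ⟪y - x, v⟫ ^ 2 := sq_nonneg _
  generalize regPow ε (-((n : ℝ) + 3) / 2) x y = r at *
  generalize regPow ε (-((n : ℝ) + 3) / 2 + 1) x y = q at *
  generalize ⟪y - x, v⟫ ^ 2 = t at *
  have hir : t * r ≤ q := by rw [hr]; nlinarith [sq_nonneg ε]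
  have htr : 0 ≤ t * r := by positivity
  have : 2 * (-((n : ℝ) - 1) / 2) * (1 ^ 2 * q + 2 * (-((n : ℝ) + 3) / 2 + 1) * t * r) =
      ((n : ℝ) - 1) * ((n + 1) * (t * r) - q) := by ring
  rw [this, abs_mul, abs_of_nonneg (by linarith), mul_assoc]
  refine mul_le_mul_of_nonneg_left ?_ (by linarith)
  refine (abs_le.2 ⟨?_, ?_⟩ : _ ≤ (n : ℝ) * q).trans (by gcongr)
  · nlinarith
  · nlinarith

end Regularization

section ApproximateIdentity

open Filter Topology

variable {n : ℕ}

lemma omega_n_eq (n : ℕ) : omega_n n =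
    (n + 1) * (volume : Measure (EuclideanSpace ℝ (Fin (n + 1)))).real (ball 0 1) := by
  have h := Measure.toSphere_real_apply_univ (volume : Measure (EuclideanSpace ℝ (Fin (n + 1))))
  rw [finrank_euclideanSpace_fin] at h
  unfold omega_n
  rw [Measure.real] at h
  rw [h]
  push_cast
  ring

lemma omega_n_pos (n : ℕ) : 0 < omega_n n := by
  rw [omega_n_eq]
  have : 0 < (volume : Measure (EuclideanSpace ℝ (Fin (n + 1)))).real (ball 0 1) :=
    ENNReal.toReal_pos (measure_ball_pos _ _ one_pos).ne' measure_ball_lt_top.ne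
  positivity

lemma integral_one_add_sq_rpow (n : ℕ) :
    ∫ r in Ioi (0 : ℝ), (n + 1) * (r ^ n * (r ^ 2 + 1) ^ (-((n : ℝ) + 3) / 2)) = 1 := by
  have hderiv : ∀ r ∈ Ici (0 : ℝ), HasDerivAt
      (fun r : ℝ => r ^ (n + 1) * (r ^ 2 + 1) ^ (-((n : ℝ) + 1) / 2))
      ((n + 1) * (r ^ n * (r ^ 2 + 1) ^ (-((n : ℝ) + 3) / 2))) r := by
    intro r _
    have h1 : HasDerivAt (fun r : ℝ => r ^ 2 + 1) (2 * r) r := by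
      simpa using (hasDerivAt_pow 2 r).add_const (1 : ℝ)
    have h0 : (0 : ℝ) < r ^ 2 + 1 := by positivity
    have h2 := (hasDerivAt_pow (n + 1) r).mul
      (h1.rpow_const (p := -((n : ℝ) + 1) / 2) (Or.inl h0.ne'))
    refine h2.congr_deriv ?_
    rw [show -((n : ℝ) + 1) / 2 = -((n : ℝ) + 3) / 2 + 1 by ring, Real.rpow_add_one h0.ne',
      add_sub_cancel_right]
    simp only [Nat.add_sub_cancel]
    push_cast
    ring
  have hlim : Tendsto (fun r : ℝ => r ^ (n + 1) * (r ^ 2 + 1) ^ (-((n : ℝ) + 1) / 2)) atTop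
      (𝓝 1) := by
    have h1 : Tendsto (fun r : ℝ => (1 + (r⁻¹) ^ 2) ^ (-((n : ℝ) + 1) / 2)) atTop (𝓝 1) := by
      have h2 : Tendsto (fun r : ℝ => 1 + (r⁻¹) ^ 2) atTop (𝓝 (1 + 0 ^ 2)) :=
        (tendsto_inv_atTop_zero.pow 2).const_add 1
      have := h2.rpow_const (p := -((n : ℝ) + 1) / 2) (Or.inl (by norm_num))
      simpa using this
    refine h1.congr' ?_
    filter_upwards [eventually_gt_atTop 0] with r hr
    have e : r ^ 2 + 1 = r ^ 2 * (1 + (r⁻¹) ^ 2) := by field_simp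
    have e2 : (r ^ 2) ^ (-((n : ℝ) + 1) / 2) = (r ^ (n + 1))⁻¹ := by
      rw [← Real.rpow_natCast, ← Real.rpow_natCast, ← Real.rpow_neg hr.le, ← Real.rpow_mul hr.le]
      congr 1; push_cast; ring
    rw [e, Real.mul_rpow (by positivity) (by positivity), e2]
    field_simp
  have := integral_Ioi_of_hasDerivAt_of_nonneg' (a := (0 : ℝ)) hderiv
    (fun r hr => by have : (0 : ℝ) < r := hr; positivity) hlim
  simpa using this

lemma integral_approxId_one (n : ℕ) :
    ∫ z : EuclideanSpace ℝ (Fin (n + 1)), (n + 1) * (‖z‖ ^ 2 + 1) ^ (-((n : ℝ) + 3) / 2) =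
      omega_n n := by
  have h := integral_fun_norm_addHaar (volume : Measure (EuclideanSpace ℝ (Fin (n + 1))))
    (fun r : ℝ => (n + 1) * (r ^ 2 + 1) ^ (-((n : ℝ) + 3) / 2))
  rw [h, finrank_euclideanSpace_fin, omega_n_eq]
  simp only [Nat.add_sub_cancel, smul_eq_mul, nsmul_eq_mul]
  have h1 := integral_one_add_sq_rpow n
  have h2 : ∀ r : ℝ, r ^ n * ((n + 1) * (r ^ 2 + 1) ^ (-((n : ℝ) + 3) / 2)) =
    (n + 1) * (r ^ n * (r ^ 2 + 1) ^ (-((n : ℝ) + 3) / 2)) := fun r => by ring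
  simp only [h2, h1]
  push_cast
  ring

lemma integrable_approxId_one (n : ℕ) :
    Integrable fun z : EuclideanSpace ℝ (Fin (n + 1)) =>
      ((n : ℝ) + 1) * (‖z‖ ^ 2 + 1) ^ (-((n : ℝ) + 3) / 2) := by
  have := integrable_rpow_neg_one_add_norm_sq (E := EuclideanSpace ℝ (Fin (n + 1)))
    (μ := volume) (r := (n : ℝ) + 3) (by simp)
  refine (this.const_mul ((n : ℝ) + 1)).congr (ae_of_all _ fun z => ?_)
  simp only [add_comm]

lemma tendsto_integral_approxId {ψ : EuclideanSpace ℝ (Fin (n + 1)) → ℝ} (hψ : Continuous ψ)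
    (hψc : HasCompactSupport ψ) (x : EuclideanSpace ℝ (Fin (n + 1))) :
    Tendsto (fun ε => ∫ y, approxId ε x y * ψ y) (𝓝[>] 0) (𝓝 (omega_n n * ψ x)) := by
  obtain ⟨C, hC⟩ := hψc.exists_bound_of_continuous hψ
  have key : Tendsto (fun ε : ℝ => ∫ z : EuclideanSpace ℝ (Fin (n + 1)),
      (((n : ℝ) + 1) * (‖z‖ ^ 2 + 1) ^ (-((n : ℝ) + 3) / 2)) * ψ (x + ε • z)) (𝓝[>] 0)
      (𝓝 (∫ z : EuclideanSpace ℝ (Fin (n + 1)),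
        (((n : ℝ) + 1) * (‖z‖ ^ 2 + 1) ^ (-((n : ℝ) + 3) / 2)) * ψ x)) := by
    refine tendsto_integral_filter_of_dominated_convergence
      (fun z => ((n : ℝ) + 1) * (‖z‖ ^ 2 + 1) ^ (-((n : ℝ) + 3) / 2) * C) ?_ ?_
      ((integrable_approxId_one n).mul_const C) ?_
    · refine Eventually.of_forall fun ε => ?_
      exact (integrable_approxId_one n).aestronglyMeasurable.mul
        (by fun_prop : Continuous fun z => ψ (x + ε • z)).aestronglyMeasurable
    · refine Eventually.of_forall fun ε => ae_of_all _ fun z => ?_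
      rw [norm_mul, Real.norm_of_nonneg (by positivity)]
      gcongr
      exact hC _
    · refine ae_of_all _ fun z => ?_
      have : Tendsto (fun ε : ℝ => ψ (x + ε • z)) (𝓝[>] 0) (𝓝 (ψ (x + (0 : ℝ) • z))) :=
        ((by fun_prop : Continuous fun ε : ℝ => ψ (x + ε • z)).tendsto 0).mono_left
          nhdsWithin_le_nhds
      simpa using this.const_mul _
  rw [integral_mul_const, integral_approxId_one] at key
  refine key.congr' ?_
  filter_upwards [self_mem_nhdsWithin] with ε hε
  have hε : 0 < ε := hε
  rw [← integral_add_left_eq_self (fun y => approxId ε x y * ψ y) x]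
  have h2 := Measure.integral_comp_smul (volume : Measure (EuclideanSpace ℝ (Fin (n + 1))))
    (fun y => approxId ε x (x + y) * ψ (x + y)) ε
  rw [finrank_euclideanSpace_fin, abs_of_pos (by positivity)] at h2
  rw [inv_smul_eq_iff₀ (by positivity) |>.1 h2.symm]
  rw [← integral_smul]
  refine integral_congr_ae (ae_of_all _ fun z => ?_)
  simp only [approxId, regPow, add_sub_cancel_left, norm_smul, smul_eq_mul, Real.norm_of_nonneg hε.le]
  have e : (ε * ‖z‖) ^ 2 + ε ^ 2 = ε ^ 2 * (‖z‖ ^ 2 + 1) := by ring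
  have e2 : (ε ^ 2) ^ (-((n : ℝ) + 3) / 2) = (ε ^ (n + 3))⁻¹ := by
    rw [← Real.rpow_natCast, ← Real.rpow_natCast, ← Real.rpow_neg hε.le, ← Real.rpow_mul hε.le]
    congr 1; push_cast; ring
  rw [e, Real.mul_rpow (by positivity) (by positivity), e2]
  field_simp
  ring

end ApproximateIdentity

section Newton

open Filter Topology

variable {n : ℕ}

lemma continuous_fderiv_fderiv_apply {φ : EuclideanSpace ℝ (Fin (n + 1)) → ℝ}
    (hφ : ContDiff ℝ 2 φ) (v w : EuclideanSpace ℝ (Fin (n + 1))) :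
    Continuous fun y => fderiv ℝ (fun z => fderiv ℝ φ z v) y w :=
  (contDiff_fderiv_apply_const (k := 0) (contDiff_fderiv_apply_const (k := 1) hφ (by norm_num) v)
    (by norm_num) w).continuous

lemma continuous_laplacian {φ : EuclideanSpace ℝ (Fin (n + 1)) → ℝ}
    (hφ : ContDiff ℝ 2 φ) : Continuous (laplacian φ) :=
  continuous_finsetSum _ fun _ _ => continuous_fderiv_fderiv_apply hφ _ _

lemma tsupport_laplacian_subset {φ : EuclideanSpace ℝ (Fin (n + 1)) → ℝ} :
    tsupport (laplacian φ) ⊆ tsupport φ := by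
  refine closure_minimal (fun x hx => ?_) (isClosed_tsupport φ)
  by_contra hx'
  have h : ∀ i, x ∉ tsupport fun y => fderiv ℝ (fun z => fderiv ℝ φ z (EuclideanSpace.single i 1))
      y (EuclideanSpace.single i (1 : ℝ)) := fun _ hi => hx'
    (tsupport_fderiv_apply_subset ℝ _ (tsupport_fderiv_apply_subset ℝ _ hi))
  exact hx (Finset.sum_eq_zero fun i _ => image_eq_zero_of_notMem_tsupport
    (f := fun y => fderiv ℝ (fun z => fderiv ℝ φ z (EuclideanSpace.single i 1)) y
      (EuclideanSpace.single i (1 : ℝ))) (h i))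

lemma hasCompactSupport_laplacian {φ : EuclideanSpace ℝ (Fin (n + 1)) → ℝ}
    (hφ : HasCompactSupport φ) : HasCompactSupport (laplacian φ) :=
  hφ.mono' (subset_closure.trans tsupport_laplacian_subset)

lemma integral_regKer_mul_laplacian {φ : EuclideanSpace ℝ (Fin (n + 1)) → ℝ}
    (hφ : ContDiff ℝ 2 φ) (hφc : HasCompactSupport φ) (x : EuclideanSpace ℝ (Fin (n + 1)))
    {ε : ℝ} (hε : 0 < ε) :
    ∫ y, regKer ε x y * laplacian φ y = -((n : ℝ) - 1) * ∫ y, approxId ε x y * φ y := by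
  have hk : ContDiff ℝ 4 (regKer ε x) := contDiff_regPow hε _ x
  have hi (v : EuclideanSpace ℝ (Fin (n + 1))) : Integrable fun y =>
      regKer ε x y * fderiv ℝ (fun z => fderiv ℝ φ z v) y v :=
    (hk.continuous.mul (continuous_fderiv_fderiv_apply hφ v v)).integrable_of_hasCompactSupport
      ((hφc.fderiv_apply ℝ v).fderiv_apply ℝ v).mul_left
  have hi' (v : EuclideanSpace ℝ (Fin (n + 1))) : Integrable fun y =>
      fderiv ℝ (fun z => fderiv ℝ (regKer ε x) z v) y v * φ y :=
    ((continuous_fderiv_fderiv_apply (hk.of_le (by norm_num)) v v).mul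
      hφ.continuous).integrable_of_hasCompactSupport hφc.mul_left
  have h1 : ∫ y, regKer ε x y * laplacian φ y = ∫ y, laplacian (regKer ε x) y * φ y := by
    simp only [laplacian, Finset.mul_sum, Finset.sum_mul]
    rw [integral_finsetSum _ fun i _ => hi _, integral_finsetSum _ fun i _ => hi' _]
    exact Finset.sum_congr rfl fun i _ =>
      integral_mul_fderiv_fderiv (hk.of_le (by norm_num)) hφ hφc _
  rw [h1, ← integral_const_mul]
  simp only [laplacian_regKer hε, mul_assoc]

lemma integral_fderiv_regKer_mul_laplacian {φ : EuclideanSpace ℝ (Fin (n + 1)) → ℝ}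
    (hφ : ContDiff ℝ 2 φ) (hφc : HasCompactSupport φ) (x v : EuclideanSpace ℝ (Fin (n + 1)))
    {ε : ℝ} (hε : 0 < ε) :
    ∫ y, fderiv ℝ (fun z => fderiv ℝ (regKer ε x) z v) y v * laplacian φ y =
      -((n : ℝ) - 1) * ∫ y, approxId ε x y * fderiv ℝ (fun z => fderiv ℝ φ z v) y v := by
  have hk : ContDiff ℝ 4 (regKer ε x) := contDiff_regPow hε _ x
  have hi (v w : EuclideanSpace ℝ (Fin (n + 1))) : Integrable fun y =>
      fderiv ℝ (fun z => fderiv ℝ (regKer ε x) z v) y v * fderiv ℝ (fun z => fderiv ℝ φ z w) y w :=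
    ((continuous_fderiv_fderiv_apply (hk.of_le (by norm_num)) v v).mul
      (continuous_fderiv_fderiv_apply hφ w w)).integrable_of_hasCompactSupport
      ((hφc.fderiv_apply ℝ w).fderiv_apply ℝ w).mul_left
  have h1 : ∫ y, fderiv ℝ (fun z => fderiv ℝ (regKer ε x) z v) y v * laplacian φ y =
      ∫ y, laplacian (regKer ε x) y * fderiv ℝ (fun z => fderiv ℝ φ z v) y v := by
    simp only [laplacian, Finset.mul_sum, Finset.sum_mul]
    rw [integral_finsetSum _ fun i _ => hi _ _, integral_finsetSum _ fun i _ => hi _ _]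
    exact Finset.sum_congr rfl fun i _ => integral_fderiv_fderiv_mul_swap hk hφ hφc _ _
  rw [h1, ← integral_const_mul]
  simp only [laplacian_regKer hε, mul_assoc]

lemma integrable_riesz_mul {ψ : EuclideanSpace ℝ (Fin (n + 1)) → ℝ} (hψ : Continuous ψ)
    (hψc : HasCompactSupport ψ) (x : EuclideanSpace ℝ (Fin (n + 1))) {a : ℝ}
    (ha : a < n + 1) :
    Integrable fun y => ‖x - y‖ ^ (-a) * ψ y := by
  obtain ⟨C, hC⟩ := hψc.exists_bound_of_continuous hψ
  obtain ⟨R, hR⟩ := hψc.isCompact.isBounded.subset_ball x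
  have h1 := (integrableOn_ball_norm_sub_rpow (m := n + 1) (by omega) (by simpa using ha) R x)
  have h2 : IntegrableOn (fun y => ‖x - y‖ ^ (-a) * ψ y) (ball x R) := by
    refine (h1.mul_const C).mono' (h1.aestronglyMeasurable.mul hψ.aestronglyMeasurable) ?_
    refine ae_of_all _ fun y => ?_
    rw [norm_mul, Real.norm_of_nonneg (by positivity)]
    gcongr
    exact hC _
  refine h2.integrable_of_forall_notMem_eq_zero fun y hy => ?_
  rw [image_eq_zero_of_notMem_tsupport fun h => hy (hR h), mul_zero]

/-- The Newtonian potential of the Laplacian of a test function. -/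
lemma integral_riesz_mul_laplacian (hn : 1 ≤ n) {φ : EuclideanSpace ℝ (Fin (n + 1)) → ℝ}
    (hφ : ContDiff ℝ 2 φ) (hφc : HasCompactSupport φ) (x : EuclideanSpace ℝ (Fin (n + 1))) :
    ∫ y, ‖x - y‖ ^ (-((n : ℝ) - 1)) * laplacian φ y = -((n : ℝ) - 1) * omega_n n * φ x := by
  have hn' : (1 : ℝ) ≤ n := by exact_mod_cast hn
  have hl := continuous_laplacian hφ
  have hlc := hasCompactSupport_laplacian hφc
  have h1 : Tendsto (fun ε => ∫ y, regKer ε x y * laplacian φ y) (𝓝[>] 0)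
      (𝓝 (∫ y, ‖x - y‖ ^ (-((n : ℝ) - 1)) * laplacian φ y)) := by
    have hx : ∀ᵐ y : EuclideanSpace ℝ (Fin (n + 1)), y ≠ x := by
      simp [ae_iff]
    refine tendsto_integral_filter_of_dominated_convergence
      (fun y => ‖‖x - y‖ ^ (-((n : ℝ) - 1)) * laplacian φ y‖) ?_ ?_
      (integrable_riesz_mul hl hlc x (by linarith)).norm ?_
    · filter_upwards [self_mem_nhdsWithin] with ε hε
      exact ((contDiff_regPow hε _ x (k := 0)).continuous.mul hl).aestronglyMeasurable
    · filter_upwards [self_mem_nhdsWithin] with ε hε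
      have hε : 0 < ε := hε
      filter_upwards [hx] with y hy
      have hd : 0 < ‖x - y‖ := norm_pos_iff.2 (sub_ne_zero.2 hy.symm)
      rw [norm_mul, norm_mul]
      gcongr
      unfold regKer regPow
      rw [Real.norm_of_nonneg (by positivity), Real.norm_of_nonneg (by positivity), norm_sub_rev]
      have e : ‖x - y‖ ^ (-((n : ℝ) - 1)) = (‖x - y‖ ^ 2) ^ (-((n : ℝ) - 1) / 2) := by
        rw [← Real.rpow_natCast, ← Real.rpow_mul hd.le]; congr 1; push_cast; ring
      rw [e]
      exact Real.rpow_le_rpow_of_nonpos (by positivity) (by nlinarith) (by linarith)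
    · filter_upwards [hx] with y hy
      have hd : 0 < ‖x - y‖ := norm_pos_iff.2 (sub_ne_zero.2 hy.symm)
      have e : ‖x - y‖ ^ (-((n : ℝ) - 1)) = (‖x - y‖ ^ 2 + 0 ^ 2) ^ (-((n : ℝ) - 1) / 2) := by
        rw [zero_pow two_ne_zero, add_zero, ← Real.rpow_natCast, ← Real.rpow_mul hd.le]
        congr 1; push_cast; ring
      rw [e]
      refine Tendsto.mul_const _ ?_
      unfold regKer regPow
      rw [norm_sub_rev]
      refine Tendsto.mono_left ?_ nhdsWithin_le_nhds
      refine Tendsto.rpow_const ?_ (Or.inl (by positivity))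
      exact (by fun_prop : Continuous fun ε : ℝ => ‖x - y‖ ^ 2 + ε ^ 2).tendsto 0
  have h2 : Tendsto (fun ε => ∫ y, regKer ε x y * laplacian φ y) (𝓝[>] 0)
      (𝓝 (-((n : ℝ) - 1) * (omega_n n * φ x))) := by
    refine ((tendsto_integral_approxId hφ.continuous hφc x).const_mul _).congr' ?_
    filter_upwards [self_mem_nhdsWithin] with ε hε
    exact (integral_regKer_mul_laplacian hφ hφc x hε).symm
  rw [tendsto_nhds_unique h1 h2]
  ring

/-- A pointwise bound for pure second derivatives through the singular integral of the
Laplacian. -/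
lemma omega_mul_abs_fderiv_fderiv_le (hn : 2 ≤ n) {φ : EuclideanSpace ℝ (Fin (n + 1)) → ℝ}
    (hφ : ContDiff ℝ 2 φ) (hφc : HasCompactSupport φ) {x v : EuclideanSpace ℝ (Fin (n + 1))}
    (hv : ‖v‖ = 1) {B : EuclideanSpace ℝ (Fin (n + 1)) → ℝ} (hB : Integrable B)
    (hle : ∀ᵐ y, (‖y - x‖ ^ (n + 1))⁻¹ * |laplacian φ y| ≤ B y) :
    omega_n n * |fderiv ℝ (fun z => fderiv ℝ φ z v) x v| ≤ n * ∫ y, B y := by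
  have hn' : (2 : ℝ) ≤ n := by exact_mod_cast hn
  have h1 := (tendsto_integral_approxId (continuous_fderiv_fderiv_apply hφ v v)
    ((hφc.fderiv_apply ℝ v).fderiv_apply ℝ v) x).abs
  rw [abs_mul, abs_of_pos (omega_n_pos n)] at h1
  refine le_of_tendsto h1 ?_
  filter_upwards [self_mem_nhdsWithin] with ε hε
  have hx : ∀ᵐ y : EuclideanSpace ℝ (Fin (n + 1)), y ≠ x := by simp [ae_iff]
  have h2 := integral_fderiv_regKer_mul_laplacian hφ hφc x v hε
  have h3 : |∫ y, fderiv ℝ (fun z => fderiv ℝ (regKer ε x) z v) y v * laplacian φ y| ≤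
      ((n : ℝ) - 1) * n * ∫ y, B y := by
    rw [← integral_const_mul, ← Real.norm_eq_abs]
    refine norm_integral_le_of_norm_le (hB.const_mul _) ?_
    filter_upwards [hx, hle] with y hy hBy
    rw [norm_mul, Real.norm_eq_abs, Real.norm_eq_abs]
    calc _ ≤ ((n - 1) * n * (‖y - x‖ ^ (n + 1))⁻¹) * |laplacian φ y| := by
          gcongr; exact abs_fderiv_fderiv_regKer_le (by omega) hε hv hy
      _ = (n - 1) * n * ((‖y - x‖ ^ (n + 1))⁻¹ * |laplacian φ y|) := by ring
      _ ≤ _ := by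
          have : (0 : ℝ) ≤ n - 1 := by linarith
          gcongr
  rw [h2, abs_mul, abs_neg, abs_of_pos (by linarith), mul_assoc] at h3
  exact le_of_mul_le_mul_left h3 (by linarith)

end Newton

section Cutoff

open Filter Topology

variable {m : ℕ}

lemma contDiff_radial_mul {k : WithTop ℕ∞} {w : EuclideanSpace ℝ (Fin m) → ℝ} {τ : ℝ → ℝ} {K : ℝ}
    (hτ : ContDiff ℝ k τ) (hK : ∀ t, K ≤ |t| → τ t = 0) (hw : ContDiffOn ℝ k w {0}ᶜ)
    (hw0 : w 0 = 0) : ContDiff ℝ k fun z => τ (Real.log ‖z‖) * w z := by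
  rw [contDiff_iff_contDiffAt]
  intro x
  rcases eq_or_ne x 0 with rfl | hx
  · have : (fun z => τ (Real.log ‖z‖) * w z) =ᶠ[𝓝 0] fun _ => 0 := by
      filter_upwards [ball_mem_nhds 0 (Real.exp_pos (-|K|))] with z hz
      rcases eq_or_ne z 0 with rfl | hz0
      · rw [hw0, mul_zero]
      · have h1 : Real.log ‖z‖ < -|K| := by
          rw [Real.log_lt_iff_lt_exp (norm_pos_iff.2 hz0)]
          simpa using hz
        rw [hK, zero_mul]
        rw [abs_of_neg (by linarith [abs_nonneg K])]
        linarith [le_abs_self K]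
    exact contDiffAt_const.congr_of_eventuallyEq this
  · exact (hτ.contDiffAt.comp x (contDiffAt_log_norm hx)).mul
      (hw.contDiffAt (isOpen_compl_singleton.mem_nhds hx))

lemma hasCompactSupport_radial_mul {w : EuclideanSpace ℝ (Fin m) → ℝ} {τ : ℝ → ℝ} {K : ℝ}
    (hK : ∀ t, K ≤ |t| → τ t = 0) :
    HasCompactSupport fun z => τ (Real.log ‖z‖) * w z := by
  refine HasCompactSupport.intro (isCompact_closedBall 0 (Real.exp |K|)) fun z hz => ?_
  have hz : Real.exp |K| < ‖z‖ := by simpa using hz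
  have h1 : |K| < Real.log ‖z‖ := by
    rwa [Real.lt_log_iff_exp_lt ((Real.exp_pos _).trans hz)]
  rw [hK, zero_mul]
  exact (le_abs_self K).trans (h1.le.trans (le_abs_self _))

/-- Euler's relation for homogeneous functions. -/
lemma fderiv_self_of_homogeneous {w : EuclideanSpace ℝ (Fin m) → ℝ} {s : ℝ}
    (hw : ∀ t : ℝ, 0 < t → ∀ y, y ≠ 0 → w (t • y) = t ^ s * w y)
    {y : EuclideanSpace ℝ (Fin m)} (hy : y ≠ 0) (hd : DifferentiableAt ℝ w y) :
    fderiv ℝ w y y = s * w y := by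
  have h1 : HasDerivAt (fun t : ℝ => t • y) y 1 := by
    simpa using (hasDerivAt_id (1 : ℝ)).smul_const y
  have hd' : HasFDerivAt w (fderiv ℝ w y) ((1 : ℝ) • y) := by
    rw [one_smul]; exact hd.hasFDerivAt
  have h2 : HasDerivAt (fun t : ℝ => w (t • y)) (fderiv ℝ w y y) 1 :=
    hd'.comp_hasDerivAt (1 : ℝ) h1
  have h3 : HasDerivAt (fun t : ℝ => t ^ s * w y) (s * 1 ^ (s - 1) * w y) 1 :=
    (Real.hasDerivAt_rpow_const (p := s) (Or.inl one_ne_zero)).mul_const _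
  have h4 : (fun t : ℝ => w (t • y)) =ᶠ[𝓝 1] fun t : ℝ => t ^ s * w y := by
    filter_upwards [lt_mem_nhds one_pos] with t ht
    exact hw t ht y hy
  simpa using h2.unique (h3.congr_of_eventuallyEq h4)

lemma isLocalMax_deriv_deriv_nonpos {h : ℝ → ℝ} {a : ℝ} (hmax : IsLocalMax h a)
    (hc : ContinuousAt h a) : deriv (deriv h) a ≤ 0 := by
  by_contra! hpos
  have hmin := isLocalMin_of_deriv_deriv_pos hpos hmax.deriv_eq_zero hc
  have hconst : h =ᶠ[𝓝 a] fun _ => h a := by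
    filter_upwards [hmax, hmin] with t h1 h2
    exact le_antisymm h1 h2
  have := (hconst.deriv).deriv_eq
  simp at this
  linarith

lemma fderiv_fderiv_nonpos_of_isLocalMax {h : EuclideanSpace ℝ (Fin m) → ℝ}
    {x : EuclideanSpace ℝ (Fin m)} (hh : ContDiffAt ℝ 2 h x) (hmax : IsLocalMax h x)
    (v : EuclideanSpace ℝ (Fin m)) : fderiv ℝ (fderiv ℝ h) x v v ≤ 0 := by
  have hline : ContinuousAt (fun t : ℝ => x + t • v) 0 := by fun_prop
  have hx0 : x + (0 : ℝ) • v = x := by simp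
  have hev : ∀ᶠ t in 𝓝 (0 : ℝ), ContDiffAt ℝ 2 h (x + t • v) := by
    have := hh.eventually (by simp)
    rw [← hx0] at this
    exact hline.eventually this
  have h1 : deriv (fun t : ℝ => h (x + t • v)) =ᶠ[𝓝 0] fun t => fderiv ℝ h (x + t • v) v := by
    filter_upwards [hev] with t ht
    exact (hasDerivAt_comp_line (ht.differentiableAt (by norm_num))).deriv
  have h2 : deriv (deriv fun t : ℝ => h (x + t • v)) 0 = fderiv ℝ (fderiv ℝ h) x v v := by
    rw [h1.deriv_eq, (hasDerivAt_fderiv_comp_line (s := 0) (by simpa using hh)).deriv, hx0]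
  rw [← h2]
  refine isLocalMax_deriv_deriv_nonpos ?_
    (hasDerivAt_comp_line (s := 0) (by simpa using hh.differentiableAt (by norm_num))).continuousAt
  have : Tendsto (fun t : ℝ => x + t • v) (𝓝 0) (𝓝 x) := by simpa [ContinuousAt] using hline
  filter_upwards [this.eventually hmax] with t ht
  simpa using ht

lemma laplacian_nonpos_of_isLocalMax {h : EuclideanSpace ℝ (Fin m) → ℝ}
    {x : EuclideanSpace ℝ (Fin m)} (hh : ContDiffAt ℝ 2 h x) (hmax : IsLocalMax h x) :
    laplacian h x ≤ 0 := by
  rw [laplacian_eq_sum_single hh]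
  exact Finset.sum_nonpos fun i _ => fderiv_fderiv_nonpos_of_isLocalMax hh hmax _

lemma laplacian_sub {u v : EuclideanSpace ℝ (Fin m) → ℝ} {x : EuclideanSpace ℝ (Fin m)}
    (hu : ContDiffAt ℝ 2 u x) (hv : ContDiffAt ℝ 2 v x) (q : ℝ) :
    laplacian (fun y => u y - q * v y) x = laplacian u x - q * laplacian v x := by
  have h := hu.eventually (by simp)
  have h' := hv.eventually (by simp)
  have key (i) : fderiv ℝ (fun y => fderiv ℝ (fun y => u y - q * v y) y (EuclideanSpace.single i 1)) x
      (EuclideanSpace.single i 1) =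
      fderiv ℝ (fun y => fderiv ℝ u y (EuclideanSpace.single i 1)) x (EuclideanSpace.single i 1) -
      q * fderiv ℝ (fun y => fderiv ℝ v y (EuclideanSpace.single i 1)) x
        (EuclideanSpace.single i 1) := by
    set e := EuclideanSpace.single i (1 : ℝ)
    have h1 : (fun y => fderiv ℝ (fun y => u y - q * v y) y e) =ᶠ[𝓝 x]
        fun y => fderiv ℝ u y e - q * fderiv ℝ v y e := by
      filter_upwards [h, h'] with y hy hy'
      have := ((hy.differentiableAt (by norm_num)).hasFDerivAt.sub
        ((hy'.differentiableAt (by norm_num)).hasFDerivAt.const_mul q)).fderiv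
      simp only [Pi.sub_def] at this
      rw [this]
      simp
    have hu2 : DifferentiableAt ℝ (fun y => fderiv ℝ u y e) x :=
      (differentiableAt_fderiv_of_contDiffAt_two hu).clm_apply (differentiableAt_const _)
    have hv2 : DifferentiableAt ℝ (fun y => fderiv ℝ v y e) x :=
      (differentiableAt_fderiv_of_contDiffAt_two hv).clm_apply (differentiableAt_const _)
    have := (hu2.hasFDerivAt.sub (hv2.hasFDerivAt.const_mul q)).fderiv
    simp only [Pi.sub_def] at this
    rw [h1.fderiv_eq, this]
    simp
  unfold laplacian
  simp only [key, Finset.sum_sub_distrib, Finset.mul_sum]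

/-- Two positive functions of degree one are compared through their potentials `Δu / u`. -/
lemma exists_sphere_laplacian_div_le (hm : 1 ≤ m) {u v g h : EuclideanSpace ℝ (Fin m) → ℝ}
    (hu : ContDiffOn ℝ 2 u {0}ᶜ) (hv : ContDiffOn ℝ 2 v {0}ᶜ)
    (hupos : ∀ y ≠ 0, 0 < u y) (hvpos : ∀ y ≠ 0, 0 < v y)
    (huhom : ∀ t : ℝ, 0 < t → ∀ y, y ≠ 0 → u (t • y) = t * u y)
    (hvhom : ∀ t : ℝ, 0 < t → ∀ y, y ≠ 0 → v (t • y) = t * v y)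
    (hug : ∀ y ≠ 0, laplacian u y = g y * u y) (hvh : ∀ y ≠ 0, laplacian v y = h y * v y) :
    ∃ x ∈ sphere (0 : EuclideanSpace ℝ (Fin m)) 1, g x ≤ h x := by
  have hne : ∀ x ∈ sphere (0 : EuclideanSpace ℝ (Fin m)) 1, x ≠ 0 := fun x hx =>
    ne_zero_of_mem_unit_sphere ⟨x, hx⟩
  have hnonempty : (sphere (0 : EuclideanSpace ℝ (Fin m)) 1).Nonempty :=
    ⟨EuclideanSpace.single ⟨0, hm⟩ 1, by simp⟩
  have hcont : ContinuousOn (fun x => u x / v x) (sphere (0 : EuclideanSpace ℝ (Fin m)) 1) :=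
    (hu.continuousOn.mono hne).div (hv.continuousOn.mono hne) fun x hx => (hvpos x (hne x hx)).ne'
  obtain ⟨x, hx, hmax⟩ := (isCompact_sphere 0 1).exists_isMaxOn hnonempty hcont
  have hx0 := hne x hx
  refine ⟨x, hx, ?_⟩
  set q := u x / v x
  have hle : ∀ y ≠ 0, u y - q * v y ≤ 0 := by
    intro y hy
    have hyn : 0 < ‖y‖ := norm_pos_iff.2 hy
    have hs : ‖y‖⁻¹ • y ∈ sphere (0 : EuclideanSpace ℝ (Fin m)) 1 := by
      simp [norm_smul, hyn.ne']
    have := hmax hs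
    simp only [mem_ofPred_eq] at this
    rw [huhom _ (by positivity) y hy, hvhom _ (by positivity) y hy,
      mul_div_mul_left _ _ (by positivity), div_le_iff₀ (hvpos y hy)] at this
    linarith
  have hqx : u x - q * v x = 0 := by
    simp only [q]
    rw [div_mul_cancel₀ _ (hvpos x hx0).ne', sub_self]
  have hnhds : {0}ᶜ ∈ 𝓝 x := isOpen_compl_singleton.mem_nhds hx0
  have hlm : IsLocalMax (fun y => u y - q * v y) x := by
    filter_upwards [hnhds] with y hy
    rw [hqx]; exact hle y hy
  have h1 := laplacian_nonpos_of_isLocalMax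
    ((hu.contDiffAt hnhds).sub (contDiffAt_const.mul (hv.contDiffAt hnhds))) hlm
  rw [laplacian_sub (hu.contDiffAt hnhds) (hv.contDiffAt hnhds), hug x hx0, hvh x hx0] at h1
  have : q * v x = u x := by linarith
  have h2 : (g x - h x) * u x ≤ 0 := by rw [← this] at h1 ⊢; linarith
  have := nonpos_of_mul_nonpos_left h2 (hupos x hx0)
  linarith

end Cutoff

section Proportional

open Filter Topology

variable {m : ℕ}

lemma integral_fderiv_apply_eq_zero {F : EuclideanSpace ℝ (Fin m) → ℝ} (hF : ContDiff ℝ 1 F)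
    (hFc : HasCompactSupport F) (v : EuclideanSpace ℝ (Fin m)) : ∫ y, fderiv ℝ F y v = 0 := by
  have := integral_mul_fderiv_eq_neg (A := fun _ => 1) contDiff_const hF hFc v
  simpa using this

lemma fderiv_eq_smul_of_laplacian_eq {u v h : EuclideanSpace ℝ (Fin m) → ℝ}
    (hu : ContDiffOn ℝ 2 u {0}ᶜ) (hv : ContDiffOn ℝ 2 v {0}ᶜ)
    (hupos : ∀ y ≠ 0, 0 < u y) (hv0 : v 0 = 0)
    (huhom : ∀ t : ℝ, 0 < t → ∀ y, y ≠ 0 → u (t • y) = t * u y)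
    (hvhom : ∀ t : ℝ, 0 < t → ∀ y, y ≠ 0 → v (t • y) = t * v y)
    (huh : ∀ y ≠ 0, laplacian u y = h y * u y) (hvh : ∀ y ≠ 0, laplacian v y = h y * v y)
    {x : EuclideanSpace ℝ (Fin m)} (hx : x ≠ 0) :
    fderiv ℝ v x = (v x / u x) • fderiv ℝ u x := by
  have huat : ∀ y ≠ 0, ContDiffAt ℝ 2 u y := fun y hy =>
    hu.contDiffAt (isOpen_compl_singleton.mem_nhds hy)
  have hvat : ∀ y ≠ 0, ContDiffAt ℝ 2 v y := fun y hy =>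
    hv.contDiffAt (isOpen_compl_singleton.mem_nhds hy)
  let e : Fin m → EuclideanSpace ℝ (Fin m) := fun i => EuclideanSpace.single i 1
  let W : Fin m → EuclideanSpace ℝ (Fin m) → ℝ := fun i z =>
    v z * fderiv ℝ v z (e i) - v z ^ 2 / u z * fderiv ℝ u z (e i)
  have hW (i) : ContDiffOn ℝ 1 (W i) {0}ᶜ := by
    intro y hy
    have h1 := (huat y hy).of_le (m := 1) (by norm_num)
    have h2 := (hvat y hy).of_le (m := 1) (by norm_num)
    have h3 : ContDiffAt ℝ 1 (fun z => fderiv ℝ u z (e i)) y :=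
      ((huat y hy).fderiv_right (m := 1) (by norm_num)).clm_apply contDiffAt_const
    have h4 : ContDiffAt ℝ 1 (fun z => fderiv ℝ v z (e i)) y :=
      ((hvat y hy).fderiv_right (m := 1) (by norm_num)).clm_apply contDiffAt_const
    exact ((h2.mul h4).sub (((h2.pow 2).div h1 (hupos y hy).ne').mul h3)).contDiffWithinAt
  have hW0 (i) : W i 0 = 0 := by simp [W, hv0]
  let b : ContDiffBump (0 : ℝ) := ⟨|Real.log ‖x‖| + 1, |Real.log ‖x‖| + 2, by positivity, by linarith⟩
  have hb : ContDiff ℝ 1 b := b.contDiff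
  have hK : ∀ t, |Real.log ‖x‖| + 2 ≤ |t| → b t = 0 := fun t ht => by
    apply b.zero_of_le_dist
    simpa [b] using ht
  let F : Fin m → EuclideanSpace ℝ (Fin m) → ℝ := fun i z => b (Real.log ‖z‖) * W i z
  have hF (i) : ContDiff ℝ 1 (F i) := contDiff_radial_mul hb hK (hW i) (hW0 i)
  have hFc (i) : HasCompactSupport (F i) := hasCompactSupport_radial_mul hK
  let D : EuclideanSpace ℝ (Fin m) → ℝ := fun z => ∑ i, fderiv ℝ (F i) z (e i)
  have hDcont (i) : Continuous fun z => fderiv ℝ (F i) z (e i) :=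
    ((hF i).continuous_fderiv one_ne_zero).clm_apply continuous_const
  have hDint (i) : Integrable fun z => fderiv ℝ (F i) z (e i) :=
    (hDcont i).integrable_of_hasCompactSupport ((hFc i).fderiv_apply ℝ _)
  have hD0 : ∫ z, D z = 0 := by
    simp only [D]
    rw [integral_finsetSum _ fun i _ => hDint i]
    exact Finset.sum_eq_zero fun i _ => integral_fderiv_apply_eq_zero (hF i) (hFc i) _
  have hDz : ∀ z ≠ 0, D z =
      b (Real.log ‖z‖) * ∑ i, (fderiv ℝ v z (e i) - v z / u z * fderiv ℝ u z (e i)) ^ 2 := by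
    intro z hz
    have hu1 := (huat z hz).differentiableAt (by norm_num)
    have hv1 := (hvat z hz).differentiableAt (by norm_num)
    have hu0 := (hupos z hz).ne'
    have hWd (i) : fderiv ℝ (W i) z (e i) =
        (fderiv ℝ v z (e i) - v z / u z * fderiv ℝ u z (e i)) ^ 2 +
        (v z * fderiv ℝ (fun y => fderiv ℝ v y (e i)) z (e i) -
          v z ^ 2 / u z * fderiv ℝ (fun y => fderiv ℝ u y (e i)) z (e i)) := by
      have h3 : DifferentiableAt ℝ (fun z => fderiv ℝ u z (e i)) z :=
        (differentiableAt_fderiv_of_contDiffAt_two (huat z hz)).clm_apply (differentiableAt_const _)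
      have h4 : DifferentiableAt ℝ (fun z => fderiv ℝ v z (e i)) z :=
        (differentiableAt_fderiv_of_contDiffAt_two (hvat z hz)).clm_apply (differentiableAt_const _)
      have hl : HasDerivAt (fun t : ℝ => z + t • e i) (e i) 0 := by
        simpa using ((hasDerivAt_id (0 : ℝ)).smul_const (e i)).const_add z
      have aux {g : EuclideanSpace ℝ (Fin m) → ℝ} (hg : DifferentiableAt ℝ g z) :
          HasDerivAt (fun t : ℝ => g (z + t • e i)) (fderiv ℝ g z (e i)) 0 := by
        simpa using hasDerivAt_comp_line (x := z) (v := e i) (s := 0) (by simpa using hg)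
      have h5 := (((aux hv1).mul (aux h4)).sub
        ((((aux hv1).pow 2).div (aux hu1) (by simpa using hu0)).mul (aux h3)))
      have h6 := aux (((hW i).contDiffAt (isOpen_compl_singleton.mem_nhds hz)).differentiableAt
        one_ne_zero)
      have h7 := h6.unique h5
      rw [h7]
      simp
      field_simp
      ring
    have hsum : ∀ L : EuclideanSpace ℝ (Fin m) →L[ℝ] ℝ, ∑ i, ⟪z, e i⟫ * L (e i) = L z := by
      intro L
      conv_rhs => rw [← (EuclideanSpace.basisFun (Fin m) ℝ).sum_repr z]
      rw [map_sum]
      refine Finset.sum_congr rfl fun i _ => ?_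
      rw [map_smul, EuclideanSpace.basisFun_apply, smul_eq_mul, EuclideanSpace.basisFun_repr]
      simp [e, EuclideanSpace.inner_single_right]
    have hrad : ∑ i, ⟪z, e i⟫ * W i z = 0 := by
      have h1 : fderiv ℝ u z z = u z := by
        simpa using fderiv_self_of_homogeneous (s := 1) (by simpa using huhom) hz hu1
      have h2 : fderiv ℝ v z z = v z := by
        simpa using fderiv_self_of_homogeneous (s := 1) (by simpa using hvhom) hz hv1
      have h3 := hsum (v z • fderiv ℝ v z - (v z ^ 2 / u z) • fderiv ℝ u z)
      simp only [_root_.sub_apply, _root_.smul_apply, smul_eq_mul, h1, h2] at h3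
      rw [show ∑ i, ⟪z, e i⟫ * W i z = _ from h3]
      field_simp
      ring
    have hDi (i) : fderiv ℝ (F i) z (e i) =
        deriv b (Real.log ‖z‖) * (‖z‖ ^ 2)⁻¹ * (⟪z, e i⟫ * W i z) +
          b (Real.log ‖z‖) * fderiv ℝ (W i) z (e i) := by
      rw [fderiv_radial_mul (hb.differentiable one_ne_zero) hz
        (((hW i).contDiffAt (isOpen_compl_singleton.mem_nhds hz)).differentiableAt one_ne_zero)]
      ring
    have hlu : ∑ i, fderiv ℝ (fun y => fderiv ℝ u y (e i)) z (e i) = h z * u z := huh z hz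
    have hlv : ∑ i, fderiv ℝ (fun y => fderiv ℝ v y (e i)) z (e i) = h z * v z := hvh z hz
    simp only [D, hDi, hWd, Finset.sum_add_distrib, ← Finset.mul_sum, hrad, Finset.sum_sub_distrib,
      hlu, hlv]
    have he : v z * (h z * v z) - v z ^ 2 / u z * (h z * u z) = 0 := by
      field_simp
      ring
    rw [he]
    ring
  have hne : ∀ᵐ z : EuclideanSpace ℝ (Fin m), z ≠ 0 := by
    have : Nontrivial (EuclideanSpace ℝ (Fin m)) := ⟨x, 0, hx⟩
    simp [ae_iff]
  have hDnn : 0 ≤ᵐ[volume] D := by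
    filter_upwards [hne] with z hz
    rw [hDz z hz]
    exact mul_nonneg b.nonneg (Finset.sum_nonneg fun i _ => sq_nonneg _)
  have hDi : Integrable D := integrable_finsetSum _ fun i _ => hDint i
  have hDae := (integral_eq_zero_iff_of_nonneg_ae hDnn hDi).1 hD0
  have hDc : Continuous D := continuous_finsetSum _ fun i _ => hDcont i
  have hDx : D x = 0 := congrFun ((hDc.ae_eq_iff_eq volume continuous_const).1 hDae) x
  rw [hDz x hx, b.one_of_mem_closedBall (by simp [b]), one_mul,
    Finset.sum_eq_zero_iff_of_nonneg fun i _ => sq_nonneg _] at hDx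
  refine ContinuousLinearMap.coe_injective
    ((EuclideanSpace.basisFun (Fin m) ℝ).toBasis.ext fun i => ?_)
  have := pow_eq_zero_iff two_ne_zero |>.1 (hDx i (Finset.mem_univ i))
  simp only [OrthonormalBasis.coe_toBasis, EuclideanSpace.basisFun_apply,
    ContinuousLinearMap.coe_coe, _root_.smul_apply, smul_eq_mul]
  simp only [e] at this
  linarith

/-- Positive solutions of degree one of the same linear equation are proportional. -/
lemma exists_eq_const_mul_of_laplacian_eq (hm : 2 ≤ m) {u v h : EuclideanSpace ℝ (Fin m) → ℝ}
    (hu : ContDiffOn ℝ 2 u {0}ᶜ) (hv : ContDiffOn ℝ 2 v {0}ᶜ)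
    (hupos : ∀ y ≠ 0, 0 < u y) (hvpos : ∀ y ≠ 0, 0 < v y) (hu0 : u 0 = 0) (hv0 : v 0 = 0)
    (huhom : ∀ t : ℝ, 0 < t → ∀ y, y ≠ 0 → u (t • y) = t * u y)
    (hvhom : ∀ t : ℝ, 0 < t → ∀ y, y ≠ 0 → v (t • y) = t * v y)
    (huh : ∀ y ≠ 0, laplacian u y = h y * u y) (hvh : ∀ y ≠ 0, laplacian v y = h y * v y) :
    ∃ c : ℝ, 0 < c ∧ ∀ x, v x = c * u x := by
  have hconn : IsPreconnected ({0}ᶜ : Set (EuclideanSpace ℝ (Fin m))) := by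
    refine (isConnected_compl_singleton_of_one_lt_rank ?_ 0).isPreconnected
    rw [← Module.finrank_eq_rank, finrank_euclideanSpace_fin]
    exact_mod_cast hm
  have hdu : ∀ y ≠ 0, DifferentiableAt ℝ u y := fun y hy =>
    (hu.contDiffAt (isOpen_compl_singleton.mem_nhds hy)).differentiableAt (by norm_num)
  have hdv : ∀ y ≠ 0, DifferentiableAt ℝ v y := fun y hy =>
    (hv.contDiffAt (isOpen_compl_singleton.mem_nhds hy)).differentiableAt (by norm_num)
  have hd : ∀ y ≠ 0, HasFDerivAt (fun z => v z * (u z)⁻¹)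
      (0 : EuclideanSpace ℝ (Fin m) →L[ℝ] ℝ) y := by
    intro y hy
    have h1 := (hdv y hy).hasFDerivAt.mul
      ((hasDerivAt_inv (hupos y hy).ne').comp_hasFDerivAt y (hdu y hy).hasFDerivAt)
    refine h1.congr_fderiv ?_
    rw [fderiv_eq_smul_of_laplacian_eq hu hv hupos hv0 huhom hvhom huh hvh hy]
    ext w
    have := (hupos y hy).ne'
    simp
    field_simp
    ring
  let x₀ : EuclideanSpace ℝ (Fin m) := EuclideanSpace.single ⟨0, by omega⟩ 1
  have hx₀ : x₀ ≠ 0 := by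
    rw [← norm_pos_iff]; simp [x₀]
  refine ⟨v x₀ * (u x₀)⁻¹, mul_pos (hvpos _ hx₀) (inv_pos.2 (hupos _ hx₀)), fun x => ?_⟩
  rcases eq_or_ne x 0 with rfl | hx
  · rw [hu0, hv0, mul_zero]
  · have := isOpen_compl_singleton.is_const_of_fderiv_eq_zero (𝕜 := ℝ)
      (f := fun z => v z * (u z)⁻¹) hconn
      (fun y hy => (hd y hy).differentiableAt.differentiableWithinAt)
      (fun y hy => (hd y hy).fderiv) hx hx₀
    rw [← this, inv_mul_cancel_right₀ (hupos x hx).ne']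

end Proportional

section Angle

open InnerProductGeometry

variable {V : Type*} [NormedAddCommGroup V] [InnerProductSpace ℝ V]

lemma norm_sub_eq_two_sin {x y : V} (hx : ‖x‖ = 1) (hy : ‖y‖ = 1) :
    ‖x - y‖ = 2 * Real.sin (angle x y / 2) := by
  have h0 := angle_nonneg x y
  have h1 := angle_le_pi x y
  have hs : 0 ≤ Real.sin (angle x y / 2) :=
    Real.sin_nonneg_of_nonneg_of_le_pi (by linarith) (by linarith)
  rw [← sq_eq_sq₀ (norm_nonneg _) (by positivity), norm_sub_sq_real, hx, hy,
    ← cos_angle_mul_norm_mul_norm, hx, hy]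
  have hc := Real.cos_two_mul (angle x y / 2)
  rw [mul_div_cancel₀ _ (two_ne_zero)] at hc
  have := Real.sin_sq_add_cos_sq (angle x y / 2)
  rw [hc]
  linarith

lemma angle_le_pi_div_two_mul_norm_sub {x y : V} (hx : ‖x‖ = 1) (hy : ‖y‖ = 1) :
    angle x y ≤ Real.pi / 2 * ‖x - y‖ := by
  have h0 := angle_nonneg x y
  have h1 := angle_le_pi x y
  have h2 := Real.mul_le_sin (x := angle x y / 2) (by linarith) (by linarith)
  rw [norm_sub_eq_two_sin hx hy]
  have hp := Real.pi_pos
  rw [div_mul_eq_mul_div, div_le_iff₀ hp] at h2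
  linarith

lemma angle_le_pi_mul_norm_sub {x y : V} (hx : ‖x‖ = 1) (hy : y ≠ 0) :
    angle y x ≤ Real.pi * ‖y - x‖ := by
  have hyn : 0 < ‖y‖ := norm_pos_iff.2 hy
  have h1 : ‖‖y‖⁻¹ • y‖ = 1 := by simp [norm_smul, hyn.ne']
  have h2 := angle_le_pi_div_two_mul_norm_sub h1 hx
  rw [angle_smul_left_of_pos _ _ (inv_pos.2 hyn)] at h2
  have h3 : ‖‖y‖⁻¹ • y - x‖ ≤ 2 * ‖y - x‖ := by
    have e : ‖y‖⁻¹ • y - y = (‖y‖⁻¹ - 1) • y := by rw [sub_smul, one_smul]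
    have e2 : ‖‖y‖⁻¹ • y - y‖ = |1 - ‖y‖| := by
      rw [e, norm_smul, Real.norm_eq_abs, ← abs_of_pos hyn, ← abs_mul, abs_of_pos hyn, sub_mul,
        inv_mul_cancel₀ hyn.ne', one_mul]
    have e3 : |1 - ‖y‖| ≤ ‖y - x‖ := by
      rw [← hx, norm_sub_rev y x]; exact abs_norm_sub_norm_le x y
    calc ‖‖y‖⁻¹ • y - x‖ = ‖(‖y‖⁻¹ • y - y) + (y - x)‖ := by congr 1; abel
      _ ≤ ‖‖y‖⁻¹ • y - y‖ + ‖y - x‖ := norm_add_le _ _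
      _ ≤ _ := by rw [e2]; linarith
  nlinarith [Real.pi_pos]

end Angle

section Kernel

open InnerProductGeometry

variable {n : ℕ}

/-- The kernel whose total mass enters the constant `gammaConst n 1`. -/
noncomputable def angleKernel (x y : EuclideanSpace ℝ (Fin (n + 1))) : ℝ :=
  (‖y - x‖ ^ (n + 1))⁻¹ * ‖y‖⁻¹ * angle y x

lemma measurable_angle_right (x : EuclideanSpace ℝ (Fin (n + 1))) :
    Measurable fun y : EuclideanSpace ℝ (Fin (n + 1)) => angle y x := by
  unfold InnerProductGeometry.angle
  fun_prop

lemma measurable_angleKernel (x : EuclideanSpace ℝ (Fin (n + 1))) :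
    Measurable (angleKernel x) := by
  have := measurable_angle_right x
  unfold angleKernel
  fun_prop

lemma angleKernel_nonneg (x y : EuclideanSpace ℝ (Fin (n + 1))) : 0 ≤ angleKernel x y := by
  have := angle_nonneg y x
  unfold angleKernel
  positivity

lemma ae_ne_euclidean (x : EuclideanSpace ℝ (Fin (n + 1))) :
    ∀ᵐ y : EuclideanSpace ℝ (Fin (n + 1)), y ≠ x := by
  simp [ae_iff]

lemma integrable_angleKernel (hn : 1 ≤ n) {x : EuclideanSpace ℝ (Fin (n + 1))} (hx : ‖x‖ = 1) :
    Integrable (angleKernel x) := by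
  have hn' : (1 : ℝ) ≤ n := by exact_mod_cast hn
  have hx0 : x ≠ 0 := by rw [← norm_pos_iff, hx]; exact one_pos
  have h1 := integrable_riesz (m := n + 1) (by omega) (a := n + 1 / 2) (b := 1) (by positivity)
    (by push_cast; linarith) (by push_cast; linarith) (by push_cast; linarith) hx0
  refine (h1.const_mul Real.pi).mono' (measurable_angleKernel x).aestronglyMeasurable ?_
  filter_upwards [ae_ne_euclidean 0, ae_ne_euclidean x] with y hy hyx
  rw [Real.norm_of_nonneg (angleKernel_nonneg x y)]
  have hd : 0 < ‖y - x‖ := norm_pos_iff.2 (sub_ne_zero.2 hyx)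
  have hp := Real.pi_pos
  have hang : angle y x ≤ Real.pi * ‖y - x‖ ^ (1 / 2 : ℝ) := by
    rcases le_total ‖y - x‖ 1 with h | h
    · refine (angle_le_pi_mul_norm_sub hx hy).trans ?_
      gcongr
      exact Real.self_le_rpow_of_le_one hd.le h (by norm_num)
    · refine (angle_le_pi y x).trans ?_
      exact le_mul_of_one_le_right hp.le (Real.one_le_rpow h (by norm_num))
  have e : (‖y - x‖ ^ (n + 1))⁻¹ * ‖y - x‖ ^ (1 / 2 : ℝ) = ‖x - y‖ ^ (-((n : ℝ) + 1 / 2)) := by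
    rw [norm_sub_rev x y, ← Real.rpow_natCast, ← Real.rpow_neg hd.le, ← Real.rpow_add hd]
    congr 1; push_cast; ring
  unfold angleKernel
  calc _ ≤ (‖y - x‖ ^ (n + 1))⁻¹ * ‖y‖⁻¹ * (Real.pi * ‖y - x‖ ^ (1 / 2 : ℝ)) := by gcongr
    _ = Real.pi * (((‖y - x‖ ^ (n + 1))⁻¹ * ‖y - x‖ ^ (1 / 2 : ℝ)) * ‖y‖⁻¹) := by ring
    _ = _ := by rw [e, Real.rpow_neg_one]

lemma integral_angleKernel_eq {x x' : EuclideanSpace ℝ (Fin (n + 1))} (h : ‖x‖ = ‖x'‖) :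
    ∫ y, angleKernel x y = ∫ y, angleKernel x' y := by
  obtain ⟨R, rfl⟩ := exists_linearIsometryEquiv_apply_eq h
  rw [← R.measurePreserving.integral_comp R.toHomeomorph.measurableEmbedding
    (angleKernel (R x))]
  refine integral_congr_ae (ae_of_all _ fun y => ?_)
  simp only [angleKernel, ← map_sub, LinearIsometryEquiv.norm_map]
  congr 1
  exact (R.toLinearIsometry.angle_map y x).symm

lemma gammaConst_one_eq {x : EuclideanSpace ℝ (Fin (n + 1))} (hx : ‖x‖ = 1) :
    gammaConst n 1 = omega_n n / (n * (n + 1)) * (∫ y, angleKernel x y)⁻¹ := by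
  unfold gammaConst
  congr 2
  rw [integral_angleKernel_eq (x' := EuclideanSpace.single 0 1) (by simp [hx])]
  refine integral_congr_ae (ae_of_all _ fun y => ?_)
  simp only [angleKernel, Real.rpow_one, InnerProductGeometry.angle, real_inner_smul_left]
  congr 2
  simp
  ring

end Kernel

section HessianBound

open InnerProductGeometry Filter Topology

variable {n : ℕ}

lemma fderiv_norm_apply {y : EuclideanSpace ℝ (Fin (n + 1))} (hy : y ≠ 0)
    (v : EuclideanSpace ℝ (Fin (n + 1))) :
    fderiv ℝ (fun z : EuclideanSpace ℝ (Fin (n + 1)) => ‖z‖) y v = ⟪y, v⟫ * ‖y‖⁻¹ := by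
  have hyn : 0 < ‖y‖ := norm_pos_iff.2 hy
  have h1 := fderiv_radial_mul (τ := Real.exp) (w := fun _ => 1) Real.differentiable_exp hy
    (differentiableAt_const _) v
  have h2 : (fun z : EuclideanSpace ℝ (Fin (n + 1)) => Real.exp (Real.log ‖z‖) * 1) =ᶠ[𝓝 y]
      fun z => ‖z‖ := by
    filter_upwards [isOpen_compl_singleton.mem_nhds hy] with z hz
    rw [Real.exp_log (norm_pos_iff.2 hz), mul_one]
  rw [h2.fderiv_eq] at h1
  rw [h1]
  simp [Real.exp_log hyn]
  field_simp

lemma contDiffOn_norm_compl {k : WithTop ℕ∞} :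
    ContDiffOn ℝ k (fun z : EuclideanSpace ℝ (Fin (n + 1)) => ‖z‖) {0}ᶜ :=
  fun _ hy => (contDiffAt_norm ℝ hy).contDiffWithinAt

lemma laplacian_congr {u v : EuclideanSpace ℝ (Fin (n + 1)) → ℝ}
    {x : EuclideanSpace ℝ (Fin (n + 1))} (h : u =ᶠ[𝓝 x] v) : laplacian u x = laplacian v x := by
  unfold laplacian
  refine Finset.sum_congr rfl fun i _ => ?_
  have : (fun y => fderiv ℝ u y (EuclideanSpace.single i 1)) =ᶠ[𝓝 x]
      fun y => fderiv ℝ v y (EuclideanSpace.single i 1) := by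
    filter_upwards [h.fderiv (𝕜 := ℝ)] with y hy
    rw [hy]
  rw [this.fderiv_eq]

lemma laplacian_norm {y : EuclideanSpace ℝ (Fin (n + 1))} (hy : y ≠ 0) :
    laplacian (fun z : EuclideanSpace ℝ (Fin (n + 1)) => ‖z‖) y = n * ‖y‖⁻¹ := by
  have hyn : 0 < ‖y‖ := norm_pos_iff.2 hy
  have h1 := laplacian_radial_mul (τ := Real.exp) (w := fun _ => 1) (s := 0) Real.contDiff_exp
    contDiffOn_const (by simp) hy
  have h2 : (fun z : EuclideanSpace ℝ (Fin (n + 1)) => Real.exp (Real.log ‖z‖) * 1) =ᶠ[𝓝 y]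
      fun z => ‖z‖ := by
    filter_upwards [isOpen_compl_singleton.mem_nhds hy] with z hz
    rw [Real.exp_log (norm_pos_iff.2 hz), mul_one]
  rw [laplacian_congr h2] at h1
  rw [h1]
  simp [laplacian, Real.exp_log hyn]
  field_simp
  ring

lemma fderiv_fderiv_norm_apply_self {x e : EuclideanSpace ℝ (Fin (n + 1))} (hx : ‖x‖ = 1)
    (he : ‖e‖ = 1) (hxe : ⟪x, e⟫ = 0) :
    fderiv ℝ (fun z => fderiv ℝ (fun z : EuclideanSpace ℝ (Fin (n + 1)) => ‖z‖) z e) x e = 1 := by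
  have hx0 : x ≠ 0 := by rw [← norm_pos_iff, hx]; exact one_pos
  have h2 : (fun z => fderiv ℝ (fun z : EuclideanSpace ℝ (Fin (n + 1)) => ‖z‖) z e) =ᶠ[𝓝 x]
      fun z => ⟪e, z⟫ * ‖z‖⁻¹ := by
    filter_upwards [isOpen_compl_singleton.mem_nhds hx0] with z hz
    rw [fderiv_norm_apply hz, real_inner_comm]
  have hd : DifferentiableAt ℝ (fun z : EuclideanSpace ℝ (Fin (n + 1)) => ‖z‖) x :=
    (contDiffAt_norm ℝ hx0 (n := 1)).differentiableAt one_ne_zero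
  have hc := (innerSL ℝ e).hasFDerivAt (x := x)
  have h3 := (hc.mul ((hasDerivAt_inv (x := ‖x‖) (by rw [hx]; exact one_ne_zero)).comp_hasFDerivAt x
    hd.hasFDerivAt)).fderiv
  have h4 : (⇑(innerSL ℝ e) * ((fun y => y⁻¹) ∘ fun z : EuclideanSpace ℝ (Fin (n + 1)) => ‖z‖)) =
      fun z => ⟪e, z⟫ * ‖z‖⁻¹ := by
    ext z; simp
  rw [h4] at h3
  rw [h2.fderiv_eq, h3]
  have hxe' : ⟪e, x⟫ = 0 := (real_inner_comm x e).trans hxe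
  simp [he, hxe', hx]

end HessianBound

section LogCutoff

open Filter Topology

lemma exists_logCutoff : ∃ C : ℝ, 0 ≤ C ∧ ∀ R : ℝ, 1 ≤ R → ∃ τ : ℝ → ℝ, ContDiff ℝ 2 τ ∧
    (∀ t, 2 * R ≤ |t| → τ t = 0) ∧ (∀ t, 0 ≤ τ t ∧ τ t ≤ 1) ∧
    (∀ t, |t| < R → τ t = 1 ∧ deriv τ t = 0 ∧ deriv (deriv τ) t = 0) ∧
    (∀ t, |deriv τ t| ≤ C / R ∧ |deriv (deriv τ) t| ≤ C / R) := by
  let θ : ContDiffBump (0 : ℝ) := ⟨1, 2, one_pos, one_lt_two⟩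
  have hθ : ContDiff ℝ 2 θ := θ.contDiff
  have hd1 : ContDiff ℝ 1 (deriv θ) := hθ.deriv'
  have hd2 : ContDiff ℝ 0 (deriv (deriv θ)) := hd1.deriv'
  obtain ⟨C1, hC1⟩ := (θ.hasCompactSupport.deriv).exists_bound_of_continuous hd1.continuous
  obtain ⟨C2, hC2⟩ := (θ.hasCompactSupport.deriv.deriv).exists_bound_of_continuous hd2.continuous
  have hC1' := (norm_nonneg _).trans (hC1 0)
  have hC2' := (norm_nonneg _).trans (hC2 0)
  refine ⟨C1 + C2, by positivity, fun R hR => ?_⟩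
  have hR0 : 0 < R := by linarith
  have e1 : deriv (fun t => θ (R⁻¹ * t)) = fun t => R⁻¹ * deriv θ (R⁻¹ * t) := by
    ext t
    rw [deriv_comp_mul_left]; rfl
  have e2 : deriv (fun t => R⁻¹ * deriv θ (R⁻¹ * t)) =
      fun t => R⁻¹ * (R⁻¹ * deriv (deriv θ) (R⁻¹ * t)) := by
    ext t
    rw [deriv_const_mul_field, deriv_comp_mul_left]; rfl
  have hone : ∀ t, |t| < R → θ (R⁻¹ * t) = 1 := by
    intro t ht
    refine θ.one_of_mem_closedBall ?_
    simp only [mem_closedBall, dist_zero_right, norm_mul, Real.norm_eq_abs, abs_inv,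
      abs_of_pos hR0]
    rw [inv_mul_le_iff₀ hR0]
    simpa [θ] using ht.le
  refine ⟨fun t => θ (R⁻¹ * t), hθ.comp (contDiff_const.mul contDiff_id), fun t ht => ?_,
    fun t => ⟨θ.nonneg, θ.le_one⟩, fun t ht => ?_, fun t => ?_⟩
  · refine θ.zero_of_le_dist ?_
    simp only [dist_zero_right, norm_mul, Real.norm_eq_abs, abs_inv, abs_of_pos hR0]
    rw [le_inv_mul_iff₀ hR0]
    simpa [θ, mul_comm] using ht
  · have h1 : (fun t => θ (R⁻¹ * t)) =ᶠ[𝓝 t] fun _ => 1 := by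
      filter_upwards [(isOpen_lt continuous_abs continuous_const).mem_nhds ht] with s hs
      exact hone s hs
    refine ⟨hone t ht, by rw [h1.deriv_eq, deriv_const], ?_⟩
    rw [h1.deriv.deriv_eq]
    simp
  · have hi : R⁻¹ ≤ 1 := inv_le_one_of_one_le₀ hR
    have hi0 : 0 < R⁻¹ := inv_pos.2 hR0
    have b1 := hC1 (R⁻¹ * t)
    have b2 := hC2 (R⁻¹ * t)
    rw [Real.norm_eq_abs] at b1 b2
    rw [e1, e2, abs_mul, abs_mul, abs_mul, abs_of_pos hi0, div_eq_inv_mul]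
    constructor
    · gcongr
      linarith
    · gcongr
      nlinarith [abs_nonneg (deriv (deriv θ) (R⁻¹ * t))]

end LogCutoff

section HessianBound

open InnerProductGeometry Filter Topology

variable {n : ℕ}

lemma abs_log_lt_one {r : ℝ} (h1 : 1 / 2 < r) (h2 : r < 3 / 2) : |Real.log r| < 1 := by
  have hr : 0 < r := by linarith
  rw [abs_lt]
  constructor
  · have := Real.one_sub_inv_le_log_of_pos hr
    have h3 : r⁻¹ < 2 := by rw [inv_lt_comm₀ hr two_pos]; linarith
    linarith
  · have := Real.log_le_sub_one_of_pos hr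
    linarith

lemma exists_abs_le_mul_norm {w : EuclideanSpace ℝ (Fin (n + 1)) → ℝ}
    (hw : ContinuousOn w {0}ᶜ) (hhom : ∀ t : ℝ, 0 < t → ∀ y, y ≠ 0 → w (t • y) = t * w y) :
    ∃ W, 0 ≤ W ∧ ∀ y ≠ 0, |w y| ≤ W * ‖y‖ := by
  have hsub : sphere (0 : EuclideanSpace ℝ (Fin (n + 1))) 1 ⊆ {0}ᶜ := fun y hy => by
    rw [mem_sphere_zero_iff_norm] at hy
    intro h; rw [mem_singleton_iff.1 h] at hy; simp at hy
  obtain ⟨W, hW⟩ := (isCompact_sphere (0 : EuclideanSpace ℝ (Fin (n + 1))) 1).exists_bound_of_continuousOn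
    (hw.mono hsub)
  refine ⟨max W 0, le_max_right _ _, fun y hy => ?_⟩
  have hyn : 0 < ‖y‖ := norm_pos_iff.2 hy
  have h1 := hW (‖y‖⁻¹ • y) (by simp [norm_smul, hyn.ne'])
  rw [hhom _ (inv_pos.2 hyn) y hy, Real.norm_eq_abs, abs_mul, abs_of_pos (inv_pos.2 hyn),
    inv_mul_le_iff₀ hyn] at h1
  nlinarith [le_max_left W 0]

lemma omega_mul_abs_hessian_sub_le (hn : 2 ≤ n) {u g : EuclideanSpace ℝ (Fin (n + 1)) → ℝ} {G : ℝ}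
    (hu : ContDiffOn ℝ 2 u {0}ᶜ) (hu0 : u 0 = 0)
    (hhom : ∀ t : ℝ, 0 < t → ∀ y, y ≠ 0 → u (t • y) = t * u y)
    (hlap : ∀ y, y ≠ 0 → laplacian u y = g y)
    (hg : ∀ t : ℝ, 0 < t → ∀ y, y ≠ 0 → g (t • y) = t⁻¹ * g y)
    (hG : ∀ x y, ‖x‖ = 1 → ‖y‖ = 1 → |g y - g x| ≤ G * angle y x)
    {x e : EuclideanSpace ℝ (Fin (n + 1))} (hx : ‖x‖ = 1) (he : ‖e‖ = 1) (hxe : ⟪x, e⟫ = 0) :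
    omega_n n * |fderiv ℝ (fun z => fderiv ℝ u z e) x e - g x / n| ≤
      n * (G * ∫ y, angleKernel x y) := by
  have hn' : (2 : ℝ) ≤ n := by exact_mod_cast hn
  have hx0 : x ≠ 0 := by rw [← norm_pos_iff, hx]; exact one_pos
  obtain ⟨C, hC0, hC⟩ := exists_logCutoff
  set q : ℝ := g x / n with hq
  set w : EuclideanSpace ℝ (Fin (n + 1)) → ℝ := fun y => u y - q * ‖y‖ with hw
  have hwC : ContDiffOn ℝ 2 w {0}ᶜ := hu.sub (contDiffOn_const.mul contDiffOn_norm_compl)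
  have hw0 : w 0 = 0 := by simp [hw, hu0]
  have hwhom : ∀ t : ℝ, 0 < t → ∀ y, y ≠ 0 → w (t • y) = t * w y := by
    intro t ht y hy
    simp only [hw, hhom t ht y hy, norm_smul, Real.norm_of_nonneg ht.le]
    ring
  have hop : ∀ {y : EuclideanSpace ℝ (Fin (n + 1))}, y ≠ 0 → {0}ᶜ ∈ 𝓝 y := fun hy =>
    isOpen_compl_singleton.mem_nhds hy
  have hEu : ∀ y ≠ 0, fderiv ℝ w y y = 1 * w y := fun y hy =>
    fderiv_self_of_homogeneous (by simpa using hwhom) hy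
      ((hwC.contDiffAt (hop hy)).differentiableAt two_ne_zero)
  have hwlap : ∀ y ≠ 0, laplacian w y = g y - g x * ‖y‖⁻¹ := fun y hy => by
    rw [hw, laplacian_sub (hu.contDiffAt (hop hy)) (contDiffAt_norm ℝ hy), hlap y hy,
      laplacian_norm hy, hq]
    field_simp
  have hwlap' : ∀ y ≠ 0, |laplacian w y| ≤ G * (‖y‖⁻¹ * angle y x) := fun y hy => by
    have hyn : 0 < ‖y‖ := norm_pos_iff.2 hy
    have h1 := hg ‖y‖⁻¹ (inv_pos.2 hyn) y hy
    have h2 := hG x (‖y‖⁻¹ • y) hx (by simp [norm_smul, hyn.ne'])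
    rw [angle_smul_left_of_pos _ _ (inv_pos.2 hyn), h1, inv_inv] at h2
    have h3 : g y - g x * ‖y‖⁻¹ = ‖y‖⁻¹ * (‖y‖ * g y - g x) := by field_simp
    rw [hwlap y hy, h3, abs_mul, abs_of_pos (inv_pos.2 hyn)]
    calc _ ≤ ‖y‖⁻¹ * (G * angle y x) := by gcongr
      _ = _ := by ring
  obtain ⟨W, hW0, hW⟩ := exists_abs_le_mul_norm hwC.continuousOn hwhom
  set D : ℝ := (C + (n + 1) * C) * W with hD
  set J : ℝ := ∫ y, (ball x (1 / 2))ᶜ.indicator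
    (fun y => ‖x - y‖ ^ (-((n : ℝ) + 1)) * ‖y‖ ^ (-(1 : ℝ))) y with hJ
  have hJi : Integrable ((ball x (1 / 2))ᶜ.indicator
      (fun y => ‖x - y‖ ^ (-((n : ℝ) + 1)) * ‖y‖ ^ (-(1 : ℝ)))) := by
    rw [integrable_indicator_iff measurableSet_ball.compl]
    exact integrableOn_compl_ball_riesz (by omega) (by positivity)
      (by push_cast; linarith) (by push_cast; linarith) (by norm_num)
  have hai := integrable_angleKernel (n := n) (by omega) hx
  have key : ∀ R : ℝ, 1 ≤ R →
      omega_n n * |fderiv ℝ (fun z => fderiv ℝ u z e) x e - g x / n| ≤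
        n * (G * ∫ y, angleKernel x y) + n * (D * J) * R⁻¹ := by
    intro R hR
    have hR0 : 0 < R := by linarith
    obtain ⟨τ, hτ, hτ0, hτ1, hτR, hτd⟩ := hC R hR
    have hφ := contDiff_radial_mul hτ hτ0 hwC hw0
    have hφc := hasCompactSupport_radial_mul (w := w) hτ0
    have hB : Integrable fun y => G * angleKernel x y + D * R⁻¹ * (ball x (1 / 2))ᶜ.indicator
      (fun y => ‖x - y‖ ^ (-((n : ℝ) + 1)) * ‖y‖ ^ (-(1 : ℝ))) y :=
      (hai.const_mul G).add (hJi.const_mul _)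
    have hmain := omega_mul_abs_fderiv_fderiv_le hn hφ hφc (x := x) he hB ?_
    · have hnear : (fun z => τ (Real.log ‖z‖) * w z) =ᶠ[𝓝 x] w := by
        have hcont : ContinuousAt (fun z : EuclideanSpace ℝ (Fin (n + 1)) => |Real.log ‖z‖|) x :=
          ((contDiffAt_log_norm (k := 1) hx0).continuousAt).abs
        filter_upwards [hcont.eventually_lt continuousAt_const (by simp [hx] : |Real.log ‖x‖| < 1)]
          with z hz
        rw [(hτR _ (lt_of_lt_of_le hz hR)).1, one_mul]
      have hnear2 : (fun z => fderiv ℝ (fun z => τ (Real.log ‖z‖) * w z) z e) =ᶠ[𝓝 x]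
          fun z => fderiv ℝ u z e - q * fderiv ℝ (fun z => ‖z‖) z e := by
        filter_upwards [hnear.fderiv (𝕜 := ℝ), hop hx0] with z hz hz0
        rw [hz, hw]
        have d1 := (hu.contDiffAt (hop hz0)).differentiableAt two_ne_zero
        have d2 := (contDiffAt_norm ℝ hz0 (n := 1)).differentiableAt one_ne_zero
        rw [fderiv_fun_sub d1 (d2.const_mul q), fderiv_const_mul d2]
        simp
      have d1 := differentiableAt_fderiv_of_contDiffAt_two (hu.contDiffAt (hop hx0))
      have d2 := differentiableAt_fderiv_of_contDiffAt_two (contDiffAt_norm ℝ hx0 (n := 2))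
      have d1' := d1.clm_apply (differentiableAt_const e)
      have d2' := d2.clm_apply (differentiableAt_const e)
      have hval : fderiv ℝ (fun z => fderiv ℝ (fun z => τ (Real.log ‖z‖) * w z) z e) x e =
          fderiv ℝ (fun z => fderiv ℝ u z e) x e - q := by
        rw [hnear2.fderiv_eq, fderiv_fun_sub d1' (d2'.const_mul q), fderiv_const_mul d2']
        have := fderiv_fderiv_norm_apply_self hx he hxe
        simp [this]
      rw [hval, integral_add (hai.const_mul G) (hJi.const_mul _), integral_const_mul,
        integral_const_mul] at hmain
      refine hmain.trans (le_of_eq ?_)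
      ring
    · filter_upwards [ae_ne_euclidean 0, ae_ne_euclidean x] with y hy hyx
      have hyn : 0 < ‖y‖ := norm_pos_iff.2 hy
      have hd : 0 < ‖y - x‖ := norm_pos_iff.2 (sub_ne_zero.2 hyx)
      rw [laplacian_radial_mul hτ hwC hEu hy]
      set t := Real.log ‖y‖
      have h1 : |τ t * laplacian w y| ≤ G * (‖y‖⁻¹ * angle y x) := by
        rw [abs_mul, abs_of_nonneg (hτ1 t).1]
        exact (mul_le_of_le_one_left (abs_nonneg _) (hτ1 t).2).trans (hwlap' y hy)
      have h2 : (‖y - x‖ ^ (n + 1))⁻¹ * |(deriv (deriv τ) t + (n - 1 + 2 * 1) * deriv τ t) *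
          (‖y‖ ^ 2)⁻¹ * w y| ≤ D * R⁻¹ * (ball x (1 / 2))ᶜ.indicator
          (fun y => ‖x - y‖ ^ (-((n : ℝ) + 1)) * ‖y‖ ^ (-(1 : ℝ))) y := by
        by_cases hyb : y ∈ ball x (1 / 2)
        · rw [indicator_of_notMem (by simpa using hyb)]
          rw [mem_ball, dist_eq_norm] at hyb
          have a1 := abs_norm_sub_norm_le y x
          rw [hx] at a1
          have a2 := abs_lt.1 (a1.trans_lt hyb)
          have ht := abs_log_lt_one (r := ‖y‖) (by linarith) (by linarith)
          obtain ⟨-, z1, z2⟩ := hτR t (ht.trans_le hR)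
          simp [z1, z2]
        · rw [indicator_of_mem (by simpa using hyb)]
          have k1 : |deriv (deriv τ) t + (n - 1 + 2 * 1) * deriv τ t| ≤ (C + (n + 1) * C) * R⁻¹ := by
            refine (abs_add_le _ _).trans ?_
            rw [abs_mul, abs_of_nonneg (by linarith : (0 : ℝ) ≤ n - 1 + 2 * 1)]
            have := (hτd t).1
            have := (hτd t).2
            calc _ ≤ C / R + (n - 1 + 2 * 1) * (C / R) := by gcongr; linarith
              _ = _ := by ring
          have k2 : (‖y‖ ^ 2)⁻¹ * |w y| ≤ W * ‖y‖⁻¹ := by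
            calc _ ≤ (‖y‖ ^ 2)⁻¹ * (W * ‖y‖) := by gcongr; exact hW y hy
              _ = _ := by field_simp
          have k3 : ‖x - y‖ ^ (-((n : ℝ) + 1)) = (‖y - x‖ ^ (n + 1))⁻¹ := by
            rw [norm_sub_rev x y, Real.rpow_neg hd.le, ← Real.rpow_natCast]
            push_cast; rfl
          rw [k3, Real.rpow_neg_one, abs_mul, abs_mul, abs_of_pos (by positivity : 0 < (‖y‖ ^ 2)⁻¹),
            mul_assoc |_|]
          calc _ ≤ (‖y - x‖ ^ (n + 1))⁻¹ * (((C + (n + 1) * C) * R⁻¹) * (W * ‖y‖⁻¹)) := by gcongr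
            _ = _ := by rw [hD]; ring
      calc _ ≤ (‖y - x‖ ^ (n + 1))⁻¹ * (|τ t * laplacian w y| +
            |(deriv (deriv τ) t + (n - 1 + 2 * 1) * deriv τ t) * (‖y‖ ^ 2)⁻¹ * w y|) := by
            gcongr; exact abs_add_le _ _
        _ ≤ (‖y - x‖ ^ (n + 1))⁻¹ * (G * (‖y‖⁻¹ * angle y x)) + _ := by
            rw [mul_add]; exact add_le_add (by gcongr) h2
        _ = _ := by
            congr 1
            unfold angleKernel
            ring
  have hlim : Tendsto (fun R : ℝ => n * (G * ∫ y, angleKernel x y) + n * (D * J) * R⁻¹) atTop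
      (𝓝 (n * (G * ∫ y, angleKernel x y) + n * (D * J) * 0)) :=
    tendsto_const_nhds.add (tendsto_inv_atTop_zero.const_mul _)
  rw [mul_zero, add_zero] at hlim
  exact ge_of_tendsto hlim ((eventually_ge_atTop 1).mono key)

end HessianBound

section Convexity

open Filter Topology

variable {n : ℕ}

lemma fderiv_smul_of_homogeneous {m : ℕ} {w : EuclideanSpace ℝ (Fin m) → ℝ} {t c : ℝ}
    (hw : ∀ y, y ≠ 0 → w (t • y) = c * w y) {y : EuclideanSpace ℝ (Fin m)}
    (hy : y ≠ 0) (hd : DifferentiableAt ℝ w y) (v : EuclideanSpace ℝ (Fin m)) :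
    t * fderiv ℝ w (t • y) v = c * fderiv ℝ w y v := by
  have h1 : (fun z => w (t • z)) =ᶠ[𝓝 y] fun z => c * w z := by
    filter_upwards [isOpen_compl_singleton.mem_nhds hy] with z hz using hw z hz
  have h2 := congrArg (fun L : EuclideanSpace ℝ (Fin m) →L[ℝ] ℝ => L v) (h1.fderiv_eq (𝕜 := ℝ))
  rw [fderiv_const_mul hd] at h2
  have h3 := fderiv_comp_smul (f := w) (x := y) (𝕜 := ℝ) t
  simp only [h3] at h2
  simpa using h2

lemma hessian_nonneg_of_tangential {u : EuclideanSpace ℝ (Fin (n + 1)) → ℝ}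
    (hu : ContDiffOn ℝ 2 u {0}ᶜ)
    (hhom : ∀ t : ℝ, 0 < t → ∀ y, y ≠ 0 → u (t • y) = t * u y)
    (hess : ∀ x e : EuclideanSpace ℝ (Fin (n + 1)), ‖x‖ = 1 → ‖e‖ = 1 → ⟪x, e⟫ = 0 →
      0 ≤ fderiv ℝ (fderiv ℝ u) x e e)
    {x : EuclideanSpace ℝ (Fin (n + 1))} (hx : x ≠ 0) (v : EuclideanSpace ℝ (Fin (n + 1))) :
    0 ≤ fderiv ℝ (fderiv ℝ u) x v v := by
  have hC : ∀ {y : EuclideanSpace ℝ (Fin (n + 1))}, y ≠ 0 → ContDiffAt ℝ 2 u y := fun hy =>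
    hu.contDiffAt (isOpen_compl_singleton.mem_nhds hy)
  have hD : ∀ {y : EuclideanSpace ℝ (Fin (n + 1))}, y ≠ 0 → DifferentiableAt ℝ (fderiv ℝ u) y :=
    fun hy => differentiableAt_fderiv_of_contDiffAt_two (hC hy)
  have hd0 : ∀ v, ∀ t : ℝ, 0 < t → ∀ y, y ≠ 0 → fderiv ℝ u (t • y) v = 1 * fderiv ℝ u y v := by
    intro v t ht y hy
    have := fderiv_smul_of_homogeneous (hhom t ht) hy ((hC hy).differentiableAt two_ne_zero) v
    rw [one_mul]
    exact mul_left_cancel₀ ht.ne' this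
  have hap : ∀ {y : EuclideanSpace ℝ (Fin (n + 1))}, y ≠ 0 → ∀ v w,
      fderiv ℝ (fun z => fderiv ℝ u z v) y w = fderiv ℝ (fderiv ℝ u) y w v := fun hy v w => by
    rw [fderiv_clm_apply (hD hy) (differentiableAt_const _)]
    simp
  have hdiff : ∀ {y : EuclideanSpace ℝ (Fin (n + 1))}, y ≠ 0 → ∀ v,
      DifferentiableAt ℝ (fun z => fderiv ℝ u z v) y := fun hy v =>
    (hD hy).clm_apply (differentiableAt_const _)
  have hrad : ∀ {y : EuclideanSpace ℝ (Fin (n + 1))}, y ≠ 0 → ∀ v,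
      fderiv ℝ (fderiv ℝ u) y y v = 0 := fun hy v => by
    rw [← hap hy, fderiv_self_of_homogeneous (s := 0) (by simpa using hd0 v) hy (hdiff hy v),
      zero_mul]
  have hsymm : ∀ {y : EuclideanSpace ℝ (Fin (n + 1))}, y ≠ 0 → ∀ v w,
      fderiv ℝ (fderiv ℝ u) y v w = fderiv ℝ (fderiv ℝ u) y w v := fun hy v w =>
    (hC hy).isSymmSndFDerivAt (by simp) v w
  have hsph : ∀ x : EuclideanSpace ℝ (Fin (n + 1)), ‖x‖ = 1 → ∀ v,
      0 ≤ fderiv ℝ (fderiv ℝ u) x v v := by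
    intro x hx1 v
    have hx0 : x ≠ 0 := by rw [← norm_pos_iff, hx1]; exact one_pos
    set e' := v - ⟪x, v⟫ • x with he'
    have hv : v = ⟪x, v⟫ • x + e' := by simp [he']
    have horth : ⟪x, e'⟫ = 0 := by
      rw [he', inner_sub_right, real_inner_smul_right, real_inner_self_eq_norm_sq, hx1]
      ring
    have h1 : fderiv ℝ (fderiv ℝ u) x v v = fderiv ℝ (fderiv ℝ u) x e' e' := by
      rw [hv]
      simp only [map_add, map_smul, _root_.add_apply, _root_.smul_apply, hrad hx0,
        hsymm hx0 e' x]
      simp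
    rw [h1]
    rcases eq_or_ne e' 0 with h0 | h0
    · simp [h0]
    · have hn0 : 0 < ‖e'‖ := norm_pos_iff.2 h0
      have h2 := hess x (‖e'‖⁻¹ • e') hx1 (by simp [norm_smul, hn0.ne'])
        (by rw [real_inner_smul_right, horth, mul_zero])
      simp only [map_smul, _root_.smul_apply, smul_eq_mul] at h2
      have h3 : 0 < ‖e'‖⁻¹ := inv_pos.2 hn0
      exact nonneg_of_mul_nonneg_right (nonneg_of_mul_nonneg_right h2 h3) h3
  have hxn : 0 < ‖x‖ := norm_pos_iff.2 hx
  have h1 := fderiv_smul_of_homogeneous (hd0 v _ (inv_pos.2 hxn)) hx (hdiff hx v) v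
  have hxs : ‖x‖⁻¹ • x ≠ 0 := smul_ne_zero (inv_pos.2 hxn).ne' hx
  rw [hap hx, hap hxs, one_mul] at h1
  rw [← h1]
  exact mul_nonneg (inv_pos.2 hxn).le (hsph _ (by simp [norm_smul, hxn.ne']) v)

lemma exists_forall_line_ne_zero (hn : 2 ≤ n) (x y : EuclideanSpace ℝ (Fin (n + 1))) :
    ∃ e : EuclideanSpace ℝ (Fin (n + 1)), ∀ ε : ℝ, ε ≠ 0 → ∀ s : ℝ,
      x + ε • e + s • (y - x) ≠ 0 := by
  have h1 : Submodule.span ℝ {x, y} ≠ ⊤ := by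
    intro h
    have h2 := finrank_span_le_card (R := ℝ) ({x, y} : Set (EuclideanSpace ℝ (Fin (n + 1))))
    rw [h, finrank_top, finrank_euclideanSpace_fin] at h2
    have h3 : ({x, y} : Set (EuclideanSpace ℝ (Fin (n + 1)))).toFinset.card ≤ 2 := by
      classical
      rw [Set.toFinset_card]
      convert Finset.card_le_two (a := x) (b := y)
      rw [← Set.toFinset_card]
      congr 1
      ext; simp
    omega
  obtain ⟨e, he⟩ := SetLike.exists_not_mem_of_ne_top _ h1 rfl
  refine ⟨e, fun ε hε s h => he ?_⟩
  have h2 : e = ε⁻¹ • (-(x + s • (y - x))) := by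
    rw [eq_inv_smul_iff₀ hε]
    rw [eq_neg_iff_add_eq_zero, ← h]
    abel
  rw [h2]
  have hx : x ∈ Submodule.span ℝ {x, y} := Submodule.subset_span (by simp)
  have hy : y ∈ Submodule.span ℝ {x, y} := Submodule.subset_span (by simp)
  exact Submodule.smul_mem _ _ (Submodule.neg_mem _ (Submodule.add_mem _ hx
    (Submodule.smul_mem _ _ (Submodule.sub_mem _ hy hx))))

lemma continuous_of_homogeneous {u : EuclideanSpace ℝ (Fin (n + 1)) → ℝ}
    (hu : ContinuousOn u {0}ᶜ) (hu0 : u 0 = 0)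
    (hhom : ∀ t : ℝ, 0 < t → ∀ y, y ≠ 0 → u (t • y) = t * u y) : Continuous u := by
  obtain ⟨W, hW0, hW⟩ := exists_abs_le_mul_norm hu hhom
  rw [continuous_iff_continuousAt]
  intro x
  rcases eq_or_ne x 0 with rfl | hx
  · have h1 : Tendsto (fun y : EuclideanSpace ℝ (Fin (n + 1)) => W * ‖y‖) (𝓝 0) (𝓝 0) := by
      have : Continuous fun y : EuclideanSpace ℝ (Fin (n + 1)) => W * ‖y‖ := by fun_prop
      simpa using this.tendsto 0
    rw [ContinuousAt, hu0]
    refine squeeze_zero_norm (fun y => ?_) h1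
    rcases eq_or_ne y 0 with rfl | hy
    · simp [hu0]
    · exact hW y hy
  · exact hu.continuousAt (isOpen_compl_singleton.mem_nhds hx)

lemma convexOn_of_hessian_nonneg (hn : 2 ≤ n) {u : EuclideanSpace ℝ (Fin (n + 1)) → ℝ}
    (hu : ContDiffOn ℝ 2 u {0}ᶜ) (huc : Continuous u)
    (hess : ∀ x, x ≠ 0 → ∀ v, 0 ≤ fderiv ℝ (fderiv ℝ u) x v v) : ConvexOn ℝ univ u := by
  have hC : ∀ {y : EuclideanSpace ℝ (Fin (n + 1))}, y ≠ 0 → ContDiffAt ℝ 2 u y := fun hy =>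
    hu.contDiffAt (isOpen_compl_singleton.mem_nhds hy)
  have hline : ∀ x v : EuclideanSpace ℝ (Fin (n + 1)), (∀ s : ℝ, x + s • v ≠ 0) →
      ConvexOn ℝ univ fun s : ℝ => u (x + s • v) := by
    intro x v h
    have h1 : ∀ s, HasDerivAt (fun s : ℝ => u (x + s • v)) (fderiv ℝ u (x + s • v) v) s :=
      fun s => hasDerivAt_comp_line ((hC (h s)).differentiableAt two_ne_zero)
    have h2 : ∀ s, HasDerivAt (fun t : ℝ => fderiv ℝ u (x + t • v) v)
      (fderiv ℝ (fderiv ℝ u) (x + s • v) v v) s := fun s => hasDerivAt_fderiv_comp_line (hC (h s))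
    have e1 : deriv (fun s : ℝ => u (x + s • v)) = fun s => fderiv ℝ u (x + s • v) v :=
      funext fun s => (h1 s).deriv
    refine convexOn_univ_of_deriv2_nonneg (fun s => (h1 s).differentiableAt) ?_ fun s => ?_
    · rw [e1]; exact fun s => (h2 s).differentiableAt
    · rw [Function.iterate_succ, Function.iterate_one, Function.comp_apply, e1, (h2 s).deriv]
      exact hess _ (h s) v
  refine ⟨convex_univ, fun x _ y _ a b ha hb hab => ?_⟩
  obtain ⟨e, he⟩ := exists_forall_line_ne_zero hn x y
  have hε : ∀ ε : ℝ, ε ≠ 0 → u (a • x + b • y + ε • e) ≤ a * u (x + ε • e) + b * u (y + ε • e) := by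
    intro ε hε
    have h1 := (hline (x + ε • e) (y - x) (he ε hε)).2 (mem_univ 0) (mem_univ 1) ha hb hab
    simp only [smul_eq_mul, mul_zero, mul_one, zero_add, zero_smul, add_zero, one_smul] at h1
    have e1 : x + ε • e + (y - x) = y + ε • e := by abel
    have e2 : x + ε • e + b • (y - x) = a • x + b • y + ε • e := by
      rw [eq_sub_of_add_eq hab, smul_sub, sub_smul, one_smul]; abel
    rwa [e1, e2] at h1
  have hl : Tendsto (fun ε : ℝ => u (a • x + b • y + ε • e)) (𝓝[≠] 0) (𝓝 (u (a • x + b • y))) := by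
    have : Continuous fun ε : ℝ => u (a • x + b • y + ε • e) := by fun_prop
    simpa using (this.tendsto 0).mono_left nhdsWithin_le_nhds
  have hr : Tendsto (fun ε : ℝ => a * u (x + ε • e) + b * u (y + ε • e)) (𝓝[≠] 0)
      (𝓝 (a * u x + b * u y)) := by
    have : Continuous fun ε : ℝ => a * u (x + ε • e) + b * u (y + ε • e) := by fun_prop
    simpa using (this.tendsto 0).mono_left nhdsWithin_le_nhds
  refine le_of_tendsto_of_tendsto hl hr ?_
  filter_upwards [self_mem_nhdsWithin] with ε h using hε ε h

open InnerProductGeometry in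
/-- A homogeneous function whose Laplacian has a small spherical Lipschitz constant is convex. -/
lemma convexOn_of_lipschitz_laplacian (hn : 2 ≤ n) {u g : EuclideanSpace ℝ (Fin (n + 1)) → ℝ}
    {G : ℝ} (hu : ContDiffOn ℝ 2 u {0}ᶜ) (hu0 : u 0 = 0)
    (hhom : ∀ t : ℝ, 0 < t → ∀ y, y ≠ 0 → u (t • y) = t * u y)
    (hlap : ∀ y, y ≠ 0 → laplacian u y = g y)
    (hg : ∀ t : ℝ, 0 < t → ∀ y, y ≠ 0 → g (t • y) = t⁻¹ * g y)
    (hG : ∀ x y, ‖x‖ = 1 → ‖y‖ = 1 → |g y - g x| ≤ G * angle y x)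
    (hg0 : ∀ x, ‖x‖ = 1 → 0 ≤ g x)
    (hGg : ∀ x, ‖x‖ = 1 → G ≤ gammaConst n 1 * g x) : ConvexOn ℝ univ u := by
  have hn' : (2 : ℝ) ≤ n := by exact_mod_cast hn
  refine convexOn_of_hessian_nonneg hn hu (continuous_of_homogeneous hu.continuousOn hu0 hhom)
    fun x hx v => hessian_nonneg_of_tangential hu hhom (fun x e hx he hxe => ?_) hx v
  have hx0 : x ≠ 0 := by rw [← norm_pos_iff, hx]; exact one_pos
  have h1 := omega_mul_abs_hessian_sub_le hn hu hu0 hhom hlap hg hG hx he hxe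
  rw [fderiv_clm_apply (differentiableAt_fderiv_of_contDiffAt_two
    (hu.contDiffAt (isOpen_compl_singleton.mem_nhds hx0))) (differentiableAt_const _)] at h1
  have h2 := hGg x hx
  have hI : 0 ≤ ∫ y, angleKernel x y := integral_nonneg (angleKernel_nonneg x)
  have hω := omega_n_pos n
  set I := ∫ y, angleKernel x y
  rw [gammaConst_one_eq hx] at h2
  have hgx := hg0 x hx
  have h3 : n * (G * I) ≤ omega_n n * (g x / n) := by
    rcases hI.eq_or_lt with h0 | h0
    · rw [← h0]; simp only [mul_zero]; positivity
    · have h4 : n * (G * I) ≤ n * ((omega_n n / (n * (n + 1)) * I⁻¹ * g x) * I) := by gcongr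
      have h5 : n * ((omega_n n / (n * (n + 1)) * I⁻¹ * g x) * I) =
          omega_n n * (g x / (n + 1)) := by field_simp
      rw [h5] at h4
      refine h4.trans ?_
      gcongr
      linarith
  have h4 := (abs_le.1 (le_of_mul_le_mul_left (h1.trans h3) hω)).1
  simp at h4
  linarith

end Convexity

section RadialIntegrals

open InnerProductGeometry Filter Topology

variable {n : ℕ}

lemma integral_radial_eq (F : ℝ → ℝ) :
    ∫ y : EuclideanSpace ℝ (Fin (n + 1)), F ‖y‖ = omega_n n * ∫ r in Ioi (0 : ℝ), r ^ n * F r := by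
  rw [integral_fun_norm_addHaar, omega_n_eq, finrank_euclideanSpace_fin]
  simp [mul_assoc]

lemma integrable_radial_iff (F : ℝ → ℝ) :
    Integrable (fun y : EuclideanSpace ℝ (Fin (n + 1)) => F ‖y‖) ↔
      IntegrableOn (fun r : ℝ => r ^ n * F r) (Ioi 0) := by
  rw [integrable_fun_norm_addHaar, finrank_euclideanSpace_fin]
  simp

lemma integrable_radial_mul_angle {F : ℝ → ℝ}
    (hF : Integrable fun y : EuclideanSpace ℝ (Fin (n + 1)) => F ‖y‖)
    (e : EuclideanSpace ℝ (Fin (n + 1))) :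
    Integrable fun y : EuclideanSpace ℝ (Fin (n + 1)) => F ‖y‖ * angle y e := by
  refine (hF.mul_bdd (c := Real.pi) (measurable_angle_right e).aestronglyMeasurable
    (ae_of_all _ fun y => ?_))
  rw [Real.norm_of_nonneg (angle_nonneg _ _)]
  exact angle_le_pi _ _

lemma integral_radial_mul_angle {F : ℝ → ℝ}
    (hF : Integrable fun y : EuclideanSpace ℝ (Fin (n + 1)) => F ‖y‖)
    (e : EuclideanSpace ℝ (Fin (n + 1))) :
    ∫ y : EuclideanSpace ℝ (Fin (n + 1)), F ‖y‖ * angle y e =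
      Real.pi / 2 * ∫ y : EuclideanSpace ℝ (Fin (n + 1)), F ‖y‖ := by
  have h1 := integral_neg_eq_self (fun y : EuclideanSpace ℝ (Fin (n + 1)) => F ‖y‖ * angle y e) volume
  simp only [norm_neg, angle_neg_left, mul_sub] at h1
  rw [integral_sub (hF.mul_const _) (integrable_radial_mul_angle hF e), integral_mul_const] at h1
  linarith

lemma integral_sq_inner_mul_radial {F : ℝ → ℝ}
    (hF : Integrable fun y : EuclideanSpace ℝ (Fin (n + 1)) => ‖y‖ ^ 2 * F ‖y‖)
    (hFm : Measurable F) {e : EuclideanSpace ℝ (Fin (n + 1))} (he : ‖e‖ = 1) :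
    Integrable (fun y : EuclideanSpace ℝ (Fin (n + 1)) => ⟪y, e⟫ ^ 2 * F ‖y‖) ∧
    (n + 1) * ∫ y : EuclideanSpace ℝ (Fin (n + 1)), ⟪y, e⟫ ^ 2 * F ‖y‖ =
      ∫ y : EuclideanSpace ℝ (Fin (n + 1)), ‖y‖ ^ 2 * F ‖y‖ := by
  have hInt : ∀ e' : EuclideanSpace ℝ (Fin (n + 1)), ‖e'‖ = 1 →
      Integrable (fun y : EuclideanSpace ℝ (Fin (n + 1)) => ⟪y, e'⟫ ^ 2 * F ‖y‖) := by
    intro e' he'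
    refine hF.mono (by fun_prop) (ae_of_all _ fun y => ?_)
    rw [norm_mul, norm_mul, norm_pow, norm_pow, norm_norm]
    gcongr
    simpa [he'] using abs_real_inner_le_norm y e'
  refine ⟨hInt e he, ?_⟩
  have heq : ∀ i : Fin (n + 1), ∫ y : EuclideanSpace ℝ (Fin (n + 1)),
      ⟪y, EuclideanSpace.single i 1⟫ ^ 2 * F ‖y‖ = ∫ y, ⟪y, e⟫ ^ 2 * F ‖y‖ := by
    intro i
    obtain ⟨R, hR⟩ := exists_linearIsometryEquiv_apply_eq (x := e) (y := EuclideanSpace.single i 1)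
      (by simp [he])
    rw [← R.measurePreserving.integral_comp R.toHomeomorph.measurableEmbedding]
    simp [← hR]
  have hsum : ∀ y : EuclideanSpace ℝ (Fin (n + 1)), ‖y‖ ^ 2 * F ‖y‖ =
      ∑ i, ⟪y, EuclideanSpace.single i 1⟫ ^ 2 * F ‖y‖ := by
    intro y
    rw [← Finset.sum_mul, EuclideanSpace.norm_sq_eq]
    simp [EuclideanSpace.inner_single_right]
  simp_rw [hsum]
  rw [integral_finsetSum _ fun i _ => hInt _ (by simp)]
  simp [heq]

lemma tendsto_div_sqrt_one_add_sq :
    Tendsto (fun r : ℝ => r / √(1 + r ^ 2)) atTop (𝓝 1) := by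
  have h1 : Tendsto (fun r : ℝ => (√(1 + (r⁻¹) ^ 2))⁻¹) atTop (𝓝 1) := by
    have : ContinuousAt (fun s : ℝ => (√(1 + s ^ 2))⁻¹) 0 := by
      refine ContinuousAt.inv₀ (by fun_prop) (by simp)
    simpa [Function.comp_def] using this.tendsto.comp tendsto_inv_atTop_zero
  refine h1.congr' ?_
  filter_upwards [eventually_gt_atTop 0] with r hr
  have : 1 + r ^ 2 = r ^ 2 * (1 + r⁻¹ ^ 2) := by field_simp; ring
  rw [this, Real.sqrt_mul (by positivity), Real.sqrt_sq hr.le]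
  field_simp

lemma hasDerivAt_sqrt_one_add_sq (r : ℝ) :
    HasDerivAt (fun r : ℝ => √(1 + r ^ 2)) (r / √(1 + r ^ 2)) r := by
  have h := (((hasDerivAt_id r).pow 2).const_add 1).sqrt
    (by have : (0 : ℝ) < 1 + r ^ 2 := by positivity
        simpa using this.ne')
  refine h.congr_deriv ?_
  simp
  field_simp

lemma integral_mul_inv_sqrt_pow_three :
    IntegrableOn (fun r : ℝ => r ^ 2 * ((√(1 + r ^ 2) ^ 3)⁻¹ * r⁻¹)) (Ioi 0) ∧
      ∫ r in Ioi (0 : ℝ), r ^ 2 * ((√(1 + r ^ 2) ^ 3)⁻¹ * r⁻¹) = 1 := by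
  have hd : ∀ r ∈ Ioi (0 : ℝ), HasDerivAt (fun r : ℝ => -(√(1 + r ^ 2))⁻¹)
      (r ^ 2 * ((√(1 + r ^ 2) ^ 3)⁻¹ * r⁻¹)) r := by
    intro r hr
    have hr : 0 < r := hr
    have h0 : 0 < √(1 + r ^ 2) := by positivity
    refine ((hasDerivAt_sqrt_one_add_sq r).inv h0.ne').neg.congr_deriv ?_
    field_simp
  have hc : ContinuousWithinAt (fun r : ℝ => -(√(1 + r ^ 2))⁻¹) (Ici 0) 0 := by
    refine ContinuousAt.continuousWithinAt (ContinuousAt.neg (ContinuousAt.inv₀ (by fun_prop) (by simp)))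
  have hpos : ∀ r ∈ Ioi (0 : ℝ), 0 ≤ r ^ 2 * ((√(1 + r ^ 2) ^ 3)⁻¹ * r⁻¹) := by
    intro r hr
    have hr : 0 < r := hr
    positivity
  have hl : Tendsto (fun r : ℝ => -(√(1 + r ^ 2))⁻¹) atTop (𝓝 0) := by
    have h1 := tendsto_div_sqrt_one_add_sq.mul tendsto_inv_atTop_zero
    rw [mul_zero] at h1
    have h2 := h1.neg
    rw [neg_zero] at h2
    refine h2.congr' ?_
    filter_upwards [eventually_gt_atTop 0] with r hr
    field_simp
  exact ⟨integrableOn_Ioi_deriv_of_nonneg hc hd hpos hl,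
    by rw [integral_Ioi_of_hasDerivAt_of_nonneg hc hd hpos hl]; simp⟩

lemma integral_sq_mul_inv_sqrt_pow_five :
    IntegrableOn (fun r : ℝ => r ^ 2 * (√(1 + r ^ 2) ^ 5)⁻¹) (Ioi 0) ∧
      ∫ r in Ioi (0 : ℝ), r ^ 2 * (√(1 + r ^ 2) ^ 5)⁻¹ = 1 / 3 := by
  have hd : ∀ r ∈ Ici (0 : ℝ), HasDerivAt (fun r : ℝ => 1 / 3 * (r / √(1 + r ^ 2)) ^ 3)
      (r ^ 2 * (√(1 + r ^ 2) ^ 5)⁻¹) r := by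
    intro r _
    have h0 : 0 < √(1 + r ^ 2) := by positivity
    have hs : √(1 + r ^ 2) ^ 2 = 1 + r ^ 2 := Real.sq_sqrt (by positivity)
    refine ((((hasDerivAt_id r).div (hasDerivAt_sqrt_one_add_sq r) h0.ne').pow 3).const_mul
      (1 / 3)).congr_deriv ?_
    simp only [id, Pi.div_apply]
    push_cast
    field_simp
    rw [hs]
    ring
  have hpos : ∀ r ∈ Ioi (0 : ℝ), 0 ≤ r ^ 2 * (√(1 + r ^ 2) ^ 5)⁻¹ := fun r _ => by positivity
  have hl := (tendsto_div_sqrt_one_add_sq.pow 3).const_mul (1 / 3)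
  exact ⟨integrableOn_Ioi_deriv_of_nonneg' hd hpos hl,
    by rw [integral_Ioi_of_hasDerivAt_of_nonneg' hd hpos hl]; simp⟩

lemma integral_inv_one_add_pow (hn : 1 ≤ n) :
    IntegrableOn (fun r : ℝ => r ^ n * (((1 + r) ^ (n + 1))⁻¹ * r⁻¹)) (Ioi 0) ∧
      ∫ r in Ioi (0 : ℝ), r ^ n * (((1 + r) ^ (n + 1))⁻¹ * r⁻¹) = 1 / n := by
  obtain ⟨k, rfl⟩ : ∃ k, n = k + 1 := ⟨n - 1, by omega⟩
  have hd : ∀ r ∈ Ioi (0 : ℝ), HasDerivAt (fun r : ℝ => 1 / ((k + 1 : ℕ) : ℝ) * (r / (1 + r)) ^ (k + 1))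
      (r ^ (k + 1) * (((1 + r) ^ (k + 1 + 1))⁻¹ * r⁻¹)) r := by
    intro r hr
    have hr : 0 < r := hr
    have h0 : 0 < 1 + r := by linarith
    refine ((((hasDerivAt_id r).div ((hasDerivAt_id r).const_add 1) h0.ne').pow (k + 1)).const_mul
      (1 / ((k + 1 : ℕ) : ℝ))).congr_deriv ?_
    simp only [id, Pi.div_apply]
    push_cast
    rw [div_pow]
    field_simp
    ring
  have hc : ContinuousWithinAt (fun r : ℝ => 1 / ((k + 1 : ℕ) : ℝ) * (r / (1 + r)) ^ (k + 1))
      (Ici 0) 0 := by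
    refine ContinuousAt.continuousWithinAt (ContinuousAt.mul continuousAt_const (ContinuousAt.pow
      (ContinuousAt.div continuousAt_id (by fun_prop) (by simp)) _))
  have hpos : ∀ r ∈ Ioi (0 : ℝ), 0 ≤ r ^ (k + 1) * (((1 + r) ^ (k + 1 + 1))⁻¹ * r⁻¹) := by
    intro r hr
    have hr : 0 < r := hr
    positivity
  have hl0 : Tendsto (fun r : ℝ => r / (1 + r)) atTop (𝓝 1) := by
    have h1 : Tendsto (fun r : ℝ => 1 - (1 + r)⁻¹) atTop (𝓝 (1 - 0)) :=
      tendsto_const_nhds.sub (tendsto_inv_atTop_zero.comp (tendsto_atTop_add_const_left _ _ tendsto_id))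
    rw [sub_zero] at h1
    refine h1.congr' ?_
    filter_upwards [eventually_gt_atTop 0] with r hr
    field_simp
    ring
  have hl := (hl0.pow (k + 1)).const_mul (1 / ((k + 1 : ℕ) : ℝ))
  exact ⟨integrableOn_Ioi_deriv_of_nonneg hc hd hpos hl,
    by rw [integral_Ioi_of_hasDerivAt_of_nonneg hc hd hpos hl]; simp⟩

lemma le_integral_angleKernel (hn : 1 ≤ n) {e : EuclideanSpace ℝ (Fin (n + 1))} (he : ‖e‖ = 1) :
    omega_n n * (Real.pi / (2 * n)) ≤ ∫ y, angleKernel e y := by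
  obtain ⟨h1, h2⟩ := integral_inv_one_add_pow hn
  have hF := (integrable_radial_iff fun r => ((1 + r) ^ (n + 1))⁻¹ * r⁻¹).2 h1
  have h3 := integral_radial_mul_angle (F := fun r => ((1 + r) ^ (n + 1))⁻¹ * r⁻¹) hF e
  rw [integral_radial_eq (fun r => ((1 + r) ^ (n + 1))⁻¹ * r⁻¹), h2] at h3
  have h4 : Real.pi / 2 * (omega_n n * (1 / n)) = omega_n n * (Real.pi / (2 * n)) := by ring
  rw [← h4, ← h3]
  refine integral_mono_ae (integrable_radial_mul_angle (F := fun r => ((1 + r) ^ (n + 1))⁻¹ * r⁻¹) hF e) (integrable_angleKernel hn he) ?_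
  filter_upwards [ae_ne_euclidean e] with y hy
  have hd : 0 < ‖y - e‖ := norm_pos_iff.2 (sub_ne_zero.2 hy)
  have hle : ‖y - e‖ ≤ 1 + ‖y‖ := by
    have := norm_sub_le y e
    linarith
  have := angle_nonneg y e
  unfold angleKernel
  gcongr

lemma five_mul_sub_le_inv_pow {A s p : ℝ} (hA : 0 < A) (hs : 0 < s) (h : s ^ 2 = A ^ 2 - 2 * p) :
    (A ^ 3)⁻¹ + 3 * p * (A ^ 5)⁻¹ ≤ (s ^ 3)⁻¹ := by
  have hp : p = (A ^ 2 - s ^ 2) / 2 := by linarith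
  have key : (s ^ 3)⁻¹ - ((A ^ 3)⁻¹ + 3 * p * (A ^ 5)⁻¹) =
      (s - A) ^ 2 * (3 * s ^ 3 + 6 * s ^ 2 * A + 4 * s * A ^ 2 + 2 * A ^ 3) / (2 * A ^ 5 * s ^ 3) := by
    rw [hp]
    field_simp
    ring
  have : 0 ≤ (s - A) ^ 2 * (3 * s ^ 3 + 6 * s ^ 2 * A + 4 * s * A ^ 2 + 2 * A ^ 3) /
    (2 * A ^ 5 * s ^ 3) := by positivity
  linarith

lemma arcsin_mul_self_le {t : ℝ} (h1 : -1 ≤ t) (h2 : t ≤ 1) :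
    t * Real.arcsin t ≤ Real.pi / 2 * t ^ 2 := by
  have hpi := Real.pi_pos
  have key : ∀ t : ℝ, 0 ≤ t → t ≤ 1 → t * Real.arcsin t ≤ Real.pi / 2 * t ^ 2 := by
    intro t h0 h1
    have h3 := Real.mul_le_sin (Real.arcsin_nonneg.2 h0) (Real.arcsin_le_pi_div_two t)
    rw [Real.sin_arcsin (by linarith) h1, div_mul_eq_mul_div, div_le_iff₀ hpi] at h3
    nlinarith
  rcases le_total 0 t with h | h
  · exact key t h h2
  · have := key (-t) (by linarith) (by linarith)
    rw [Real.arcsin_neg] at this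
    linarith

lemma le_integral_angleKernel_two {e : EuclideanSpace ℝ (Fin (2 + 1))} (he : ‖e‖ = 1) :
    omega_n 2 * (Real.pi / 3) ≤ ∫ y, angleKernel e y := by
  have hpi := Real.pi_pos
  have hω := omega_n_pos 2
  obtain ⟨i1, v1⟩ := integral_mul_inv_sqrt_pow_three
  obtain ⟨i2, v2⟩ := integral_sq_mul_inv_sqrt_pow_five
  have F1 := (integrable_radial_iff (n := 2) fun r => (√(1 + r ^ 2) ^ 3)⁻¹ * r⁻¹).2 i1
  have F2 := (integrable_radial_iff (n := 2) fun r => (√(1 + r ^ 2) ^ 5)⁻¹).2 i2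
  have A1 := integral_radial_mul_angle (F := fun r => (√(1 + r ^ 2) ^ 3)⁻¹ * r⁻¹) F1 e
  rw [integral_radial_eq (fun r => (√(1 + r ^ 2) ^ 3)⁻¹ * r⁻¹), v1, mul_one] at A1
  have V2 := integral_radial_eq (n := 2) fun r => (√(1 + r ^ 2) ^ 5)⁻¹
  rw [v2] at V2
  have F3e : (fun y : EuclideanSpace ℝ (Fin (2 + 1)) => ‖y‖ ^ 2 * ((√(1 + ‖y‖ ^ 2) ^ 5)⁻¹ *
      (‖y‖ ^ 2)⁻¹)) =ᵐ[volume] fun y => (√(1 + ‖y‖ ^ 2) ^ 5)⁻¹ := by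
    filter_upwards [ae_ne_euclidean 0] with y hy
    have hyn : 0 < ‖y‖ := norm_pos_iff.2 hy
    field_simp
  obtain ⟨i3, v3⟩ := integral_sq_inner_mul_radial (F := fun r => (√(1 + r ^ 2) ^ 5)⁻¹ * (r ^ 2)⁻¹)
    (F2.congr F3e.symm) (by fun_prop) he
  rw [integral_congr_ae F3e, V2] at v3
  have A2 := integral_neg_eq_self (fun y : EuclideanSpace ℝ (Fin (2 + 1)) =>
    ⟪y, e⟫ * ((√(1 + ‖y‖ ^ 2) ^ 5)⁻¹ * ‖y‖⁻¹)) volume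
  simp only [norm_neg, inner_neg_left, neg_mul, integral_neg] at A2
  have i4 : Integrable fun y : EuclideanSpace ℝ (Fin (2 + 1)) =>
      ⟪y, e⟫ * ((√(1 + ‖y‖ ^ 2) ^ 5)⁻¹ * ‖y‖⁻¹) := by
    refine F2.mono' (by fun_prop) (ae_of_all _ fun y => ?_)
    rw [norm_mul, Real.norm_of_nonneg (by positivity : 0 ≤ (√(1 + ‖y‖ ^ 2) ^ 5)⁻¹ * ‖y‖⁻¹)]
    rcases eq_or_ne y 0 with rfl | hy
    · simp
    · have hyn : 0 < ‖y‖ := norm_pos_iff.2 hy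
      have h1 : ‖⟪y, e⟫‖ ≤ ‖y‖ := by simpa [he] using abs_real_inner_le_norm y e
      calc _ ≤ ‖y‖ * ((√(1 + ‖y‖ ^ 2) ^ 5)⁻¹ * ‖y‖⁻¹) := by gcongr
        _ = _ := by field_simp
  have i1' := integrable_radial_mul_angle (F := fun r => (√(1 + r ^ 2) ^ 3)⁻¹ * r⁻¹) F1 e
  have i5 : Integrable fun y : EuclideanSpace ℝ (Fin (2 + 1)) =>
      Real.pi / 2 * (⟪y, e⟫ * ((√(1 + ‖y‖ ^ 2) ^ 5)⁻¹ * ‖y‖⁻¹)) -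
        Real.pi / 2 * (⟪y, e⟫ ^ 2 * ((√(1 + ‖y‖ ^ 2) ^ 5)⁻¹ * (‖y‖ ^ 2)⁻¹)) :=
    (i4.const_mul _).sub (i3.const_mul _)
  have hlow : Integrable fun y : EuclideanSpace ℝ (Fin (2 + 1)) =>
      (√(1 + ‖y‖ ^ 2) ^ 3)⁻¹ * ‖y‖⁻¹ * angle y e +
        3 * (Real.pi / 2 * (⟪y, e⟫ * ((√(1 + ‖y‖ ^ 2) ^ 5)⁻¹ * ‖y‖⁻¹)) -
          Real.pi / 2 * (⟪y, e⟫ ^ 2 * ((√(1 + ‖y‖ ^ 2) ^ 5)⁻¹ * (‖y‖ ^ 2)⁻¹))) :=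
    i1'.add (i5.const_mul 3)
  have hmain := integral_mono_ae hlow (integrable_angleKernel (by norm_num) he) ?_
  · rw [integral_add i1' (i5.const_mul 3), integral_const_mul,
      integral_sub (i4.const_mul _) (i3.const_mul _), integral_const_mul, integral_const_mul, A1]
      at hmain
    have h4 : ∫ y : EuclideanSpace ℝ (Fin (2 + 1)), ⟪y, e⟫ * ((√(1 + ‖y‖ ^ 2) ^ 5)⁻¹ * ‖y‖⁻¹) = 0 := by
      linarith
    push_cast at v3
    rw [h4] at hmain
    nlinarith
  · filter_upwards [ae_ne_euclidean e, ae_ne_euclidean 0] with y hy hy0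
    have hd : 0 < ‖y - e‖ := norm_pos_iff.2 (sub_ne_zero.2 hy)
    have hyn : 0 < ‖y‖ := norm_pos_iff.2 hy0
    have hA : 0 < √(1 + ‖y‖ ^ 2) := by positivity
    have h1 := five_mul_sub_le_inv_pow (p := ⟪y, e⟫) hA hd (by
      rw [norm_sub_sq_real, he, Real.sq_sqrt (by positivity)]; ring)
    set A := √(1 + ‖y‖ ^ 2)
    set p := ⟪y, e⟫ with hp
    have hθ := angle_nonneg y e
    have h2 : p * (Real.pi / 2 - angle y e) ≤ Real.pi / 2 * p ^ 2 * ‖y‖⁻¹ := by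
      have ht := abs_le.1 (abs_real_inner_div_norm_mul_norm_le_one y e)
      have h3 := arcsin_mul_self_le ht.1 ht.2
      rw [Real.arcsin_eq_pi_div_two_sub_arccos] at h3
      change ⟪y, e⟫ / (‖y‖ * ‖e‖) * (Real.pi / 2 - angle y e) ≤ _ at h3
      rw [he, mul_one, ← hp] at h3
      have h4 := mul_le_mul_of_nonneg_left h3 hyn.le
      calc p * (Real.pi / 2 - angle y e) = ‖y‖ * (p / ‖y‖ * (Real.pi / 2 - angle y e)) := by
            field_simp
        _ ≤ ‖y‖ * (Real.pi / 2 * (p / ‖y‖) ^ 2) := h4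
        _ = _ := by field_simp
    have h5 : Real.pi / 2 * p - Real.pi / 2 * p ^ 2 * ‖y‖⁻¹ ≤ p * angle y e := by linarith
    change _ ≤ (‖y - e‖ ^ 3)⁻¹ * ‖y‖⁻¹ * angle y e
    calc _ = (A ^ 3)⁻¹ * ‖y‖⁻¹ * angle y e +
          3 * (A ^ 5)⁻¹ * ‖y‖⁻¹ * (Real.pi / 2 * p - Real.pi / 2 * p ^ 2 * ‖y‖⁻¹) := by
          field_simp
      _ ≤ (A ^ 3)⁻¹ * ‖y‖⁻¹ * angle y e + 3 * (A ^ 5)⁻¹ * ‖y‖⁻¹ * (p * angle y e) := by gcongr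
      _ = ((A ^ 3)⁻¹ + 3 * p * (A ^ 5)⁻¹) * ‖y‖⁻¹ * angle y e := by ring
      _ ≤ _ := by gcongr

lemma gammaConst_one_le (hn : 1 ≤ n) : gammaConst n 1 ≤ 2 / ((n + 1) * Real.pi) := by
  have hn' : (1 : ℝ) ≤ n := by exact_mod_cast hn
  have he : ‖(EuclideanSpace.single 0 1 : EuclideanSpace ℝ (Fin (n + 1)))‖ = 1 := by simp
  have h := le_integral_angleKernel hn he
  have hω := omega_n_pos n
  have hpi := Real.pi_pos
  rw [gammaConst_one_eq he]
  calc _ ≤ omega_n n / (n * (n + 1)) * (omega_n n * (Real.pi / (2 * n)))⁻¹ := by gcongr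
    _ = _ := by field_simp

lemma gammaConst_two_le : gammaConst 2 1 ≤ 1 / (2 * Real.pi) := by
  have he : ‖(EuclideanSpace.single 0 1 : EuclideanSpace ℝ (Fin (2 + 1)))‖ = 1 := by simp
  have h := le_integral_angleKernel_two he
  have hω := omega_n_pos 2
  have hpi := Real.pi_pos
  rw [gammaConst_one_eq he]
  push_cast
  calc _ ≤ omega_n 2 / (2 * (2 + 1)) * (omega_n 2 * (Real.pi / 3))⁻¹ := by gcongr
    _ = _ := by field_simp; norm_num

/-- The smallness condition forces the oscillation of `f` to be small compared to the bottom
`(n - 1)² / 4` of the spectral shift. -/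
lemma mul_ratio_sub_one_lt (hn : 2 ≤ n) {M m G : ℝ} (hm : 0 < m) (hmM : m ≤ M)
    (hG : 0 ≤ G) (hosc : M - m ≤ Real.pi * G)
    (hcond : (1 + (n / (n - 1) : ℝ) * (M / m)) * Real.exp ((n * Real.pi / (n - 1)) * (G / m)) * G ≤
      gammaConst n 1 * m) : n * (M / m - 1) < ((n : ℝ) - 1) ^ 2 / 4 := by
  have hpi := Real.pi_pos
  have hn' : (2 : ℝ) ≤ n := by exact_mod_cast hn
  have hn1 : (0 : ℝ) < n - 1 := by linarith
  set r := M / m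
  set q := G / m
  have hq : 0 ≤ q := by positivity
  have hr : 1 ≤ r := by rwa [one_le_div hm]
  have hrq : r - 1 ≤ Real.pi * q := by
    have : r - 1 = (M - m) / m := by simp only [r]; field_simp
    rw [this, mul_div_assoc', div_le_div_iff_of_pos_right hm]
    exact hosc
  have hc : (1 + (n / (n - 1) : ℝ) * r) * Real.exp ((n * Real.pi / (n - 1)) * q) * q ≤
      gammaConst n 1 := by
    have h1 : (1 + (n / (n - 1) : ℝ) * r) * Real.exp ((n * Real.pi / (n - 1)) * q) * q =
      ((1 + (n / (n - 1) : ℝ) * r) * Real.exp ((n * Real.pi / (n - 1)) * q) * G) / m := by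
      simp only [q]; ring
    rwa [h1, div_le_iff₀ hm]
  clear hcond
  clear_value r q
  have hz : 0 ≤ Real.pi * q := by positivity
  rcases hn.eq_or_lt with rfl | h3
  · have hγ := hc.trans gammaConst_two_le
    push_cast at hγ ⊢
    by_contra! hcon
    norm_num at hcon hγ
    have hr' : 9 / 8 ≤ r := by linarith
    have hz' : 1 / 8 ≤ Real.pi * q := by linarith
    have hexp : 1 + 1 / 4 + (1 / 4) ^ 2 / 2 ≤ Real.exp (2 * Real.pi * q) :=
      (Real.quadratic_le_exp_of_nonneg (by norm_num)).trans (Real.exp_le_exp.2 (by linarith))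
    have h5 : (1 + 2 * r) * Real.exp (2 * Real.pi * q) * (Real.pi * q) ≤ 1 / 2 := by
      have := mul_le_mul_of_nonneg_left hγ hpi.le
      calc _ = Real.pi * ((1 + 2 * r) * Real.exp (2 * Real.pi * q) * q) := by ring
        _ ≤ _ := this
        _ = _ := by field_simp
    have h6 : (1 + 2 * (9 / 8)) * (1 + 1 / 4 + (1 / 4) ^ 2 / 2) * (1 / 8) ≤
        (1 + 2 * r) * Real.exp (2 * Real.pi * q) * (Real.pi * q) := by gcongr
    norm_num at h6
    linarith
  · have hn3 : (3 : ℝ) ≤ n := by exact_mod_cast h3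
    have hγ := hc.trans (gammaConst_one_le (by omega))
    have h4 : (1 + (n / (n - 1) : ℝ) * 1) * 1 * q ≤
        (1 + (n / (n - 1) : ℝ) * r) * Real.exp ((n * Real.pi / (n - 1)) * q) * q := by
      gcongr
      exact Real.one_le_exp (by positivity)
    have h5 := h4.trans hγ
    rw [le_div_iff₀ (by positivity)] at h5
    have h6 : (1 + (n / (n - 1) : ℝ) * 1) * 1 * q * ((n + 1) * Real.pi) =
        (2 * n - 1) * (n + 1) * (Real.pi * q) / (n - 1) := by field_simp; ring
    rw [h6, div_le_iff₀ hn1] at h5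
    have h7 : n * (Real.pi * q) < 1 := by
      by_contra! hcon
      have : (2 * n - 1) * (n + 1) * 1 ≤ (2 * n - 1) * ((n : ℝ) + 1) * (n * (Real.pi * q)) := by
        gcongr
        nlinarith
      nlinarith
    have h8 : (1 : ℝ) ≤ (n - 1) ^ 2 / 4 := by nlinarith
    have h9 : n * (r - 1) ≤ n * (Real.pi * q) := by gcongr
    linarith

end RadialIntegrals

section TwoPoint

open InnerProductGeometry Filter Topology

lemma arccos_cos_le {θ : ℝ} (h : 0 ≤ θ) : Real.arccos (Real.cos θ) ≤ θ := by
  rcases le_total θ Real.pi with h1 | h1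
  · rw [Real.arccos_cos h h1]
  · exact (Real.arccos_le_pi _).trans h1

variable {n : ℕ}

/-- Points of the sphere are joined by a great circle. -/
lemma exists_orthogonal_eq_cos_add_sin (hn : 1 ≤ n) {x y : EuclideanSpace ℝ (Fin (n + 1))}
    (hx : ‖x‖ = 1) (hy : ‖y‖ = 1) :
    ∃ e : EuclideanSpace ℝ (Fin (n + 1)), ‖e‖ = 1 ∧ ⟪x, e⟫ = 0 ∧
      y = Real.cos (angle x y) • x + Real.sin (angle x y) • e := by
  have hxy : Real.cos (angle x y) = ⟪x, y⟫ := by rw [cos_angle, hx, hy]; simp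
  have hexists : ∃ e : EuclideanSpace ℝ (Fin (n + 1)), ‖e‖ = 1 ∧ ⟪x, e⟫ = 0 := by
    have hcard : Module.finrank ℝ (EuclideanSpace ℝ (Fin (n + 1))) = Fintype.card (Fin (n + 1)) := by
      simp
    have ho : Orthonormal ℝ (({0} : Set (Fin (n + 1))).domRestrict fun _ => x) :=
      ⟨fun _ => hx, fun i j hij => absurd (Subsingleton.elim i j) hij⟩
    obtain ⟨b, hb⟩ := ho.exists_orthonormalBasis_extension_of_card_eq hcard
    refine ⟨b (Fin.last n), by simp, ?_⟩
    rw [← hb 0 rfl]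
    exact b.inner_eq_zero (by simp [Fin.ext_iff]; omega)
  rcases eq_or_ne (Real.sin (angle x y)) 0 with hs | hs
  · obtain ⟨e, he, hxe⟩ := hexists
    refine ⟨e, he, hxe, ?_⟩
    rw [hs, zero_smul, add_zero]
    have hc := Real.sin_sq_add_cos_sq (angle x y)
    rw [← sub_eq_zero, ← norm_eq_zero, ← sq_eq_zero_iff, norm_sub_sq_real, norm_smul,
      real_inner_smul_right, real_inner_comm, ← hxy, hx, hy, Real.norm_eq_abs, mul_pow, sq_abs]
    rw [hs] at hc
    linarith
  · refine ⟨(Real.sin (angle x y))⁻¹ • (y - Real.cos (angle x y) • x), ?_, ?_, ?_⟩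
    · have hc := Real.sin_sq_add_cos_sq (angle x y)
      have h1 : ‖y - Real.cos (angle x y) • x‖ ^ 2 = Real.sin (angle x y) ^ 2 := by
        rw [norm_sub_sq_real, norm_smul, real_inner_smul_right, real_inner_comm, ← hxy, hx, hy,
          Real.norm_eq_abs, mul_pow, sq_abs]
        linarith
      have h2 : ‖y - Real.cos (angle x y) • x‖ = |Real.sin (angle x y)| := by
        rw [← abs_norm, ← sq_eq_sq_iff_abs_eq_abs, h1]
      rw [norm_smul, h2, norm_inv, Real.norm_eq_abs, inv_mul_cancel₀ (abs_ne_zero.2 hs)]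
    · rw [real_inner_smul_right, inner_sub_right, real_inner_smul_right, real_inner_self_eq_norm_sq,
        hx, ← hxy]
      simp
    · rw [smul_smul, mul_inv_cancel₀ hs, one_smul]
      abel

lemma angle_add_smul_le {x y e : EuclideanSpace ℝ (Fin (n + 1))} (hx : ‖x‖ = 1) (hy : ‖y‖ = 1)
    (he : ‖e‖ = 1) (hxe : ⟪x, e⟫ = 0) {d t : ℝ}
    (h : y = Real.cos d • x + Real.sin d • e) (ht : Real.arctan t ≤ d) :
    angle (x + t • e) y ≤ d - Real.arctan t := by
  have h1 : ‖x + t • e‖ = √(1 + t ^ 2) := by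
    rw [← Real.sqrt_sq (norm_nonneg _), norm_add_sq_real, real_inner_smul_right, hxe, norm_smul, hx,
      he, Real.norm_eq_abs, mul_one, sq_abs]
    ring_nf
  have h2 : ⟪x + t • e, y⟫ = Real.cos d + t * Real.sin d := by
    have hex : ⟪e, x⟫ = 0 := by rw [real_inner_comm, hxe]
    rw [h]
    simp only [inner_add_left, inner_add_right, real_inner_smul_left, real_inner_smul_right, hxe,
      hex, real_inner_self_eq_norm_sq, hx, he]
    ring
  have h3 : ⟪x + t • e, y⟫ / (‖x + t • e‖ * ‖y‖) = Real.cos (d - Real.arctan t) := by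
    rw [Real.cos_sub, Real.cos_arctan, Real.sin_arctan, h1, h2, hy]
    ring
  rw [angle, h3]
  exact arccos_cos_le (by linarith)

lemma fderiv_of_max_sub_angle {v : EuclideanSpace ℝ (Fin (n + 1)) → ℝ}
    (hv : ContDiffOn ℝ 2 v {0}ᶜ) {x y e : EuclideanSpace ℝ (Fin (n + 1))} (hx : ‖x‖ = 1)
    (hy : ‖y‖ = 1) (he : ‖e‖ = 1) (hxe : ⟪x, e⟫ = 0) {L : ℝ} (hL : 0 ≤ L)
    (h : y = Real.cos (angle x y) • x + Real.sin (angle x y) • e) (hd : 0 < angle x y)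
    (hmax : ∀ z, z ≠ 0 → v z - L * angle z y ≤ v x - L * angle x y) :
    fderiv ℝ v x e = -L ∧ fderiv ℝ (fderiv ℝ v) x e e ≤ 0 := by
  have hne : ∀ t : ℝ, x + t • e ≠ 0 := by
    intro t h0
    have : ⟪x, x + t • e⟫ = 1 := by
      rw [inner_add_right, real_inner_smul_right, hxe, real_inner_self_eq_norm_sq, hx]; norm_num
    rw [h0, inner_zero_right] at this
    norm_num at this
  have hvt : ∀ t : ℝ, ContDiffAt ℝ 2 v (x + t • e) := fun t =>
    hv.contDiffAt (isOpen_compl_singleton.mem_nhds (hne t))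
  set F : ℝ → ℝ := fun t => v (x + t • e) + L * Real.arctan t with hF
  have hF1 : ∀ t, HasDerivAt F (fderiv ℝ v (x + t • e) e + L * (1 / (1 + t ^ 2))) t := fun t =>
    (hasDerivAt_comp_line ((hvt t).differentiableAt (by norm_num))).add
      ((Real.hasDerivAt_arctan t).const_mul L)
  have hF1' : deriv F = fun t => fderiv ℝ v (x + t • e) e + L * (1 / (1 + t ^ 2)) :=
    funext fun t => (hF1 t).deriv
  have hF2 : HasDerivAt (deriv F) (fderiv ℝ (fderiv ℝ v) x e e) 0 := by
    rw [hF1']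
    have h1 := hasDerivAt_fderiv_comp_line (w := e) (hvt 0)
    have h2 : HasDerivAt (fun t : ℝ => L * (1 / (1 + t ^ 2))) 0 0 := by
      have h3 := ((((hasDerivAt_pow 2 (0 : ℝ)).const_add 1).fun_inv (by norm_num)).const_mul L)
      simpa using h3
    have h3 := h1.fun_add h2
    simpa using h3
  have hloc : IsLocalMax F 0 := by
    have hev : ∀ᶠ t : ℝ in 𝓝 0, Real.arctan t < angle x y := by
      have := Real.continuous_arctan.tendsto 0
      rw [Real.arctan_zero] at this
      exact this.eventually (gt_mem_nhds hd)
    filter_upwards [hev] with t ht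
    have h1 := angle_add_smul_le hx hy he hxe h ht.le
    have h2 := hmax _ (hne t)
    have h3 := mul_le_mul_of_nonneg_left h1 hL
    simp only [hF, zero_smul, add_zero, Real.arctan_zero, mul_zero]
    linarith
  constructor
  · have := hloc.hasDerivAt_eq_zero (hF1 0)
    simp at this
    linarith
  · rw [← hF2.deriv]
    exact isLocalMax_deriv_deriv_nonpos hloc (hF1 0).continuousAt

lemma fderiv_of_max_sub_angle_transversal {v : EuclideanSpace ℝ (Fin (n + 1)) → ℝ}
    (hv : ContDiffOn ℝ 2 v {0}ᶜ) {x y z : EuclideanSpace ℝ (Fin (n + 1))} (hx : ‖x‖ = 1)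
    (hy : ‖y‖ = 1) (hz : ‖z‖ = 1) (hxz : ⟪x, z⟫ = 0) (hyz : ⟪y, z⟫ = 0) {L : ℝ}
    (hd : 0 < angle x y) (hd' : angle x y < Real.pi)
    (hmax : ∀ x' y', x' ≠ 0 → y' ≠ 0 → v y' - v x' - L * angle x' y' ≤ v y - v x - L * angle x y) :
    fderiv ℝ v y z = fderiv ℝ v x z ∧
      fderiv ℝ (fderiv ℝ v) y z z - fderiv ℝ (fderiv ℝ v) x z z +
        2 * L * Real.tan (angle x y / 2) ≤ 0 := by
  have hne : ∀ x : EuclideanSpace ℝ (Fin (n + 1)), ‖x‖ = 1 → ⟪x, z⟫ = 0 →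
      ∀ t : ℝ, x + t • z ≠ 0 := by
    intro x hx hxz t h0
    have : ⟪x, x + t • z⟫ = 1 := by
      rw [inner_add_right, real_inner_smul_right, hxz, real_inner_self_eq_norm_sq, hx]; norm_num
    rw [h0, inner_zero_right] at this
    norm_num at this
  have hvx : ∀ t : ℝ, ContDiffAt ℝ 2 v (x + t • z) := fun t =>
    hv.contDiffAt (isOpen_compl_singleton.mem_nhds (hne x hx hxz t))
  have hvy : ∀ t : ℝ, ContDiffAt ℝ 2 v (y + t • z) := fun t =>
    hv.contDiffAt (isOpen_compl_singleton.mem_nhds (hne y hy hyz t))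
  set d := angle x y with hd_def
  set c := Real.cos d with hc
  have hcxy : ⟪x, y⟫ = c := by rw [hc, hd_def, cos_angle, hx, hy]; simp
  have hs : 0 < Real.sin d := Real.sin_pos_of_pos_of_lt_pi hd hd'
  have hc2 : 1 - c ^ 2 = Real.sin d ^ 2 := by have := Real.sin_sq_add_cos_sq d; linarith
  have hc1 : c < 1 := by nlinarith
  have hc1' : -1 < c := by nlinarith
  set q : ℝ → ℝ := fun t => (c + t ^ 2) / (1 + t ^ 2) with hq
  have hang : ∀ t, angle (x + t • z) (y + t • z) = Real.arccos (q t) := by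
    intro t
    have hnorm : ∀ x : EuclideanSpace ℝ (Fin (n + 1)), ‖x‖ = 1 → ⟪x, z⟫ = 0 →
        ‖x + t • z‖ = √(1 + t ^ 2) := by
      intro x hx hxz
      rw [← Real.sqrt_sq (norm_nonneg _), norm_add_sq_real, real_inner_smul_right, hxz, norm_smul,
        hx, hz, Real.norm_eq_abs, mul_one, sq_abs]
      ring_nf
    have hzy : ⟪z, y⟫ = 0 := by rw [real_inner_comm, hyz]
    rw [angle, hnorm x hx hxz, hnorm y hy hyz, Real.mul_self_sqrt (by positivity)]
    simp only [inner_add_left, inner_add_right, real_inner_smul_left, real_inner_smul_right, hxz,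
      hzy, real_inner_self_eq_norm_sq, norm_smul, hz, Real.norm_eq_abs, mul_pow, sq_abs, hcxy, hq]
    ring_nf
  have hqd : ∀ t, HasDerivAt q (t * (2 * (1 - c) / (1 + t ^ 2) ^ 2)) t := by
    intro t
    have h0 : 1 + t ^ 2 ≠ 0 := by positivity
    refine (((hasDerivAt_pow 2 t).const_add c).fun_div ((hasDerivAt_pow 2 t).const_add 1)
      h0).congr_deriv ?_
    field_simp
    ring
  have hq0 : q 0 = c := by simp [hq]
  have hqc : Continuous q := continuous_iff_continuousAt.2 fun t => (hqd t).continuousAt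
  set F : ℝ → ℝ := fun t => v (y + t • z) - v (x + t • z) - L * Real.arccos (q t) with hF
  set B : ℝ → ℝ := fun t => 2 * (1 - c) / (1 + t ^ 2) ^ 2 * (1 / √(1 - q t ^ 2)) with hB
  have hBc : ContinuousAt B 0 := by
    have h1 : √(1 - q 0 ^ 2) ≠ 0 := by rw [hq0, hc2, Real.sqrt_sq hs.le]; exact hs.ne'
    have h2 : ContinuousAt (fun t => √(1 - q t ^ 2)) 0 := by fun_prop
    refine ContinuousAt.mul (ContinuousAt.div (by fun_prop) (by fun_prop) (by norm_num)) ?_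
    exact ContinuousAt.div continuousAt_const h2 h1
  have hev : ∀ᶠ t : ℝ in 𝓝 0, -1 < q t ∧ q t < 1 := by
    have h1 := hqc.tendsto 0
    rw [hq0] at h1
    exact (h1.eventually (lt_mem_nhds hc1')).and (h1.eventually (gt_mem_nhds hc1))
  have hF1 : ∀ᶠ t in 𝓝 0, HasDerivAt F
      (fderiv ℝ v (y + t • z) z - fderiv ℝ v (x + t • z) z + L * (t * B t)) t := by
    filter_upwards [hev] with t ht
    have h1 := (Real.hasDerivAt_arccos ht.1.ne' ht.2.ne).comp t (hqd t)
    refine (((hasDerivAt_comp_line ((hvy t).differentiableAt (by norm_num))).sub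
      (hasDerivAt_comp_line ((hvx t).differentiableAt (by norm_num)))).sub
      (h1.const_mul L)).congr_deriv ?_
    simp only [hB]
    ring
  have hF2 : HasDerivAt (deriv F) (fderiv ℝ (fderiv ℝ v) y z z - fderiv ℝ (fderiv ℝ v) x z z +
      L * B 0) 0 := by
    have h1 := hasDerivAt_fderiv_comp_line (w := z) (hvy 0)
    have h2 := hasDerivAt_fderiv_comp_line (w := z) (hvx 0)
    have h3 : HasDerivAt (fun t => t * B t) (B 0) 0 := by
      rw [hasDerivAt_iff_tendsto_slope]
      refine (hBc.tendsto.mono_left nhdsWithin_le_nhds).congr' ?_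
      filter_upwards [self_mem_nhdsWithin] with t ht
      have ht : t ≠ 0 := ht
      rw [slope_def_field]
      field_simp
      ring
    have h4 := (h1.sub h2).add (h3.const_mul L)
    simp only [zero_smul, add_zero] at h4
    refine h4.congr_of_eventuallyEq ?_
    filter_upwards [hF1] with t ht
    exact ht.deriv
  have hloc : IsLocalMax F 0 := by
    refine Eventually.of_forall fun t => ?_
    have h1 := hmax _ _ (hne x hx hxz t) (hne y hy hyz t)
    rw [hang] at h1
    have h2 : Real.arccos c = d := Real.arccos_cos hd.le hd'.le
    simp only [hF, zero_smul, add_zero, hq0, h2]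
    exact h1
  constructor
  · have := hloc.hasDerivAt_eq_zero hF1.self_of_nhds
    simp at this
    linarith
  · have h1 := isLocalMax_deriv_deriv_nonpos hloc hF1.self_of_nhds.continuousAt
    rw [hF2.deriv] at h1
    have h2 : B 0 = 2 * Real.tan (d / 2) := by
      have hs2 : 0 < Real.sin (d / 2) := Real.sin_pos_of_pos_of_lt_pi (by linarith) (by linarith)
      have hc2' : 0 < Real.cos (d / 2) := Real.cos_pos_of_mem_Ioo ⟨by linarith, by linarith⟩
      have hsd : Real.sin d = 2 * Real.sin (d / 2) * Real.cos (d / 2) := by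
        rw [← Real.sin_two_mul]; ring_nf
      have hcd : c = 1 - 2 * Real.sin (d / 2) ^ 2 := by
        rw [hc, show d = 2 * (d / 2) by ring, Real.cos_two_mul, mul_div_cancel_left₀ _ (two_ne_zero)]
        have := Real.sin_sq_add_cos_sq (d / 2)
        linarith
      simp only [hB, hq0, hc2, Real.sqrt_sq hs.le]
      rw [hsd, hcd, Real.tan_eq_sin_div_cos]
      field_simp
      ring
    rw [h2] at h1
    linarith

end TwoPoint

section GradientEstimate

open InnerProductGeometry Filter Topology

variable {n : ℕ}

/-- A function with tangential derivative bounded by `G` is `G`-Lipschitz for the spherical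
distance. -/
lemma abs_sub_le_mul_angle (hn : 1 ≤ n) {f : EuclideanSpace ℝ (Fin (n + 1)) → ℝ} {G : ℝ}
    (hf : ∀ y, y ≠ 0 → DifferentiableAt ℝ f y)
    (hG : ∀ x v, ‖x‖ = 1 → ‖v‖ = 1 → ⟪x, v⟫ = 0 → |fderiv ℝ f x v| ≤ G)
    {x y : EuclideanSpace ℝ (Fin (n + 1))} (hx : ‖x‖ = 1) (hy : ‖y‖ = 1) :
    |f y - f x| ≤ G * angle x y := by
  obtain ⟨e, he, hxe, hxy⟩ := exists_orthogonal_eq_cos_add_sin hn hx hy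
  have hex : ⟪e, x⟫ = 0 := by rw [real_inner_comm, hxe]
  set c : ℝ → EuclideanSpace ℝ (Fin (n + 1)) := fun t => Real.cos t • x + Real.sin t • e
  set c' : ℝ → EuclideanSpace ℝ (Fin (n + 1)) := fun t => (-Real.sin t) • x + Real.cos t • e
  have hc : ∀ t, HasDerivAt c (c' t) t := fun t =>
    ((Real.hasDerivAt_cos t).smul_const x).add ((Real.hasDerivAt_sin t).smul_const e)
  have hnorm : ∀ a b : ℝ, a ^ 2 + b ^ 2 = 1 → ‖a • x + b • e‖ = 1 := by
    intro a b hab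
    rw [← Real.sqrt_sq (norm_nonneg _), norm_add_sq_real, real_inner_smul_left,
      real_inner_smul_right, hxe, norm_smul, norm_smul, hx, he, Real.norm_eq_abs, Real.norm_eq_abs,
      mul_one, mul_one, sq_abs, sq_abs, mul_zero, mul_zero, mul_zero, add_zero, hab, Real.sqrt_one]
  have hc1 : ∀ t, ‖c t‖ = 1 := fun t => hnorm _ _ (Real.cos_sq_add_sin_sq t)
  have hc1' : ∀ t, ‖c' t‖ = 1 := fun t => hnorm _ _ (by rw [neg_sq, Real.sin_sq_add_cos_sq])
  have hcc : ∀ t, ⟪c t, c' t⟫ = 0 := by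
    intro t
    simp only [c, c', inner_add_left, inner_add_right, real_inner_smul_left, real_inner_smul_right,
      hxe, hex, real_inner_self_eq_norm_sq, hx, he]
    ring
  have hne : ∀ t, c t ≠ 0 := fun t h => by simpa [h] using hc1 t
  have hfc : ∀ t, HasDerivAt (fun t => f (c t)) (fderiv ℝ f (c t) (c' t)) t := fun t =>
    (hf _ (hne t)).hasFDerivAt.comp_hasDerivAt t (hc t)
  have h := Convex.norm_image_sub_le_of_norm_hasDerivWithin_le (f := fun t => f (c t))
    (s := univ) (x := 0) (y := angle x y) (C := G) (fun t _ => (hfc t).hasDerivWithinAt)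
    (fun t _ => hG _ _ (hc1 t) (hc1' t) (hcc t)) convex_univ (mem_univ _) (mem_univ _)
  have h0 : c 0 = x := by simp [c]
  have h1 : c (angle x y) = y := hxy.symm
  simp only [h0, h1, sub_zero, Real.norm_eq_abs, abs_of_nonneg (angle_nonneg x y)] at h
  exact h

lemma fderiv_eq_inner_sphereGrad {m : ℕ} {f : EuclideanSpace ℝ (Fin m) → ℝ}
    {x v : EuclideanSpace ℝ (Fin m)} (hxv : ⟪x, v⟫ = 0) :
    fderiv ℝ f x v = ⟪sphereGrad f x, v⟫ := by
  rw [sphereGrad, inner_sub_left, real_inner_smul_left, hxv, mul_zero, sub_zero,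
    inner_gradient_left]

lemma laplacian_log {m : ℕ} {ι : Type*} [Fintype ι] {w : EuclideanSpace ℝ (Fin m) → ℝ}
    {x : EuclideanSpace ℝ (Fin m)}
    (hw : ContDiffAt ℝ 2 w x) (hx : 0 < w x) (b : OrthonormalBasis ι ℝ (EuclideanSpace ℝ (Fin m))) :
    (∑ i, fderiv ℝ (fderiv ℝ fun z => Real.log (w z)) x (b i) (b i)) +
      ∑ i, (fderiv ℝ (fun z => Real.log (w z)) x (b i)) ^ 2 = laplacian w x / w x := by
  have hev : ∀ᶠ z in 𝓝 x, fderiv ℝ (fun z => Real.log (w z)) z = (w z)⁻¹ • fderiv ℝ w z := by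
    filter_upwards [hw.eventually (by norm_num),
      hw.continuousAt.eventually (lt_mem_nhds hx)] with z hz hz0
    exact ((hz.differentiableAt (by norm_num)).hasFDerivAt.log hz0.ne').fderiv
  have h2 : HasFDerivAt (fderiv ℝ fun z => Real.log (w z))
      ((w x)⁻¹ • fderiv ℝ (fderiv ℝ w) x +
        ((-(w x ^ 2)⁻¹) • fderiv ℝ w x).smulRight (fderiv ℝ w x)) x := by
    refine HasFDerivAt.congr_of_eventuallyEq ?_ hev
    exact ((hasDerivAt_inv hx.ne').comp_hasFDerivAt x
      (hw.differentiableAt (by norm_num)).hasFDerivAt).smul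
      (differentiableAt_fderiv_of_contDiffAt_two hw).hasFDerivAt
  rw [laplacian_eq_sum hw b, ← Finset.sum_add_distrib, Finset.sum_div]
  refine Finset.sum_congr rfl fun i _ => ?_
  rw [h2.fderiv, hev.self_of_nhds]
  simp
  field_simp
  ring

lemma sum_eq_of_rotation {m : ℕ} {ι : Type*} [Fintype ι] [DecidableEq ι]
    (b : OrthonormalBasis ι ℝ (EuclideanSpace ℝ (Fin m)))
    (B : EuclideanSpace ℝ (Fin m) →L[ℝ] EuclideanSpace ℝ (Fin m) →L[ℝ] ℝ) {i j : ι} (hij : i ≠ j)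
    {c s : ℝ} (hcs : c ^ 2 + s ^ 2 = 1) :
    ∑ k, B (b k) (b k) = B (c • b i + s • b j) (c • b i + s • b j) +
      B (s • b i + (-c) • b j) (s • b i + (-c) • b j) +
      ∑ k ∈ (Finset.univ.erase i).erase j, B (b k) (b k) := by
  rw [← Finset.add_sum_erase _ _ (Finset.mem_univ i), ← Finset.add_sum_erase _ _
    (Finset.mem_erase.2 ⟨hij.symm, Finset.mem_univ j⟩)]
  simp only [map_add, map_smul, _root_.add_apply, _root_.smul_apply, smul_eq_mul, neg_smul,
    map_neg, _root_.neg_apply]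
  linear_combination (-(B (b i) (b i)) - B (b j) (b j)) * hcs

lemma fderiv_self_of_degree_zero {m : ℕ} {v : EuclideanSpace ℝ (Fin m) → ℝ}
    (hv : ContDiffOn ℝ 2 v {0}ᶜ) (hhom : ∀ t : ℝ, 0 < t → ∀ y, y ≠ 0 → v (t • y) = v y)
    {y : EuclideanSpace ℝ (Fin m)} (hy : y ≠ 0) :
    fderiv ℝ v y y = 0 ∧ fderiv ℝ (fderiv ℝ v) y y y = 0 := by
  have hE : ∀ z, z ≠ 0 → fderiv ℝ v z z = 0 := fun z hz => by
    rw [fderiv_self_of_homogeneous (s := 0) (by simpa using hhom) hz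
      ((hv.contDiffAt (isOpen_compl_singleton.mem_nhds hz)).differentiableAt (by norm_num)),
      zero_mul]
  refine ⟨hE y hy, ?_⟩
  have h1 := hasDerivAt_fderiv_comp_line (v := y) (w := y) (s := 0) (u := v) (x := y)
    (by simpa using hv.contDiffAt (isOpen_compl_singleton.mem_nhds hy))
  have h2 : (fun t : ℝ => fderiv ℝ v (y + t • y) y) =ᶠ[𝓝 0] fun _ => 0 := by
    filter_upwards [lt_mem_nhds (show (-1 : ℝ) < 0 by norm_num)] with t ht
    have h3 : y + t • y = (1 + t) • y := by rw [add_smul, one_smul]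
    have h4 : (1 + t) ≠ 0 := by linarith
    have h5 := hE _ (smul_ne_zero h4 hy)
    rw [map_smul, smul_eq_mul, mul_eq_zero] at h5
    rw [h3]
    exact h5.resolve_left h4
  have h3 := h1.unique ((hasDerivAt_const (0 : ℝ) (0 : ℝ)).congr_of_eventuallyEq h2)
  simpa using h3

set_option maxHeartbeats 400000 in
/-- Two-point maximum principle for positive solutions of `Δ_S w = (λ f - n) w`. -/
lemma log_sub_log_le_of_lt (hn : 2 ≤ n) {w f : EuclideanSpace ℝ (Fin (n + 1)) → ℝ} {lam G L : ℝ}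
    (hw : ContDiffOn ℝ 2 w {0}ᶜ) (hpos : ∀ y, y ≠ 0 → 0 < w y)
    (hhom : ∀ t : ℝ, 0 < t → ∀ y, y ≠ 0 → w (t • y) = w y)
    (hlap : ∀ x, ‖x‖ = 1 → laplacian w x = (lam * f x - n) * w x) (hlam : 0 ≤ lam)
    (hG0 : 0 ≤ G)
    (hG : ∀ x y, ‖x‖ = 1 → ‖y‖ = 1 → |f y - f x| ≤ G * angle x y)
    (hL : lam * G < (n - 1) * L) {x y : EuclideanSpace ℝ (Fin (n + 1))} (hx : ‖x‖ = 1)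
    (hy : ‖y‖ = 1) : Real.log (w y) - Real.log (w x) ≤ L * angle x y := by
  have hn' : (2 : ℝ) ≤ n := by exact_mod_cast hn
  have hL0 : 0 < L := by
    have : 0 < ((n : ℝ) - 1) * L := lt_of_le_of_lt (by positivity) hL
    exact pos_of_mul_pos_right this (by linarith)
  set v : EuclideanSpace ℝ (Fin (n + 1)) → ℝ := fun z => Real.log (w z) with hv_def
  have hv : ContDiffOn ℝ 2 v {0}ᶜ := hw.log fun z hz => (hpos z hz).ne'
  have hvhom : ∀ t : ℝ, 0 < t → ∀ y, y ≠ 0 → v (t • y) = v y := fun t ht y hy => by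
    simp only [hv_def, hhom t ht y hy]
  have hvc : ContinuousOn v (sphere 0 1) := hv.continuousOn.mono fun z hz => by
    rw [mem_sphere_zero_iff_norm] at hz
    exact fun h => by simp [show z = 0 from h] at hz
  have hne : ∀ z : EuclideanSpace ℝ (Fin (n + 1)), ‖z‖ = 1 → z ≠ 0 := fun z hz h => by
    simp [h] at hz
  set S : Set (EuclideanSpace ℝ (Fin (n + 1))) := sphere 0 1
  set Z : EuclideanSpace ℝ (Fin (n + 1)) × EuclideanSpace ℝ (Fin (n + 1)) → ℝ :=
    fun p => v p.2 - v p.1 - L * angle p.1 p.2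
  have hZc : ContinuousOn Z (S ×ˢ S) := by
    refine ContinuousOn.sub (ContinuousOn.sub (hvc.comp continuousOn_snd fun p hp => hp.2)
      (hvc.comp continuousOn_fst fun p hp => hp.1)) (continuousOn_const.mul ?_)
    intro p hp
    exact (continuousAt_angle (hne _ (by simpa [S] using hp.1))
      (hne _ (by simpa [S] using hp.2))).continuousWithinAt
  obtain ⟨⟨a, b⟩, hab, hmax⟩ := ((isCompact_sphere _ _).prod (isCompact_sphere _ _)).exists_isMaxOn
    ⟨(x, y), by simp [hx], by simp [hy]⟩ hZc
  have ha : ‖a‖ = 1 := by simpa [S] using hab.1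
  have hb : ‖b‖ = 1 := by simpa [S] using hab.2
  by_contra! hcon
  have hZab : 0 < Z (a, b) := by
    have h1 : Z (x, y) ≤ Z (a, b) := hmax ⟨by simp [hx], by simp [hy]⟩
    have h2 : 0 < Z (x, y) := by simp only [Z]; linarith
    linarith
  have hmax' : ∀ x' y', x' ≠ 0 → y' ≠ 0 → v y' - v x' - L * angle x' y' ≤
      v b - v a - L * angle a b := by
    intro x' y' hx' hy'
    have hx'' := inv_pos.2 (norm_pos_iff.2 hx')
    have hy'' := inv_pos.2 (norm_pos_iff.2 hy')
    have h1 : Z (‖x'‖⁻¹ • x', ‖y'‖⁻¹ • y') ≤ Z (a, b) :=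
      hmax ⟨by simp [norm_smul, hx'], by simp [norm_smul, hy']⟩
    simpa only [Z, hvhom _ hx'' _ hx', hvhom _ hy'' _ hy', angle_smul_left_of_pos _ _ hx'',
      angle_smul_right_of_pos _ _ hy''] using h1
  obtain ⟨e, he, hae, hba⟩ := exists_orthogonal_eq_cos_add_sin (by omega : 1 ≤ n) ha hb
  have hea : ⟪e, a⟫ = 0 := by rw [real_inner_comm, hae]
  have hd : 0 < angle a b := by
    refine lt_of_le_of_ne (angle_nonneg _ _) fun h => ?_
    rw [← h] at hba
    simp only [Real.cos_zero, Real.sin_zero, one_smul, zero_smul, add_zero] at hba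
    simp only [Z, hba, angle_self (hne a ha)] at hZab
    simp at hZab
  set d := angle a b with hd_def
  have hnegv : ContDiffOn ℝ 2 (fun z => -v z) {0}ᶜ := hv.neg
  have hfn : (fderiv ℝ fun z => -v z) = fun z => -fderiv ℝ v z := funext fun z => fderiv_fun_neg
  have hfirst : ∀ e : EuclideanSpace ℝ (Fin (n + 1)), ‖e‖ = 1 → ⟪a, e⟫ = 0 →
      b = Real.cos d • a + Real.sin d • e →
      fderiv ℝ v a e = L ∧ 0 ≤ fderiv ℝ (fderiv ℝ v) a e e := by
    intro e he hae hba
    have h := fderiv_of_max_sub_angle hnegv ha hb he hae hL0.le hba hd fun z hz => by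
      have := hmax' z b hz (hne b hb)
      linarith
    rw [hfn] at h
    rw [fderiv_fun_neg] at h
    simp only [_root_.neg_apply] at h
    constructor <;> linarith [h.1, h.2]
  have hd' : d < Real.pi := by
    refine lt_of_le_of_ne (angle_le_pi _ _) fun h => ?_
    have h1 := (hfirst e he hae hba).1
    have h2 := (hfirst (-e) (by simpa using he) (by simpa using hae) (by
      rw [hba, h]; simp)).1
    rw [map_neg] at h2
    linarith
  obtain ⟨ha1, ha2⟩ := hfirst e he hae hba
  set e' : EuclideanSpace ℝ (Fin (n + 1)) := Real.sin d • a + (-Real.cos d) • e with he'_def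
  have hcs := Real.cos_sq_add_sin_sq d
  have hb' : ‖e'‖ = 1 := by
    rw [← Real.sqrt_sq (norm_nonneg _), he'_def, norm_add_sq_real, real_inner_smul_left,
      real_inner_smul_right, hae, norm_smul, norm_smul, ha, he, Real.norm_eq_abs, Real.norm_eq_abs,
      mul_one, mul_one, sq_abs, sq_abs, Real.sqrt_eq_one]
    linarith
  have hbe' : ⟪b, e'⟫ = 0 := by
    rw [hba, he'_def]
    simp only [inner_add_left, inner_add_right, real_inner_smul_left, real_inner_smul_right,
      hae, hea, real_inner_self_eq_norm_sq, ha, he]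
    ring
  have hab' : a = Real.cos d • b + Real.sin d • e' := by
    rw [hba, he'_def]
    simp only [smul_add, smul_smul, neg_smul, smul_neg]
    have h1 : a = (Real.cos d ^ 2 + Real.sin d ^ 2) • a := by rw [hcs, one_smul]
    nth_rewrite 1 [h1]
    module
  obtain ⟨hb1, hb2⟩ := fderiv_of_max_sub_angle hv hb ha hb' hbe' hL0.le
    (by rw [angle_comm]; exact hab') (by rw [angle_comm]; exact hd) fun z hz => by
      have := hmax' a z (hne a ha) hz
      rw [angle_comm z a, angle_comm b a]
      linarith
  have hcard : Module.finrank ℝ (EuclideanSpace ℝ (Fin (n + 1))) = Fintype.card (Fin (n + 1)) := by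
    simp
  have h01 : (0 : Fin (n + 1)) ≠ Fin.last n := by simp [Fin.ext_iff]; omega
  set p : Fin (n + 1) → EuclideanSpace ℝ (Fin (n + 1)) := fun i => if i = 0 then a else e
  have hp : Orthonormal ℝ (({0, Fin.last n} : Set (Fin (n + 1))).domRestrict p) := by
    constructor
    · rintro ⟨i, hi⟩
      simp only [domRestrict_apply, p]
      split_ifs <;> assumption
    · rintro ⟨i, hi⟩ ⟨j, hj⟩ hij
      simp only [ne_eq, Subtype.mk.injEq] at hij
      simp only [domRestrict_apply, p]
      rcases hi with rfl | hi <;> rcases hj with rfl | hj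
      · exact absurd rfl hij
      · simpa [Ne.symm hij] using hae
      · simpa [hij] using hea
      · exact absurd (hi.trans hj.symm) hij
  obtain ⟨q, hq⟩ := hp.exists_orthonormalBasis_extension_of_card_eq hcard
  have hq0 : q 0 = a := by rw [hq 0 (by simp)]; simp [p]
  have hq1 : q (Fin.last n) = e := by rw [hq _ (by simp)]; simp [p, h01.symm]
  set I : Finset (Fin (n + 1)) := (Finset.univ.erase 0).erase (Fin.last n) with hI
  have hcardI : (I.card : ℝ) = n - 1 := by
    rw [hI, Finset.card_erase_of_mem (by simp [h01.symm]), Finset.card_erase_of_mem (by simp)]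
    simp only [Finset.card_univ, Fintype.card_fin, Nat.add_sub_cancel]
    rw [Nat.cast_sub (by omega)]
    simp
  have htrans : ∀ k ∈ I, fderiv ℝ v b (q k) = fderiv ℝ v a (q k) ∧
      fderiv ℝ (fderiv ℝ v) b (q k) (q k) - fderiv ℝ (fderiv ℝ v) a (q k) (q k) +
        2 * L * Real.tan (d / 2) ≤ 0 := by
    intro k hk
    simp only [hI, Finset.mem_erase] at hk
    have h1 : ⟪a, q k⟫ = 0 := by rw [← hq0]; exact q.inner_eq_zero hk.2.1.symm
    have h2 : ⟪e, q k⟫ = 0 := by rw [← hq1]; exact q.inner_eq_zero hk.1.symm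
    refine fderiv_of_max_sub_angle_transversal hv ha hb (by simp) h1 ?_ hd hd' hmax'
    rw [hba, inner_add_left, real_inner_smul_left, real_inner_smul_left, h1, h2]
    ring
  obtain ⟨hra, hra'⟩ := fderiv_self_of_degree_zero hv hvhom (hne a ha)
  obtain ⟨hrb, hrb'⟩ := fderiv_self_of_degree_zero hv hvhom (hne b hb)
  have hsum : ∀ B : EuclideanSpace ℝ (Fin (n + 1)) →L[ℝ] EuclideanSpace ℝ (Fin (n + 1)) →L[ℝ] ℝ,
      ∑ k, B (q k) (q k) = B b b + B e' e' + ∑ k ∈ I, B (q k) (q k) := by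
    intro B
    rw [sum_eq_of_rotation q B h01 hcs, hq0, hq1, ← hba, ← he'_def]
  have hsum' : ∀ B : EuclideanSpace ℝ (Fin (n + 1)) →L[ℝ] EuclideanSpace ℝ (Fin (n + 1)) →L[ℝ] ℝ,
      ∑ k, B (q k) (q k) = B a a + B e e + ∑ k ∈ I, B (q k) (q k) := by
    intro B
    have h := sum_eq_of_rotation q B h01 (c := 1) (s := 0) (by norm_num)
    rw [hq0, hq1] at h
    simpa using h
  have hcd : ∀ z, z ≠ 0 → ContDiffAt ℝ 2 w z := fun z hz =>
    hw.contDiffAt (isOpen_compl_singleton.mem_nhds hz)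
  have hlog : ∀ z, ‖z‖ = 1 → (∑ i, fderiv ℝ (fderiv ℝ v) z (q i) (q i)) +
      ∑ i, ((fderiv ℝ v z).smulRight (fderiv ℝ v z)) (q i) (q i) = lam * f z - n := by
    intro z hz
    have h := laplacian_log (hcd z (hne z hz)) (hpos z (hne z hz)) q
    rw [hlap z hz, mul_div_cancel_right₀ _ (hpos z (hne z hz)).ne'] at h
    rw [← h]
    congr 1
    refine Finset.sum_congr rfl fun i _ => ?_
    simp [sq]
    rfl
  have ea := hlog a ha
  have eb := hlog b hb
  rw [hsum' (fderiv ℝ (fderiv ℝ v) a), hsum' ((fderiv ℝ v a).smulRight (fderiv ℝ v a))] at ea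
  rw [hsum (fderiv ℝ (fderiv ℝ v) b), hsum ((fderiv ℝ v b).smulRight (fderiv ℝ v b))] at eb
  simp only [ContinuousLinearMap.smulRight_apply, _root_.smul_apply, smul_eq_mul, hra, hrb, ha1,
    hb1, hra', hrb'] at ea eb
  have hgrad : ∑ k ∈ I, fderiv ℝ v b (q k) * fderiv ℝ v b (q k) =
      ∑ k ∈ I, fderiv ℝ v a (q k) * fderiv ℝ v a (q k) :=
    Finset.sum_congr rfl fun k hk => by rw [(htrans k hk).1]
  have hhess : ∑ k ∈ I, fderiv ℝ (fderiv ℝ v) b (q k) (q k) -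
      ∑ k ∈ I, fderiv ℝ (fderiv ℝ v) a (q k) (q k) + (n - 1) * (2 * L * Real.tan (d / 2)) ≤ 0 := by
    have h := Finset.sum_nonpos fun k hk => (htrans k hk).2
    rw [Finset.sum_add_distrib, Finset.sum_sub_distrib, Finset.sum_const, nsmul_eq_mul, hcardI] at h
    exact h
  have htan : d / 2 < Real.tan (d / 2) := Real.lt_tan (by linarith) (by linarith)
  have hfG := abs_le.1 (hG a b ha hb)
  have h1 : (n - 1) * (2 * L * Real.tan (d / 2)) ≤ lam * (G * d) := by
    have := mul_le_mul_of_nonneg_left hfG.1 hlam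
    rw [hgrad] at eb
    linarith
  have h2 : (n - 1) * (2 * L * (d / 2)) ≤ (n - 1) * (2 * L * Real.tan (d / 2)) := by
    have : (0 : ℝ) ≤ n - 1 := by linarith
    gcongr
  have h3 := mul_lt_mul_of_pos_right hL hd
  linarith

lemma log_sub_log_le (hn : 2 ≤ n) {w f : EuclideanSpace ℝ (Fin (n + 1)) → ℝ} {lam G : ℝ}
    (hw : ContDiffOn ℝ 2 w {0}ᶜ) (hpos : ∀ y, y ≠ 0 → 0 < w y)
    (hhom : ∀ t : ℝ, 0 < t → ∀ y, y ≠ 0 → w (t • y) = w y)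
    (hlap : ∀ x, ‖x‖ = 1 → laplacian w x = (lam * f x - n) * w x) (hlam : 0 ≤ lam)
    (hG0 : 0 ≤ G)
    (hG : ∀ x y, ‖x‖ = 1 → ‖y‖ = 1 → |f y - f x| ≤ G * angle x y)
    {x y : EuclideanSpace ℝ (Fin (n + 1))} (hx : ‖x‖ = 1) (hy : ‖y‖ = 1) :
    Real.log (w y) - Real.log (w x) ≤ lam * G / (n - 1) * angle x y := by
  have hn' : (2 : ℝ) ≤ n := by exact_mod_cast hn
  have hn1 : (0 : ℝ) < n - 1 := by linarith
  have hL : ∀ L, lam * G / (n - 1) < L → Real.log (w y) - Real.log (w x) ≤ L * angle x y := by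
    intro L hL
    rw [div_lt_iff₀' hn1] at hL
    exact log_sub_log_le_of_lt hn hw hpos hhom hlap hlam hG0 hG hL hx hy
  refine ge_of_tendsto (x := 𝓝[>] (lam * G / (n - 1)))
    (f := fun L => L * angle x y) ?_ (eventually_nhdsWithin_of_forall hL)
  exact (continuous_id.mul continuous_const).continuousAt.tendsto.mono_left nhdsWithin_le_nhds

end GradientEstimate

section RieszPotential

open Filter Topology

variable {n : ℕ}

/-- The integral of a rotation invariant and jointly homogeneous kernel. -/
lemma integral_kernel_eq_rpow_mul {Φ : EuclideanSpace ℝ (Fin (n + 1)) →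
    EuclideanSpace ℝ (Fin (n + 1)) → ℝ} {p : ℝ}
    (hrot : ∀ (R : EuclideanSpace ℝ (Fin (n + 1)) ≃ₗᵢ[ℝ] EuclideanSpace ℝ (Fin (n + 1))) x y,
      Φ (R x) (R y) = Φ x y)
    (hsc : ∀ t : ℝ, 0 < t → ∀ x y, Φ (t • x) (t • y) = t ^ p * Φ x y)
    {e x : EuclideanSpace ℝ (Fin (n + 1))} (he : ‖e‖ = 1) (hx : x ≠ 0) :
    ∫ y, Φ x y = ‖x‖ ^ (n + 1 + p) * ∫ y, Φ e y := by
  have hx0 : 0 < ‖x‖ := norm_pos_iff.2 hx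
  obtain ⟨R, hR⟩ := exists_linearIsometryEquiv_apply_eq (x := ‖x‖ • e) (y := x)
    (by rw [norm_smul, he, mul_one, norm_norm])
  have h1 : ∫ y, Φ x y = ∫ y, Φ (‖x‖ • e) y := by
    rw [← R.measurePreserving.integral_comp R.toHomeomorph.measurableEmbedding (fun y => Φ x y)]
    refine integral_congr_ae (ae_of_all _ fun y => ?_)
    simp only
    conv_lhs => rw [← hR]
    rw [hrot]
  have h2 := Measure.integral_comp_smul (volume : Measure (EuclideanSpace ℝ (Fin (n + 1))))
    (fun y => Φ (‖x‖ • e) y) ‖x‖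
  simp only [hsc _ hx0, integral_const_mul, finrank_euclideanSpace, Fintype.card_fin,
    smul_eq_mul] at h2
  rw [abs_of_pos (by positivity)] at h2
  rw [h1, Real.rpow_add hx0]
  have h3 : ‖x‖ ^ ((n : ℝ) + 1) = ‖x‖ ^ (n + 1) := by
    rw [← Real.rpow_natCast]; push_cast; rfl
  rw [h3, mul_assoc, h2, mul_inv_cancel_left₀ (by positivity)]

/-- The regularised squared distance. -/
noncomputable def regSq (ε : ℝ) (x y : EuclideanSpace ℝ (Fin (n + 1))) : ℝ :=
  ‖x - y‖ ^ 2 + ε ^ 2 * ‖y‖ ^ 2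

lemma regSq_pos {ε : ℝ} (hε : ε ≠ 0) {x : EuclideanSpace ℝ (Fin (n + 1))} (hx : x ≠ 0)
    (y : EuclideanSpace ℝ (Fin (n + 1))) : 0 < regSq ε x y := by
  unfold regSq
  rcases eq_or_ne y 0 with rfl | hy
  · have : 0 < ‖x‖ := norm_pos_iff.2 hx
    simpa using by positivity
  · have : 0 < ‖y‖ := norm_pos_iff.2 hy
    positivity

lemma norm_sq_le_regSq (ε : ℝ) (x y : EuclideanSpace ℝ (Fin (n + 1))) :
    ‖x - y‖ ^ 2 ≤ regSq ε x y := by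
  unfold regSq
  have : 0 ≤ ε ^ 2 * ‖y‖ ^ 2 := by positivity
  linarith

lemma regSq_nonneg (ε : ℝ) (x y : EuclideanSpace ℝ (Fin (n + 1))) : 0 ≤ regSq ε x y :=
  (sq_nonneg _).trans (norm_sq_le_regSq ε x y)

lemma sq_rpow_half {r : ℝ} (hr : 0 ≤ r) (q : ℝ) : (r ^ 2) ^ (q / 2) = r ^ q := by
  rw [← Real.rpow_natCast, ← Real.rpow_mul hr]
  congr 1
  push_cast; ring

lemma regSq_zero_rpow (x y : EuclideanSpace ℝ (Fin (n + 1))) (q : ℝ) :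
    regSq 0 x y ^ (q / 2) = ‖x - y‖ ^ q := by
  unfold regSq
  rw [zero_pow two_ne_zero, zero_mul, add_zero, sq_rpow_half (norm_nonneg _)]

lemma regSq_rpow_le {ε q : ℝ} (hq : 0 ≤ q) {x y : EuclideanSpace ℝ (Fin (n + 1))}
    (hxy : x ≠ y) : regSq ε x y ^ (-q / 2) ≤ ‖x - y‖ ^ (-q) := by
  have h : 0 < ‖x - y‖ := norm_pos_iff.2 (sub_ne_zero.2 hxy)
  rw [← sq_rpow_half h.le]
  exact Real.rpow_le_rpow_of_nonpos (by positivity) (norm_sq_le_regSq ε x y) (by linarith)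

lemma measurable_regSq_rpow (ε q : ℝ) (x : EuclideanSpace ℝ (Fin (n + 1))) :
    Measurable fun y => regSq ε x y ^ q := by
  unfold regSq
  exact (((measurable_const.sub measurable_id).norm.pow_const 2).add
    (measurable_const.mul (measurable_norm.pow_const 2))).pow_const q

/-- The derivative in the first variable of the regularised Newtonian kernel. -/
noncomputable def regKerDeriv (ε : ℝ) (x y : EuclideanSpace ℝ (Fin (n + 1))) :
    EuclideanSpace ℝ (Fin (n + 1)) →L[ℝ] ℝ :=
  (-((n : ℝ) - 1) * regSq ε x y ^ (-((n : ℝ) + 1) / 2)) • innerSL ℝ (x - y)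

lemma hasFDerivAt_regSq_rpow {ε : ℝ} (hε : ε ≠ 0) {x : EuclideanSpace ℝ (Fin (n + 1))}
    (hx : x ≠ 0) (y : EuclideanSpace ℝ (Fin (n + 1))) :
    HasFDerivAt (fun x => regSq ε x y ^ (-((n : ℝ) - 1) / 2)) (regKerDeriv ε x y) x := by
  have h1 : HasFDerivAt (fun x => regSq ε x y) (2 • innerSL ℝ (x - y)) x := by
    have := (hasStrictFDerivAt_norm_sq (x - y)).hasFDerivAt.comp x
      ((hasFDerivAt_id x).sub_const y)
    simpa [Function.comp_def, regSq] using this.add_const (ε ^ 2 * ‖y‖ ^ 2)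
  have h2 := h1.rpow_const (p := -((n : ℝ) - 1) / 2) (Or.inl (regSq_pos hε hx y).ne')
  refine h2.congr_fderiv ?_
  ext v
  simp only [regKerDeriv, _root_.smul_apply, smul_eq_mul, nsmul_eq_mul, Nat.cast_ofNat]
  rw [show -((n : ℝ) - 1) / 2 - 1 = -((n : ℝ) + 1) / 2 by ring]
  ring

lemma norm_regKerDeriv (hn : 1 ≤ n) (ε : ℝ) (x y : EuclideanSpace ℝ (Fin (n + 1))) :
    ‖regKerDeriv ε x y‖ = ((n : ℝ) - 1) * (regSq ε x y ^ (-((n : ℝ) + 1) / 2) * ‖x - y‖) := by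
  have hn' : (1 : ℝ) ≤ n := by exact_mod_cast hn
  rw [regKerDeriv, norm_smul, innerSL_apply_norm, norm_mul, Real.norm_eq_abs, abs_neg,
    abs_of_nonneg (by linarith), Real.norm_of_nonneg (Real.rpow_nonneg (regSq_nonneg _ _ _) _),
    mul_assoc]

lemma norm_regKerDeriv_le (hn : 1 ≤ n) (ε : ℝ) {x y : EuclideanSpace ℝ (Fin (n + 1))}
    (hxy : x ≠ y) : ‖regKerDeriv ε x y‖ ≤ ((n : ℝ) - 1) * ‖x - y‖ ^ (-(n : ℝ)) := by
  have hn' : (1 : ℝ) ≤ n := by exact_mod_cast hn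
  have h : 0 < ‖x - y‖ := norm_pos_iff.2 (sub_ne_zero.2 hxy)
  rw [norm_regKerDeriv hn]
  have h1 := regSq_rpow_le (ε := ε) (q := (n : ℝ) + 1) (by positivity) hxy
  have h2 : ‖x - y‖ ^ (-(n : ℝ)) = ‖x - y‖ ^ (-((n : ℝ) + 1)) * ‖x - y‖ := by
    rw [← Real.rpow_add_one h.ne']; ring_nf
  rw [h2]
  have : (0 : ℝ) ≤ (n : ℝ) - 1 := by linarith
  gcongr

lemma continuous_regKerDeriv_left {ε : ℝ} (hε : ε ≠ 0) {x : EuclideanSpace ℝ (Fin (n + 1))}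
    (hx : x ≠ 0) (y : EuclideanSpace ℝ (Fin (n + 1))) :
    ContinuousAt (fun x => regKerDeriv ε x y) x := by
  unfold regKerDeriv
  have h1 : ContinuousAt (fun x => regSq ε x y) x := by
    unfold regSq
    fun_prop
  have h2 : ContinuousAt (fun x => innerSL ℝ (x - y)) x := by fun_prop
  exact (continuousAt_const.mul (h1.rpow_const (Or.inl (regSq_pos hε hx y).ne'))).smul h2

lemma measurable_regKerDeriv (ε : ℝ) (x : EuclideanSpace ℝ (Fin (n + 1))) :
    Measurable (fun y => regKerDeriv ε x y) := by
  unfold regKerDeriv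
  have h1 : Measurable (fun y => innerSL ℝ (x - y)) :=
    ((innerSL ℝ).continuous.comp (continuous_const.sub continuous_id)).measurable
  exact ((measurable_regSq_rpow ε _ x).const_mul _).smul h1

/-- Near a point `x₀ ≠ 0`, the regularised distance dominates the distance to `x₀`. -/
lemma norm_sub_sq_le_mul_regSq {ε : ℝ} (hε : ε ≠ 0) {x₀ x : EuclideanSpace ℝ (Fin (n + 1))}
    (hx : ‖x - x₀‖ ≤ ‖x₀‖ / 2) (y : EuclideanSpace ℝ (Fin (n + 1))) :
    ‖x₀ - y‖ ^ 2 ≤ (8 + 2 / ε ^ 2) * regSq ε x y := by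
  have h1 : ‖x₀ - y‖ ≤ ‖x - x₀‖ + ‖x - y‖ := by
    rw [norm_sub_rev x x₀]
    simpa using norm_add_le (x₀ - x) (x - y)
  have h2 : ‖x‖ ≤ ‖x - y‖ + ‖y‖ := by simpa using norm_add_le (x - y) y
  have h3 : ‖x₀‖ ≤ ‖x - x₀‖ + ‖x‖ := by
    rw [norm_sub_rev]; simpa using norm_add_le (x₀ - x) x
  have h4 : ‖x₀ - y‖ ≤ 2 * ‖x - y‖ + ‖y‖ := by linarith
  have h5 : ‖x₀ - y‖ ^ 2 ≤ 8 * ‖x - y‖ ^ 2 + 2 * ‖y‖ ^ 2 := by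
    have := pow_le_pow_left₀ (norm_nonneg _) h4 2
    nlinarith [sq_nonneg (2 * ‖x - y‖ - ‖y‖)]
  refine h5.trans ?_
  unfold regSq
  have h6 : (8 + 2 / ε ^ 2) * (‖x - y‖ ^ 2 + ε ^ 2 * ‖y‖ ^ 2) =
      8 * ‖x - y‖ ^ 2 + 2 * ‖y‖ ^ 2 + (2 / ε ^ 2 * ‖x - y‖ ^ 2 + 8 * (ε ^ 2 * ‖y‖ ^ 2)) := by
    field_simp
    ring
  rw [h6]
  have : 0 ≤ 2 / ε ^ 2 * ‖x - y‖ ^ 2 + 8 * (ε ^ 2 * ‖y‖ ^ 2) := by positivity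
  linarith

lemma norm_regKerDeriv_le_of_near (hn : 1 ≤ n) {ε : ℝ} (hε : ε ≠ 0)
    {x₀ x y : EuclideanSpace ℝ (Fin (n + 1))} (hx : ‖x - x₀‖ ≤ ‖x₀‖ / 2) (hy : x₀ ≠ y) :
    ‖regKerDeriv ε x y‖ ≤
      ((n : ℝ) - 1) * (8 + 2 / ε ^ 2) ^ ((n : ℝ) / 2) * ‖x₀ - y‖ ^ (-(n : ℝ)) := by
  have hn' : (1 : ℝ) ≤ n := by exact_mod_cast hn
  have h : 0 < ‖x₀ - y‖ := norm_pos_iff.2 (sub_ne_zero.2 hy)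
  have hA : 0 < 8 + 2 / ε ^ 2 := by positivity
  have h1 := norm_sub_sq_le_mul_regSq hε hx y
  have hq : 0 < regSq ε x y := by
    by_contra! h0
    have h' : 0 < ‖x₀ - y‖ ^ 2 := by positivity
    nlinarith
  rw [norm_regKerDeriv hn, mul_assoc]
  have h2 : ‖x - y‖ ≤ regSq ε x y ^ ((1 : ℝ) / 2) := by
    rw [← Real.sqrt_eq_rpow]
    exact Real.le_sqrt_of_sq_le (norm_sq_le_regSq ε x y)
  have h3 : regSq ε x y ^ (-((n : ℝ) + 1) / 2) * ‖x - y‖ ≤ regSq ε x y ^ (-(n : ℝ) / 2) := by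
    refine (mul_le_mul_of_nonneg_left h2 (by positivity)).trans (le_of_eq ?_)
    rw [← Real.rpow_add hq]; ring_nf
  have h4 : regSq ε x y ^ (-(n : ℝ) / 2) ≤ (8 + 2 / ε ^ 2) ^ ((n : ℝ) / 2) * ‖x₀ - y‖ ^ (-(n : ℝ)) := by
    have h5 : ‖x₀ - y‖ ^ 2 / (8 + 2 / ε ^ 2) ≤ regSq ε x y := by
      rw [div_le_iff₀ hA]; linarith
    have h6 := Real.rpow_le_rpow_of_nonpos (z := -(n : ℝ) / 2) (by positivity) h5
      (by linarith)
    refine h6.trans (le_of_eq ?_)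
    rw [Real.div_rpow (by positivity) hA.le, sq_rpow_half h.le, neg_div,
      Real.rpow_neg hA.le, div_inv_eq_mul, mul_comm]
  have : (0 : ℝ) ≤ (n : ℝ) - 1 := by linarith
  exact mul_le_mul_of_nonneg_left (h3.trans h4) this

end RieszPotential

section RieszPotential

open Filter Topology

variable {n : ℕ}

/-- The regularised Newtonian potential of the density `‖y‖ ^ (-(n + 3) / 2) * b y`. -/
noncomputable def regPot (ε : ℝ) (b : EuclideanSpace ℝ (Fin (n + 1)) → ℝ)
    (x : EuclideanSpace ℝ (Fin (n + 1))) : ℝ :=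
  ∫ y, (‖y‖ ^ (-(((n : ℝ) + 3) / 2)) * b y) * regSq ε x y ^ (-((n : ℝ) - 1) / 2)

/-- The derivative of `regPot`. -/
noncomputable def regPotDeriv (ε : ℝ) (b : EuclideanSpace ℝ (Fin (n + 1)) → ℝ)
    (x : EuclideanSpace ℝ (Fin (n + 1))) : EuclideanSpace ℝ (Fin (n + 1)) →L[ℝ] ℝ :=
  ∫ y, (‖y‖ ^ (-(((n : ℝ) + 3) / 2)) * b y) • regKerDeriv ε x y

lemma integrable_riesz_sub_one (hn : 2 ≤ n) {x : EuclideanSpace ℝ (Fin (n + 1))} (hx : x ≠ 0) :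
    Integrable (fun y => ‖x - y‖ ^ (-((n : ℝ) - 1)) * ‖y‖ ^ (-(((n : ℝ) + 3) / 2))) := by
  have hn' : (2 : ℝ) ≤ n := by exact_mod_cast hn
  exact integrable_riesz (by omega) (by linarith) (by push_cast; linarith)
    (by push_cast; linarith) (by push_cast; linarith) hx

lemma integrable_riesz_self (hn : 2 ≤ n) {x : EuclideanSpace ℝ (Fin (n + 1))} (hx : x ≠ 0) :
    Integrable (fun y => ‖x - y‖ ^ (-(n : ℝ)) * ‖y‖ ^ (-(((n : ℝ) + 3) / 2))) := by
  have hn' : (2 : ℝ) ≤ n := by exact_mod_cast hn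
  exact integrable_riesz (by omega) (by linarith) (by push_cast; linarith)
    (by push_cast; linarith) (by push_cast; linarith) hx

lemma aestronglyMeasurable_density {b : EuclideanSpace ℝ (Fin (n + 1)) → ℝ}
    (hb : AEStronglyMeasurable b) :
    AEStronglyMeasurable (fun y => ‖y‖ ^ (-(((n : ℝ) + 3) / 2)) * b y) :=
  (measurable_norm.pow_const _).aestronglyMeasurable.mul hb

lemma abs_density_le {b : EuclideanSpace ℝ (Fin (n + 1)) → ℝ} {B : ℝ}
    {y : EuclideanSpace ℝ (Fin (n + 1))} (hB : |b y| ≤ B) :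
    ‖‖y‖ ^ (-(((n : ℝ) + 3) / 2)) * b y‖ ≤ B * ‖y‖ ^ (-(((n : ℝ) + 3) / 2)) := by
  rw [norm_mul, Real.norm_of_nonneg (by positivity), mul_comm, Real.norm_eq_abs]
  gcongr

lemma norm_regPot_integrand_le (hn : 2 ≤ n) (ε : ℝ) {b : EuclideanSpace ℝ (Fin (n + 1)) → ℝ}
    {B : ℝ} {x y : EuclideanSpace ℝ (Fin (n + 1))} (hB : |b y| ≤ B) (hxy : x ≠ y) :
    ‖(‖y‖ ^ (-(((n : ℝ) + 3) / 2)) * b y) * regSq ε x y ^ (-((n : ℝ) - 1) / 2)‖ ≤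
      B * (‖x - y‖ ^ (-((n : ℝ) - 1)) * ‖y‖ ^ (-(((n : ℝ) + 3) / 2))) := by
  have hn' : (2 : ℝ) ≤ n := by exact_mod_cast hn
  have h1 := abs_density_le (n := n) hB
  have h2 := regSq_rpow_le (ε := ε) (q := (n : ℝ) - 1) (by linarith) hxy
  rw [norm_mul, Real.norm_of_nonneg (Real.rpow_nonneg (regSq_nonneg ε x y) _)]
  refine (mul_le_mul h1 h2 (Real.rpow_nonneg (regSq_nonneg ε x y) _)
    ((norm_nonneg _).trans h1)).trans (le_of_eq ?_)
  ring

lemma integrable_regPot (hn : 2 ≤ n) (ε : ℝ) {b : EuclideanSpace ℝ (Fin (n + 1)) → ℝ} {B : ℝ}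
    (hb : AEStronglyMeasurable b) (hB : ∀ y, y ≠ 0 → |b y| ≤ B)
    {x : EuclideanSpace ℝ (Fin (n + 1))} (hx : x ≠ 0) :
    Integrable fun y =>
      (‖y‖ ^ (-(((n : ℝ) + 3) / 2)) * b y) * regSq ε x y ^ (-((n : ℝ) - 1) / 2) := by
  refine ((integrable_riesz_sub_one hn hx).const_mul B).mono'
    ((aestronglyMeasurable_density hb).mul
      (measurable_regSq_rpow ε _ x).aestronglyMeasurable) ?_
  filter_upwards [ae_ne_euclidean x, ae_ne_euclidean 0] with y hy hy0
  exact norm_regPot_integrand_le hn ε (hB y hy0) hy.symm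

lemma norm_regPotDeriv_integrand_le (hn : 2 ≤ n) (ε : ℝ)
    {b : EuclideanSpace ℝ (Fin (n + 1)) → ℝ}
    {B : ℝ} {x y : EuclideanSpace ℝ (Fin (n + 1))} (hB : |b y| ≤ B) (hxy : x ≠ y) :
    ‖(‖y‖ ^ (-(((n : ℝ) + 3) / 2)) * b y) • regKerDeriv ε x y‖ ≤
      B * ((n : ℝ) - 1) * (‖x - y‖ ^ (-(n : ℝ)) * ‖y‖ ^ (-(((n : ℝ) + 3) / 2))) := by
  have h1 := abs_density_le (n := n) hB
  have h2 := norm_regKerDeriv_le (by omega) ε hxy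
  rw [norm_smul]
  refine (mul_le_mul h1 h2 (norm_nonneg _) ((norm_nonneg _).trans h1)).trans (le_of_eq ?_)
  ring

lemma integrable_regPotDeriv (hn : 2 ≤ n) (ε : ℝ) {b : EuclideanSpace ℝ (Fin (n + 1)) → ℝ}
    {B : ℝ} (hb : AEStronglyMeasurable b) (hB : ∀ y, y ≠ 0 → |b y| ≤ B)
    {x : EuclideanSpace ℝ (Fin (n + 1))} (hx : x ≠ 0) :
    Integrable fun y => (‖y‖ ^ (-(((n : ℝ) + 3) / 2)) * b y) • regKerDeriv ε x y := by
  refine ((integrable_riesz_self hn hx).const_mul (B * ((n : ℝ) - 1))).mono'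
    ((aestronglyMeasurable_density hb).smul
      (measurable_regKerDeriv ε x).aestronglyMeasurable) ?_
  filter_upwards [ae_ne_euclidean x, ae_ne_euclidean 0] with y hy hy0
  exact norm_regPotDeriv_integrand_le hn ε (hB y hy0) hy.symm

lemma norm_regPotDeriv_integrand_le_of_near (hn : 2 ≤ n) {ε : ℝ} (hε : ε ≠ 0)
    {b : EuclideanSpace ℝ (Fin (n + 1)) → ℝ}
    {B : ℝ} {x₀ x y : EuclideanSpace ℝ (Fin (n + 1))} (hB : |b y| ≤ B)
    (hx : ‖x - x₀‖ ≤ ‖x₀‖ / 2) (hy : x₀ ≠ y) :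
    ‖(‖y‖ ^ (-(((n : ℝ) + 3) / 2)) * b y) • regKerDeriv ε x y‖ ≤
      B * (((n : ℝ) - 1) * (8 + 2 / ε ^ 2) ^ ((n : ℝ) / 2)) *
        (‖x₀ - y‖ ^ (-(n : ℝ)) * ‖y‖ ^ (-(((n : ℝ) + 3) / 2))) := by
  have h1 := abs_density_le (n := n) hB
  have h2 := norm_regKerDeriv_le_of_near (by omega) hε hx hy
  rw [norm_smul]
  refine (mul_le_mul h1 h2 (norm_nonneg _) ((norm_nonneg _).trans h1)).trans (le_of_eq ?_)
  ring

lemma ne_zero_of_mem_ball_half {x₀ x : EuclideanSpace ℝ (Fin (n + 1))}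
    (hx : x ∈ ball x₀ (‖x₀‖ / 2)) : x ≠ 0 := by
  rintro rfl
  rw [mem_ball, dist_zero_left] at hx
  linarith [norm_nonneg x₀]

lemma hasFDerivAt_regPot (hn : 2 ≤ n) {ε : ℝ} (hε : ε ≠ 0)
    {b : EuclideanSpace ℝ (Fin (n + 1)) → ℝ} {B : ℝ} (hb : AEStronglyMeasurable b)
    (hB : ∀ y, y ≠ 0 → |b y| ≤ B) {x : EuclideanSpace ℝ (Fin (n + 1))} (hx : x ≠ 0) :
    HasFDerivAt (regPot ε b) (regPotDeriv ε b x) x := by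
  have hx0 : 0 < ‖x‖ := norm_pos_iff.2 hx
  refine hasFDerivAt_integral_of_dominated_of_fderiv_le
    (F' := fun x y => (‖y‖ ^ (-(((n : ℝ) + 3) / 2)) * b y) • regKerDeriv ε x y)
    (s := ball x (‖x‖ / 2)) (ball_mem_nhds x (by positivity)) ?_
    (integrable_regPot hn ε hb hB hx) (integrable_regPotDeriv hn ε hb hB hx).1 ?_
    ((integrable_riesz_self hn hx).const_mul
      (B * (((n : ℝ) - 1) * (8 + 2 / ε ^ 2) ^ ((n : ℝ) / 2)))) ?_
  · exact Eventually.of_forall fun z => (aestronglyMeasurable_density hb).mul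
      (measurable_regSq_rpow ε _ z).aestronglyMeasurable
  · filter_upwards [ae_ne_euclidean x, ae_ne_euclidean 0] with y hy hy0 z hz
    exact norm_regPotDeriv_integrand_le_of_near hn hε (hB y hy0)
      (by rw [← dist_eq_norm]; exact (mem_ball.1 hz).le) hy.symm
  · refine ae_of_all _ fun y z hz => ?_
    exact (hasFDerivAt_regSq_rpow hε (ne_zero_of_mem_ball_half hz) y).const_mul _

lemma continuousAt_regPotDeriv (hn : 2 ≤ n) {ε : ℝ} (hε : ε ≠ 0)
    {b : EuclideanSpace ℝ (Fin (n + 1)) → ℝ} {B : ℝ} (hb : AEStronglyMeasurable b)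
    (hB : ∀ y, y ≠ 0 → |b y| ≤ B) {x : EuclideanSpace ℝ (Fin (n + 1))} (hx : x ≠ 0) :
    ContinuousAt (regPotDeriv ε b) x := by
  have hx0 : 0 < ‖x‖ := norm_pos_iff.2 hx
  refine continuousAt_of_dominated ?_ ?_ ((integrable_riesz_self hn hx).const_mul
      (B * (((n : ℝ) - 1) * (8 + 2 / ε ^ 2) ^ ((n : ℝ) / 2)))) ?_
  · exact Eventually.of_forall fun z => (aestronglyMeasurable_density hb).smul
      (measurable_regKerDeriv ε z).aestronglyMeasurable
  · filter_upwards [ball_mem_nhds x (half_pos hx0)] with z hz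
    filter_upwards [ae_ne_euclidean x, ae_ne_euclidean 0] with y hy hy0
    exact norm_regPotDeriv_integrand_le_of_near hn hε (hB y hy0)
      (by rw [← dist_eq_norm]; exact (mem_ball.1 hz).le) hy.symm
  · exact ae_of_all _ fun y => (continuous_regKerDeriv_left hε hx y).fun_const_smul _

/-- The error kernel in the approximation of the derivative of the potential. -/
noncomputable def regErr (ε : ℝ) (x y : EuclideanSpace ℝ (Fin (n + 1))) : ℝ :=
  ‖y‖ ^ (-(((n : ℝ) + 3) / 2)) *
    (|regSq ε x y ^ (-((n : ℝ) + 1) / 2) - regSq 0 x y ^ (-((n : ℝ) + 1) / 2)| * ‖x - y‖)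

lemma regErr_nonneg (ε : ℝ) (x y : EuclideanSpace ℝ (Fin (n + 1))) : 0 ≤ regErr ε x y := by
  unfold regErr; positivity

lemma regErr_le (ε : ℝ) {x y : EuclideanSpace ℝ (Fin (n + 1))} (hxy : x ≠ y) :
    regErr ε x y ≤ ‖x - y‖ ^ (-(n : ℝ)) * ‖y‖ ^ (-(((n : ℝ) + 3) / 2)) := by
  have h : 0 < ‖x - y‖ := norm_pos_iff.2 (sub_ne_zero.2 hxy)
  have h1 := regSq_rpow_le (ε := ε) (q := (n : ℝ) + 1) (by positivity) hxy
  have h2 : ‖x - y‖ ^ (-(n : ℝ)) = ‖x - y‖ ^ (-((n : ℝ) + 1)) * ‖x - y‖ := by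
    rw [← Real.rpow_add_one h.ne']; ring_nf
  have h3 : 0 ≤ regSq ε x y ^ (-((n : ℝ) + 1) / 2) := Real.rpow_nonneg (regSq_nonneg ε x y) _
  rw [regErr, regSq_zero_rpow, h2, mul_comm]
  gcongr
  rw [abs_le]; constructor <;> linarith

lemma measurable_regErr (ε : ℝ) (x : EuclideanSpace ℝ (Fin (n + 1))) :
    Measurable (regErr ε x) := by
  have h : Measurable fun y => |regSq ε x y ^ (-((n : ℝ) + 1) / 2) -
      regSq 0 x y ^ (-((n : ℝ) + 1) / 2)| := by
    simpa only [Real.norm_eq_abs, Pi.sub_apply] using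
      ((measurable_regSq_rpow ε _ x).sub (measurable_regSq_rpow 0 _ x)).norm
  exact (measurable_norm.pow_const _).mul (h.mul (measurable_const.sub measurable_id).norm)

lemma integrable_regErr (hn : 2 ≤ n) (ε : ℝ) {x : EuclideanSpace ℝ (Fin (n + 1))} (hx : x ≠ 0) :
    Integrable (regErr ε x) := by
  refine (integrable_riesz_self hn hx).mono' (measurable_regErr ε x).aestronglyMeasurable ?_
  filter_upwards [ae_ne_euclidean x] with y hy
  rw [Real.norm_of_nonneg (regErr_nonneg _ _ _)]
  exact regErr_le ε hy.symm

lemma tendsto_integral_regErr (hn : 2 ≤ n) {x : EuclideanSpace ℝ (Fin (n + 1))} (hx : x ≠ 0) :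
    Tendsto (fun ε => ∫ y, regErr ε x y) (𝓝[≠] 0) (𝓝 0) := by
  have h := tendsto_integral_filter_of_dominated_convergence (μ := volume)
    (F := fun ε y => regErr ε x y) (f := fun _ => (0 : ℝ)) (l := 𝓝[≠] (0 : ℝ))
    (fun y => ‖x - y‖ ^ (-(n : ℝ)) * ‖y‖ ^ (-(((n : ℝ) + 3) / 2)))
    (Eventually.of_forall fun ε => (measurable_regErr ε x).aestronglyMeasurable)
    (Eventually.of_forall fun ε => ?_) (integrable_riesz_self hn hx) ?_
  · simpa using h
  · filter_upwards [ae_ne_euclidean x] with y hy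
    rw [Real.norm_of_nonneg (regErr_nonneg _ _ _)]
    exact regErr_le ε hy.symm
  · filter_upwards [ae_ne_euclidean x] with y hy
    have h : 0 < ‖x - y‖ := norm_pos_iff.2 (sub_ne_zero.2 hy.symm)
    have hc : ContinuousAt (fun ε => regErr ε x y) 0 := by
      unfold regErr
      have h1 : ContinuousAt (fun ε => regSq ε x y) 0 := by unfold regSq; fun_prop
      have h2 : regSq 0 x y ≠ 0 := ((by positivity : 0 < ‖x - y‖ ^ 2).trans_le
        (norm_sq_le_regSq 0 x y)).ne'
      exact continuousAt_const.mul
        (((h1.rpow_const (Or.inl h2)).sub continuousAt_const).abs.mul continuousAt_const)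
    have h3 : regErr 0 x y = 0 := by simp [regErr]
    have := hc.tendsto
    rw [h3] at this
    exact this.mono_left nhdsWithin_le_nhds

lemma regErr_map (ε : ℝ)
    (R : EuclideanSpace ℝ (Fin (n + 1)) ≃ₗᵢ[ℝ] EuclideanSpace ℝ (Fin (n + 1)))
    (x y : EuclideanSpace ℝ (Fin (n + 1))) : regErr ε (R x) (R y) = regErr ε x y := by
  simp only [regErr, regSq, ← map_sub, LinearIsometryEquiv.norm_map]

lemma regSq_smul (ε t : ℝ) (x y : EuclideanSpace ℝ (Fin (n + 1))) :
    regSq ε (t • x) (t • y) = t ^ 2 * regSq ε x y := by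
  simp only [regSq, ← smul_sub, norm_smul, mul_pow, Real.norm_eq_abs, sq_abs]
  ring

lemma regSq_smul_rpow (ε : ℝ) {t : ℝ} (ht : 0 < t) (q : ℝ)
    (x y : EuclideanSpace ℝ (Fin (n + 1))) :
    regSq ε (t • x) (t • y) ^ (q / 2) = t ^ q * regSq ε x y ^ (q / 2) := by
  rw [regSq_smul, Real.mul_rpow (by positivity) (regSq_nonneg _ _ _), sq_rpow_half ht.le]

lemma regErr_smul (ε : ℝ) {t : ℝ} (ht : 0 < t) (x y : EuclideanSpace ℝ (Fin (n + 1))) :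
    regErr ε (t • x) (t • y) = t ^ (-(n : ℝ) - ((n : ℝ) + 3) / 2) * regErr ε x y := by
  unfold regErr
  rw [regSq_smul_rpow ε ht, regSq_smul_rpow 0 ht, ← mul_sub, abs_mul, abs_of_pos (by positivity),
    ← smul_sub, norm_smul, norm_smul, Real.norm_of_nonneg ht.le,
    Real.mul_rpow ht.le (norm_nonneg _),
    show -(n : ℝ) - ((n : ℝ) + 3) / 2 = -(((n : ℝ) + 3) / 2) + -((n : ℝ) + 1) + 1 by ring,
    Real.rpow_add_one ht.ne', Real.rpow_add ht]
  ring

end RieszPotential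

section RieszPotential

open Filter Topology

variable {n : ℕ}

lemma norm_regPotDeriv_sub_le (hn : 2 ≤ n) (ε : ℝ)
    {b : EuclideanSpace ℝ (Fin (n + 1)) → ℝ} {B : ℝ} (hb : AEStronglyMeasurable b)
    (hB : ∀ y, y ≠ 0 → |b y| ≤ B) {x : EuclideanSpace ℝ (Fin (n + 1))} (hx : x ≠ 0) :
    ‖regPotDeriv ε b x - regPotDeriv 0 b x‖ ≤ B * ((n : ℝ) - 1) * ∫ y, regErr ε x y := by
  have hn' : (2 : ℝ) ≤ n := by exact_mod_cast hn
  unfold regPotDeriv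
  rw [← integral_sub (integrable_regPotDeriv hn ε hb hB hx) (integrable_regPotDeriv hn 0 hb hB hx),
    ← integral_const_mul]
  refine norm_integral_le_of_norm_le ((integrable_regErr hn ε hx).const_mul _) ?_
  filter_upwards [ae_ne_euclidean 0] with y hy0
  rw [(smul_sub (‖y‖ ^ (-(((n : ℝ) + 3) / 2)) * b y) (regKerDeriv ε x y)
    (regKerDeriv 0 x y)).symm, norm_smul]
  have h1 := abs_density_le (n := n) (hB y hy0)
  have h2 : ‖regKerDeriv ε x y - regKerDeriv 0 x y‖ = ((n : ℝ) - 1) *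
      (|regSq ε x y ^ (-((n : ℝ) + 1) / 2) - regSq 0 x y ^ (-((n : ℝ) + 1) / 2)| * ‖x - y‖) := by
    rw [regKerDeriv, regKerDeriv,
      (sub_smul (-((n : ℝ) - 1) * regSq ε x y ^ (-((n : ℝ) + 1) / 2))
        (-((n : ℝ) - 1) * regSq 0 x y ^ (-((n : ℝ) + 1) / 2)) (innerSL ℝ (x - y))).symm, ← mul_sub, norm_smul, innerSL_apply_norm, norm_mul,
      Real.norm_eq_abs, abs_neg, abs_of_nonneg (by linarith), Real.norm_eq_abs, mul_assoc]
  rw [h2]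
  refine (mul_le_mul_of_nonneg_right h1 ?_).trans (le_of_eq ?_)
  · have : (0 : ℝ) ≤ (n : ℝ) - 1 := by linarith
    positivity
  · unfold regErr; ring

lemma integral_regErr_eq (ε : ℝ) {e x : EuclideanSpace ℝ (Fin (n + 1))} (he : ‖e‖ = 1)
    (hx : x ≠ 0) :
    ∫ y, regErr ε x y = ‖x‖ ^ (-(((n : ℝ) + 1) / 2)) * ∫ y, regErr ε e y := by
  rw [integral_kernel_eq_rpow_mul (regErr_map ε) (fun t ht x y => regErr_smul ε ht x y) he hx]
  congr 2
  ring

lemma tendstoLocallyUniformlyOn_regPotDeriv (hn : 2 ≤ n)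
    {b : EuclideanSpace ℝ (Fin (n + 1)) → ℝ} {B : ℝ} (hb : AEStronglyMeasurable b)
    (hB : ∀ y, y ≠ 0 → |b y| ≤ B) :
    TendstoLocallyUniformlyOn (fun ε => regPotDeriv ε b) (regPotDeriv 0 b) (𝓝[≠] 0)
      {(0 : EuclideanSpace ℝ (Fin (n + 1)))}ᶜ := by
  have hn' : (2 : ℝ) ≤ n := by exact_mod_cast hn
  set e : EuclideanSpace ℝ (Fin (n + 1)) := EuclideanSpace.single 0 1
  have he : ‖e‖ = 1 := by simp [e]
  have he0 : e ≠ 0 := fun h => by simp [h] at he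
  have hB0 : 0 ≤ B := (abs_nonneg _).trans (hB e he0)
  rw [Metric.tendstoLocallyUniformlyOn_iff]
  intro δ hδ x hx
  have hx0 : 0 < ‖x‖ := norm_pos_iff.2 hx
  refine ⟨ball x (‖x‖ / 2), mem_nhdsWithin_of_mem_nhds (ball_mem_nhds x (by positivity)), ?_⟩
  set C : ℝ := B * ((n : ℝ) - 1) * (‖x‖ / 2) ^ (-(((n : ℝ) + 1) / 2))
  have h1 : Tendsto (fun ε => C * ∫ y, regErr ε e y) (𝓝[≠] 0) (𝓝 0) := by
    simpa using (tendsto_integral_regErr hn he0).const_mul C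
  filter_upwards [h1.eventually (gt_mem_nhds hδ)] with ε hε z hz
  have hz0 : z ≠ 0 := ne_zero_of_mem_ball_half hz
  rw [dist_comm, dist_eq_norm]
  refine lt_of_le_of_lt ?_ hε
  refine (norm_regPotDeriv_sub_le hn ε hb hB hz0).trans ?_
  rw [integral_regErr_eq ε he hz0, ← mul_assoc]
  have hzx : ‖x‖ / 2 ≤ ‖z‖ := by
    have h2 : ‖x - z‖ < ‖x‖ / 2 := by
      rw [norm_sub_rev, ← dist_eq_norm]; exact hz
    have := norm_sub_norm_le x z
    linarith
  have h3 := Real.rpow_le_rpow_of_nonpos (z := -(((n : ℝ) + 1) / 2)) (by positivity) hzx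
    (by linarith)
  have h4 : 0 ≤ ∫ y, regErr ε e y := integral_nonneg fun y => regErr_nonneg _ _ _
  have h5 : 0 ≤ B * ((n : ℝ) - 1) := mul_nonneg hB0 (by linarith)
  exact mul_le_mul_of_nonneg_right (mul_le_mul_of_nonneg_left h3 h5) h4

lemma tendsto_regPot (hn : 2 ≤ n) {b : EuclideanSpace ℝ (Fin (n + 1)) → ℝ} {B : ℝ}
    (hb : AEStronglyMeasurable b) (hB : ∀ y, y ≠ 0 → |b y| ≤ B)
    {x : EuclideanSpace ℝ (Fin (n + 1))} (hx : x ≠ 0) :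
    Tendsto (fun ε => regPot ε b x) (𝓝[≠] 0) (𝓝 (regPot 0 b x)) := by
  refine tendsto_integral_filter_of_dominated_convergence
    (fun y => B * (‖x - y‖ ^ (-((n : ℝ) - 1)) * ‖y‖ ^ (-(((n : ℝ) + 3) / 2))))
    (Eventually.of_forall fun ε => (integrable_regPot hn ε hb hB hx).1)
    (Eventually.of_forall fun ε => ?_) ((integrable_riesz_sub_one hn hx).const_mul B) ?_
  · filter_upwards [ae_ne_euclidean x, ae_ne_euclidean 0] with y hy hy0
    exact norm_regPot_integrand_le hn ε (hB y hy0) hy.symm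
  · filter_upwards [ae_ne_euclidean x] with y hy
    have h : 0 < ‖x - y‖ := norm_pos_iff.2 (sub_ne_zero.2 hy.symm)
    have h1 : ContinuousAt (fun ε => regSq ε x y) 0 := by unfold regSq; fun_prop
    have h2 : regSq 0 x y ≠ 0 := ((by positivity : 0 < ‖x - y‖ ^ 2).trans_le
      (norm_sq_le_regSq 0 x y)).ne'
    have h3 := (h1.rpow_const (p := -((n : ℝ) - 1) / 2) (Or.inl h2)).tendsto.const_mul
      (‖y‖ ^ (-(((n : ℝ) + 3) / 2)) * b y)
    exact h3.mono_left nhdsWithin_le_nhds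

/-- The Newtonian potential of the density `‖y‖ ^ (-(n + 3) / 2) * b y`. -/
noncomputable def newtonPot (b : EuclideanSpace ℝ (Fin (n + 1)) → ℝ)
    (x : EuclideanSpace ℝ (Fin (n + 1))) : ℝ :=
  ∫ y, ‖x - y‖ ^ (-((n : ℝ) - 1)) * (‖y‖ ^ (-(((n : ℝ) + 3) / 2)) * b y)

lemma newtonPot_eq_regPot (b : EuclideanSpace ℝ (Fin (n + 1)) → ℝ) :
    newtonPot b = regPot 0 b := by
  funext x
  unfold newtonPot regPot
  simp only [regSq_zero_rpow, mul_comm]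

lemma integrable_newtonPot (hn : 2 ≤ n) {b : EuclideanSpace ℝ (Fin (n + 1)) → ℝ} {B : ℝ}
    (hb : AEStronglyMeasurable b) (hB : ∀ y, y ≠ 0 → |b y| ≤ B)
    {x : EuclideanSpace ℝ (Fin (n + 1))} (hx : x ≠ 0) :
    Integrable fun y =>
      ‖x - y‖ ^ (-((n : ℝ) - 1)) * (‖y‖ ^ (-(((n : ℝ) + 3) / 2)) * b y) := by
  refine (integrable_regPot hn 0 hb hB hx).congr (ae_of_all _ fun y => ?_)
  simp only [regSq_zero_rpow, mul_comm]

lemma hasFDerivAt_newtonPot (hn : 2 ≤ n) {b : EuclideanSpace ℝ (Fin (n + 1)) → ℝ} {B : ℝ}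
    (hb : AEStronglyMeasurable b) (hB : ∀ y, y ≠ 0 → |b y| ≤ B)
    {x : EuclideanSpace ℝ (Fin (n + 1))} (hx : x ≠ 0) :
    HasFDerivAt (newtonPot b) (regPotDeriv 0 b x) x := by
  rw [newtonPot_eq_regPot]
  have h := tendstoLocallyUniformlyOn_regPotDeriv hn hb hB
  set u : ℕ → ℝ := fun k => 1 / ((k : ℝ) + 1)
  have hu : Tendsto u atTop (𝓝[≠] 0) := tendsto_nhdsWithin_iff.2
    ⟨tendsto_one_div_add_atTop_nhds_zero_nat, Eventually.of_forall fun k => by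
      simp only [u, mem_compl_iff, mem_singleton_iff]; positivity⟩
  refine hasFDerivAt_of_tendstoLocallyUniformlyOn (l := atTop) (f := fun k => regPot (u k) b)
    (f' := fun k => regPotDeriv (u k) b) (s := {0}ᶜ) isOpen_compl_singleton ?_
    (fun k z hz => hasFDerivAt_regPot hn (by simp only [u]; positivity) hb hB hz)
    (fun z hz => (tendsto_regPot hn hb hB hz).comp hu) hx
  intro v hv z hz
  obtain ⟨t, ht, h3⟩ := h v hv z hz
  exact ⟨t, ht, hu.eventually h3⟩

lemma continuousOn_regPotDeriv_zero (hn : 2 ≤ n) {b : EuclideanSpace ℝ (Fin (n + 1)) → ℝ} {B : ℝ}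
    (hb : AEStronglyMeasurable b) (hB : ∀ y, y ≠ 0 → |b y| ≤ B) :
    ContinuousOn (regPotDeriv 0 b) {(0 : EuclideanSpace ℝ (Fin (n + 1)))}ᶜ := by
  refine (tendstoLocallyUniformlyOn_regPotDeriv hn hb hB).continuousOn (Eventually.frequently ?_)
  filter_upwards [self_mem_nhdsWithin] with ε hε z hz
  exact (continuousAt_regPotDeriv hn hε hb hB hz).continuousWithinAt

lemma contDiffOn_one_newtonPot (hn : 2 ≤ n) {b : EuclideanSpace ℝ (Fin (n + 1)) → ℝ} {B : ℝ}
    (hb : AEStronglyMeasurable b) (hB : ∀ y, y ≠ 0 → |b y| ≤ B) :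
    ContDiffOn ℝ 1 (newtonPot b) {(0 : EuclideanSpace ℝ (Fin (n + 1)))}ᶜ := by
  intro x hx
  exact (contDiffAt_one_iff.2 ⟨_, _, isOpen_compl_singleton.mem_nhds hx,
    continuousOn_regPotDeriv_zero hn hb hB,
    fun z hz => hasFDerivAt_newtonPot hn hb hB hz⟩).contDiffWithinAt

lemma newtonPot_smul {b : EuclideanSpace ℝ (Fin (n + 1)) → ℝ}
    (hhom : ∀ t : ℝ, 0 < t → ∀ y, y ≠ 0 → b (t • y) = b y) {t : ℝ} (ht : 0 < t)
    (x : EuclideanSpace ℝ (Fin (n + 1))) :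
    newtonPot b (t • x) = t ^ (-(((n : ℝ) - 1) / 2)) * newtonPot b x := by
  have h1 := Measure.integral_comp_smul (volume : Measure (EuclideanSpace ℝ (Fin (n + 1))))
    (fun y => ‖t • x - y‖ ^ (-((n : ℝ) - 1)) * (‖y‖ ^ (-(((n : ℝ) + 3) / 2)) * b y)) t
  have h2 : ∫ y, ‖t • x - t • y‖ ^ (-((n : ℝ) - 1)) *
      (‖t • y‖ ^ (-(((n : ℝ) + 3) / 2)) * b (t • y)) =
      t ^ (-((n : ℝ) - 1) + -(((n : ℝ) + 3) / 2)) * newtonPot b x := by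
    rw [newtonPot, ← integral_const_mul]
    refine integral_congr_ae ?_
    filter_upwards [ae_ne_euclidean 0] with y hy
    rw [hhom t ht y hy, ← smul_sub, norm_smul, norm_smul, Real.norm_of_nonneg ht.le,
      Real.mul_rpow ht.le (norm_nonneg _), Real.mul_rpow ht.le (norm_nonneg _), Real.rpow_add ht]
    ring
  rw [h2, finrank_euclideanSpace, Fintype.card_fin, smul_eq_mul, abs_of_pos (by positivity)] at h1
  have h3 : t ^ (n + 1) = t ^ ((n : ℝ) + 1) := by
    rw [← Real.rpow_natCast]; push_cast; rfl
  have h4 : newtonPot b (t • x) =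
      t ^ (n + 1) * (t ^ (-((n : ℝ) - 1) + -(((n : ℝ) + 3) / 2)) * newtonPot b x) := by
    rw [h1, mul_inv_cancel_left₀ (by positivity)]
    rfl
  rw [h4, h3, ← mul_assoc, ← Real.rpow_add ht]
  ring_nf

lemma newtonPot_map (R : EuclideanSpace ℝ (Fin (n + 1)) ≃ₗᵢ[ℝ] EuclideanSpace ℝ (Fin (n + 1)))
    (b : EuclideanSpace ℝ (Fin (n + 1)) → ℝ) (x : EuclideanSpace ℝ (Fin (n + 1))) :
    newtonPot b (R x) = newtonPot (fun y => b (R y)) x := by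
  unfold newtonPot
  rw [← R.measurePreserving.integral_comp R.toHomeomorph.measurableEmbedding
    (fun y => ‖R x - y‖ ^ (-((n : ℝ) - 1)) * (‖y‖ ^ (-(((n : ℝ) + 3) / 2)) * b y))]
  simp only [← map_sub, LinearIsometryEquiv.norm_map]

/-- The tangential derivative of a potential is controlled by the sup norm of the density. -/
lemma exists_norm_fderiv_newtonPot_le (hn : 2 ≤ n) :
    ∃ C : ℝ, 0 ≤ C ∧ ∀ (b : EuclideanSpace ℝ (Fin (n + 1)) → ℝ) (B : ℝ),
      AEStronglyMeasurable b → (∀ y, y ≠ 0 → |b y| ≤ B) →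
      ∀ x, ‖x‖ = 1 → ‖fderiv ℝ (newtonPot b) x‖ ≤ C * B := by
  have hn' : (2 : ℝ) ≤ n := by exact_mod_cast hn
  set e : EuclideanSpace ℝ (Fin (n + 1)) := EuclideanSpace.single 0 1
  have he : ‖e‖ = 1 := by simp [e]
  refine ⟨((n : ℝ) - 1) * ∫ y, ‖e - y‖ ^ (-(n : ℝ)) * ‖y‖ ^ (-(((n : ℝ) + 3) / 2)),
    mul_nonneg (by linarith) (integral_nonneg fun y => by positivity), fun b B hb hB x hx => ?_⟩
  have hx0 : x ≠ 0 := fun h => by simp [h] at hx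
  rw [(hasFDerivAt_newtonPot hn hb hB hx0).fderiv, integral_riesz_eq (he.trans hx.symm),
    mul_right_comm, mul_comm _ B, ← integral_const_mul, regPotDeriv]
  refine norm_integral_le_of_norm_le ((integrable_riesz_self hn hx0).const_mul _) ?_
  filter_upwards [ae_ne_euclidean x, ae_ne_euclidean 0] with y hy hy0
  exact norm_regPotDeriv_integrand_le hn 0 (hB y hy0) hy.symm

end RieszPotential

section RotationDerivative

open Filter Topology

variable {n : ℕ}

/-- The infinitesimal rotation in the plane spanned by `p` and `q`. -/
noncomputable def planeGen (p q y : EuclideanSpace ℝ (Fin (n + 1))) :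
    EuclideanSpace ℝ (Fin (n + 1)) :=
  ⟪p, y⟫ • q - ⟪q, y⟫ • p

/-- The rotation by the angle `t` in the plane spanned by the orthonormal vectors `p` and `q`. -/
noncomputable def planeRot (p q : EuclideanSpace ℝ (Fin (n + 1))) (t : ℝ)
    (y : EuclideanSpace ℝ (Fin (n + 1))) : EuclideanSpace ℝ (Fin (n + 1)) :=
  y + ((Real.cos t - 1) * ⟪p, y⟫ - Real.sin t * ⟪q, y⟫) • p +
    (Real.sin t * ⟪p, y⟫ + (Real.cos t - 1) * ⟪q, y⟫) • q

variable {p q : EuclideanSpace ℝ (Fin (n + 1))}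

lemma norm_planeRot (hp : ‖p‖ = 1) (hq : ‖q‖ = 1) (hpq : ⟪p, q⟫ = 0) (t : ℝ)
    (y : EuclideanSpace ℝ (Fin (n + 1))) : ‖planeRot p q t y‖ = ‖y‖ := by
  have hpp : ⟪p, p⟫ = 1 := by rw [real_inner_self_eq_norm_sq, hp, one_pow]
  have hqq : ⟪q, q⟫ = 1 := by rw [real_inner_self_eq_norm_sq, hq, one_pow]
  have hqp : ⟪q, p⟫ = 0 := by rw [real_inner_comm, hpq]
  have hyp : ⟪y, p⟫ = ⟪p, y⟫ := real_inner_comm _ _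
  have hyq : ⟪y, q⟫ = ⟪q, y⟫ := real_inner_comm _ _
  have h : ‖planeRot p q t y‖ ^ 2 = ‖y‖ ^ 2 := by
    rw [← real_inner_self_eq_norm_sq, ← real_inner_self_eq_norm_sq y, planeRot]
    simp only [inner_add_left, inner_add_right, real_inner_smul_left, real_inner_smul_right,
      hpp, hqq, hqp, hpq, hyp, hyq]
    linear_combination (⟪p, y⟫ ^ 2 + ⟪q, y⟫ ^ 2) * Real.sin_sq_add_cos_sq t
  exact (sq_eq_sq₀ (norm_nonneg _) (norm_nonneg _)).1 h

lemma exists_linearIsometryEquiv_eq_planeRot (hp : ‖p‖ = 1) (hq : ‖q‖ = 1) (hpq : ⟪p, q⟫ = 0)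
    (t : ℝ) : ∃ R : EuclideanSpace ℝ (Fin (n + 1)) ≃ₗᵢ[ℝ] EuclideanSpace ℝ (Fin (n + 1)),
      ∀ y, R y = planeRot p q t y := by
  let L : EuclideanSpace ℝ (Fin (n + 1)) →ₗ[ℝ] EuclideanSpace ℝ (Fin (n + 1)) :=
    { toFun := planeRot p q t
      map_add' := fun x y => by
        simp only [planeRot, inner_add_right]; module
      map_smul' := fun c y => by
        simp only [planeRot, real_inner_smul_right, RingHom.id_apply]; module }
  exact ⟨LinearIsometry.toLinearIsometryEquiv ⟨L, norm_planeRot hp hq hpq t⟩ rfl, fun y => rfl⟩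

lemma hasDerivAt_planeRot (hp : ‖p‖ = 1) (hq : ‖q‖ = 1) (hpq : ⟪p, q⟫ = 0)
    (y : EuclideanSpace ℝ (Fin (n + 1))) (t : ℝ) :
    HasDerivAt (fun t => planeRot p q t y) (planeGen p q (planeRot p q t y)) t := by
  have hpp : ⟪p, p⟫ = 1 := by rw [real_inner_self_eq_norm_sq, hp, one_pow]
  have hqq : ⟪q, q⟫ = 1 := by rw [real_inner_self_eq_norm_sq, hq, one_pow]
  have hqp : ⟪q, p⟫ = 0 := by rw [real_inner_comm, hpq]
  have h1 : HasDerivAt (fun t => (Real.cos t - 1) * ⟪p, y⟫ - Real.sin t * ⟪q, y⟫)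
      (-Real.sin t * ⟪p, y⟫ - Real.cos t * ⟪q, y⟫) t :=
    (((Real.hasDerivAt_cos t).sub_const 1).mul_const _).fun_sub
      ((Real.hasDerivAt_sin t).mul_const _)
  have h2 : HasDerivAt (fun t => Real.sin t * ⟪p, y⟫ + (Real.cos t - 1) * ⟪q, y⟫)
      (Real.cos t * ⟪p, y⟫ + -Real.sin t * ⟪q, y⟫) t :=
    ((Real.hasDerivAt_sin t).mul_const _).fun_add
      (((Real.hasDerivAt_cos t).sub_const 1).mul_const _)
  have h3 := ((h1.smul_const p).const_add y).fun_add (h2.smul_const q)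
  refine h3.congr_deriv ?_
  simp only [planeGen, planeRot, inner_add_right, real_inner_smul_right, hpp, hqq, hqp, hpq]
  module

lemma planeRot_zero (y : EuclideanSpace ℝ (Fin (n + 1))) : planeRot p q 0 y = y := by
  simp [planeRot]

lemma planeGen_smul (c : ℝ) (y : EuclideanSpace ℝ (Fin (n + 1))) :
    planeGen p q (c • y) = c • planeGen p q y := by
  simp only [planeGen, real_inner_smul_right]
  module

lemma continuous_planeGen : Continuous (planeGen p q) := by
  unfold planeGen
  fun_prop

/-- The derivative of `b` along the infinitesimal rotation. -/
noncomputable def rotDeriv (p q : EuclideanSpace ℝ (Fin (n + 1)))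
    (b : EuclideanSpace ℝ (Fin (n + 1)) → ℝ) (y : EuclideanSpace ℝ (Fin (n + 1))) : ℝ :=
  fderiv ℝ b y (planeGen p q y)

lemma continuousOn_rotDeriv {b : EuclideanSpace ℝ (Fin (n + 1)) → ℝ}
    (hb : ContDiffOn ℝ 1 b {(0 : EuclideanSpace ℝ (Fin (n + 1)))}ᶜ) :
    ContinuousOn (rotDeriv p q b) {(0 : EuclideanSpace ℝ (Fin (n + 1)))}ᶜ :=
  (hb.continuousOn_fderiv_of_isOpen isOpen_compl_singleton le_rfl).clm_apply
    continuous_planeGen.continuousOn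

lemma rotDeriv_smul {b : EuclideanSpace ℝ (Fin (n + 1)) → ℝ}
    (hb : ContDiffOn ℝ 1 b {(0 : EuclideanSpace ℝ (Fin (n + 1)))}ᶜ)
    (hhom : ∀ t : ℝ, 0 < t → ∀ y, y ≠ 0 → b (t • y) = b y) {t : ℝ} (ht : 0 < t)
    {y : EuclideanSpace ℝ (Fin (n + 1))} (hy : y ≠ 0) :
    rotDeriv p q b (t • y) = rotDeriv p q b y := by
  have hd : DifferentiableAt ℝ b y :=
    (hb.contDiffAt (isOpen_compl_singleton.mem_nhds hy)).differentiableAt one_ne_zero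
  have h := fderiv_smul_of_homogeneous (c := 1) (t := t) (w := b)
    (fun y hy => by rw [hhom t ht y hy, one_mul]) hy hd (planeGen p q y)
  rw [rotDeriv, planeGen_smul, map_smul, smul_eq_mul, h, one_mul, rotDeriv]

lemma aestronglyMeasurable_of_continuousOn_compl {b : EuclideanSpace ℝ (Fin (n + 1)) → ℝ}
    (hb : ContinuousOn b {(0 : EuclideanSpace ℝ (Fin (n + 1)))}ᶜ) : AEStronglyMeasurable b := by
  have h := hb.aestronglyMeasurable (μ := volume) isOpen_compl_singleton.measurableSet
  have h2 : (volume : Measure (EuclideanSpace ℝ (Fin (n + 1)))).restrict {0}ᶜ = volume :=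
    Measure.restrict_eq_self_of_ae_mem (ae_ne_euclidean 0)
  rwa [h2] at h

lemma exists_abs_le_of_degree_zero {b : EuclideanSpace ℝ (Fin (n + 1)) → ℝ}
    (hb : ContinuousOn b {(0 : EuclideanSpace ℝ (Fin (n + 1)))}ᶜ)
    (hhom : ∀ t : ℝ, 0 < t → ∀ y, y ≠ 0 → b (t • y) = b y) :
    ∃ B, ∀ y, y ≠ 0 → |b y| ≤ B := by
  have hsub : sphere (0 : EuclideanSpace ℝ (Fin (n + 1))) 1 ⊆ {0}ᶜ := fun y hy =>
    ne_zero_of_mem_unit_sphere ⟨y, hy⟩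
  obtain ⟨B, hB⟩ := (isCompact_sphere (0 : EuclideanSpace ℝ (Fin (n + 1))) 1).exists_bound_of_continuousOn
    (hb.mono hsub)
  refine ⟨B, fun y hy => ?_⟩
  have hy0 : 0 < ‖y‖ := norm_pos_iff.2 hy
  rw [← hhom ‖y‖⁻¹ (by positivity) y hy]
  exact hB _ (by simp [norm_smul, hy0.ne'])

lemma fderiv_newtonPot_planeGen (hn : 2 ≤ n) (hp : ‖p‖ = 1) (hq : ‖q‖ = 1) (hpq : ⟪p, q⟫ = 0)
    {b : EuclideanSpace ℝ (Fin (n + 1)) → ℝ}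
    (hb : ContDiffOn ℝ 1 b {(0 : EuclideanSpace ℝ (Fin (n + 1)))}ᶜ)
    (hhom : ∀ t : ℝ, 0 < t → ∀ y, y ≠ 0 → b (t • y) = b y)
    {x : EuclideanSpace ℝ (Fin (n + 1))} (hx : x ≠ 0) :
    fderiv ℝ (newtonPot b) x (planeGen p q x) = newtonPot (rotDeriv p q b) x := by
  have hbm := aestronglyMeasurable_of_continuousOn_compl hb.continuousOn
  obtain ⟨B, hB⟩ := exists_abs_le_of_degree_zero hb.continuousOn hhom
  have hrc := continuousOn_rotDeriv (p := p) (q := q) hb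
  have hrm := aestronglyMeasurable_of_continuousOn_compl hrc
  obtain ⟨B', hB'⟩ := exists_abs_le_of_degree_zero hrc
    (fun t ht y hy => rotDeriv_smul hb hhom ht hy)
  have hne : ∀ t y, y ≠ 0 → planeRot p q t y ≠ 0 := fun t y hy h => by
    have := norm_planeRot hp hq hpq t y
    rw [h, norm_zero] at this
    exact hy (norm_eq_zero.1 this.symm)
  have h1 : HasDerivAt (fun t => newtonPot b (planeRot p q t x))
      (fderiv ℝ (newtonPot b) x (planeGen p q x)) 0 := by
    have h2 := hasDerivAt_planeRot hp hq hpq x 0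
    rw [planeRot_zero] at h2
    have h3 : HasFDerivAt (newtonPot b) (fderiv ℝ (newtonPot b) x) (planeRot p q 0 x) := by
      rw [planeRot_zero]
      exact (hasFDerivAt_newtonPot hn hbm hB hx).differentiableAt.hasFDerivAt
    exact h3.comp_hasDerivAt 0 h2
  have h4 : ∀ t, AEStronglyMeasurable (fun y => b (planeRot p q t y)) := fun t => by
    obtain ⟨R, hR⟩ := exists_linearIsometryEquiv_eq_planeRot hp hq hpq t
    simp only [← hR]
    exact hbm.comp_measurePreserving R.measurePreserving
  have h5 : HasDerivAt (fun t => newtonPot (fun y => b (planeRot p q t y)) x)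
      (newtonPot (rotDeriv p q b) x) 0 := by
    have hr0 : newtonPot (rotDeriv p q b) x =
        newtonPot (fun y => rotDeriv p q b (planeRot p q 0 y)) x := by
      simp only [planeRot_zero]
    rw [hr0]
    refine (hasDerivAt_integral_of_dominated_loc_of_deriv_le (s := univ)
      (bound := fun y => B' * (‖x - y‖ ^ (-((n : ℝ) - 1)) * ‖y‖ ^ (-(((n : ℝ) + 3) / 2))))
      (F := fun t y => ‖x - y‖ ^ (-((n : ℝ) - 1)) *
        (‖y‖ ^ (-(((n : ℝ) + 3) / 2)) * b (planeRot p q t y)))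
      (F' := fun t y => ‖x - y‖ ^ (-((n : ℝ) - 1)) *
        (‖y‖ ^ (-(((n : ℝ) + 3) / 2)) * rotDeriv p q b (planeRot p q t y)))
      univ_mem ?_ ?_ ?_ ?_ ((integrable_riesz_sub_one hn hx).const_mul B') ?_).2
    · exact Eventually.of_forall fun t =>
        (integrable_newtonPot hn (h4 t) (fun y hy => hB _ (hne t y hy)) hx).1
    · exact integrable_newtonPot hn (h4 0) (fun y hy => hB _ (hne 0 y hy)) hx
    · simp only [planeRot_zero]
      exact (integrable_newtonPot hn hrm hB' hx).1
    · filter_upwards [ae_ne_euclidean 0] with y hy t _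
      have h6 := abs_density_le (n := n) (b := fun y => rotDeriv p q b (planeRot p q t y))
        (hB' _ (hne t y hy))
      rw [norm_mul, Real.norm_of_nonneg (by positivity)]
      refine (mul_le_mul_of_nonneg_left h6 (by positivity)).trans (le_of_eq ?_)
      ring
    · filter_upwards [ae_ne_euclidean 0] with y hy t _
      have hd : DifferentiableAt ℝ b (planeRot p q t y) :=
        (hb.contDiffAt (isOpen_compl_singleton.mem_nhds (hne t y hy))).differentiableAt
          one_ne_zero
      exact ((hd.hasFDerivAt.comp_hasDerivAt t (hasDerivAt_planeRot hp hq hpq y t)).const_mul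
        _).const_mul _
  have h7 : (fun t => newtonPot b (planeRot p q t x)) =
      fun t => newtonPot (fun y => b (planeRot p q t y)) x := by
    funext t
    obtain ⟨R, hR⟩ := exists_linearIsometryEquiv_eq_planeRot hp hq hpq t
    simp only [← hR]
    exact newtonPot_map R b x
  rw [h7] at h1
  exact h1.unique h5

lemma contDiffOn_two_newtonPot (hn : 2 ≤ n) {b : EuclideanSpace ℝ (Fin (n + 1)) → ℝ}
    (hb : ContDiffOn ℝ 1 b {(0 : EuclideanSpace ℝ (Fin (n + 1)))}ᶜ)
    (hhom : ∀ t : ℝ, 0 < t → ∀ y, y ≠ 0 → b (t • y) = b y) :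
    ContDiffOn ℝ 2 (newtonPot b) {(0 : EuclideanSpace ℝ (Fin (n + 1)))}ᶜ := by
  have hbm := aestronglyMeasurable_of_continuousOn_compl hb.continuousOn
  obtain ⟨B, hB⟩ := exists_abs_le_of_degree_zero hb.continuousOn hhom
  have hd : ∀ x, x ≠ 0 → DifferentiableAt ℝ (newtonPot b) x := fun x hx =>
    (hasFDerivAt_newtonPot hn hbm hB hx).differentiableAt
  have h1 := contDiffOn_one_newtonPot hn hbm hB
  set e : Fin (n + 1) → EuclideanSpace ℝ (Fin (n + 1)) := fun i => EuclideanSpace.single i 1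
  have he : ∀ i, ‖e i‖ = 1 := fun i => by simp [e]
  have hee : ∀ i j, i ≠ j → ⟪e i, e j⟫ = 0 := fun i j hij => by
    simp [e, EuclideanSpace.inner_single_left, hij]
  have hA : ∀ i j x, x ≠ 0 → fderiv ℝ (newtonPot b) x (planeGen (e i) (e j) x) =
      if i = j then 0 else newtonPot (rotDeriv (e i) (e j) b) x := by
    intro i j x hx
    split_ifs with hij
    · rw [hij, planeGen, sub_self, map_zero]
    · exact fderiv_newtonPot_planeGen hn (he i) (he j) (hee i j hij) hb hhom hx
  have hR : ∀ i j, ContDiffOn ℝ 1 (fun x => if i = j then 0 else newtonPot (rotDeriv (e i) (e j) b) x)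
      {(0 : EuclideanSpace ℝ (Fin (n + 1)))}ᶜ := by
    intro i j
    split_ifs with hij
    · exact contDiffOn_const
    · have hrc := continuousOn_rotDeriv (p := e i) (q := e j) hb
      obtain ⟨B', hB'⟩ := exists_abs_le_of_degree_zero hrc
        (fun t ht y hy => rotDeriv_smul hb hhom ht hy)
      exact contDiffOn_one_newtonPot hn (aestronglyMeasurable_of_continuousOn_compl hrc) hB'
  have hvec : ∀ x v : EuclideanSpace ℝ (Fin (n + 1)),
      ∑ i, ∑ j, (x i * v j) • planeGen (e i) (e j) x = ‖x‖ ^ 2 • v - ⟪x, v⟫ • x := by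
    intro x v
    ext k
    simp only [planeGen, e, EuclideanSpace.inner_single_left, map_one, one_mul]
    simp only [WithLp.ofLp_sum, Finset.sum_apply, PiLp.smul_apply, PiLp.sub_apply, smul_eq_mul,
      PiLp.single_apply, mul_sub, Finset.sum_sub_distrib, mul_ite, mul_one, mul_zero,
      Finset.sum_ite_eq, Finset.mem_univ, if_true]
    rw [EuclideanSpace.real_norm_sq_eq, Finset.sum_mul, PiLp.inner_apply, Finset.sum_mul]
    congr 1
    · exact Finset.sum_congr rfl fun i _ => by ring
    · rw [Finset.sum_comm]
      simp only [Finset.sum_ite_eq, Finset.mem_univ, if_true]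
      exact Finset.sum_congr rfl fun i _ => by
        rw [RCLike.inner_apply, conj_trivial]; ring
  have hform : ∀ v x, x ≠ 0 → fderiv ℝ (newtonPot b) x v = (‖x‖ ^ 2)⁻¹ *
      (∑ i, ∑ j, (x i * v j) * (if i = j then 0 else newtonPot (rotDeriv (e i) (e j) b) x) +
        ⟪x, v⟫ * (-(((n : ℝ) - 1) / 2) * newtonPot b x)) := by
    intro v x hx
    have hx0 : 0 < ‖x‖ := norm_pos_iff.2 hx
    have h2 := congrArg (fderiv ℝ (newtonPot b) x) (hvec x v)
    simp only [map_sum, map_smul, map_sub, smul_eq_mul, hA _ _ x hx,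
      fderiv_self_of_homogeneous (fun t ht y _ => newtonPot_smul hhom ht y) hx (hd x hx)] at h2
    rw [h2]
    field_simp
    ring
  rw [show (2 : WithTop ℕ∞) = 1 + 1 from one_add_one_eq_two.symm,
    contDiffOn_succ_iff_fderiv_of_isOpen isOpen_compl_singleton]
  refine ⟨fun x hx => (hd x hx).differentiableWithinAt, by simp, ?_⟩
  rw [contDiffOn_clm_apply]
  intro v
  have hn1 : ContDiffOn ℝ 1 (fun x : EuclideanSpace ℝ (Fin (n + 1)) => (‖x‖ ^ 2)⁻¹) {0}ᶜ :=
    (contDiff_norm_sq ℝ).contDiffOn.inv fun x hx => by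
      have : 0 < ‖x‖ := norm_pos_iff.2 hx
      positivity
  have hin : ContDiff ℝ 1 (fun x : EuclideanSpace ℝ (Fin (n + 1)) => ⟪x, v⟫) :=
    contDiff_id.inner ℝ contDiff_const
  have hco : ∀ i, ContDiff ℝ 1 (fun x : EuclideanSpace ℝ (Fin (n + 1)) => x i) := by
    intro i; fun_prop
  refine (hn1.mul ((ContDiffOn.sum fun i _ => ContDiffOn.sum fun j _ =>
    (((hco i).contDiffOn.mul contDiffOn_const).mul (hR i j))).add
      (hin.contDiffOn.mul (contDiffOn_const.mul h1)))).congr fun x hx => hform v x hx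

end RotationDerivative

section PoissonEquation

open Filter Topology

variable {n : ℕ}

lemma integral_mul_newtonPot (hn : 2 ≤ n) {b : EuclideanSpace ℝ (Fin (n + 1)) → ℝ} {B : ℝ}
    (hb : AEStronglyMeasurable b) (hB : ∀ y, y ≠ 0 → |b y| ≤ B)
    {ψ : EuclideanSpace ℝ (Fin (n + 1)) → ℝ} (hψ : Continuous ψ) (hψc : HasCompactSupport ψ)
    (hψ0 : tsupport ψ ⊆ {0}ᶜ) :
    ∫ x, ψ x * newtonPot b x =
      ∫ y, (‖y‖ ^ (-(((n : ℝ) + 3) / 2)) * b y) * ∫ x, ‖y - x‖ ^ (-((n : ℝ) - 1)) * ψ x := by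
  set ρ : EuclideanSpace ℝ (Fin (n + 1)) → ℝ := fun y => ‖y‖ ^ (-(((n : ℝ) + 3) / 2)) * b y
  have hρ : AEStronglyMeasurable ρ := aestronglyMeasurable_density hb
  have hF : Integrable (fun p : EuclideanSpace ℝ (Fin (n + 1)) × EuclideanSpace ℝ (Fin (n + 1)) =>
      ψ p.1 * (‖p.1 - p.2‖ ^ (-((n : ℝ) - 1)) * ρ p.2)) (volume.prod volume) := by
    have hm : AEStronglyMeasurable
        (fun p : EuclideanSpace ℝ (Fin (n + 1)) × EuclideanSpace ℝ (Fin (n + 1)) =>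
          ψ p.1 * (‖p.1 - p.2‖ ^ (-((n : ℝ) - 1)) * ρ p.2)) (volume.prod volume) := by
      refine ((hψ.comp continuous_fst).aestronglyMeasurable).mul (.mul ?_ hρ.comp_snd)
      exact (((continuous_fst.sub continuous_snd).norm.measurable).pow_const _).aestronglyMeasurable
    rw [integrable_prod_iff hm]
    constructor
    · filter_upwards [ae_ne_euclidean 0] with x hx
      exact (integrable_newtonPot hn hb hB hx).const_mul _
    · have h1 : ∀ x, ∫ y, ‖ψ x * (‖x - y‖ ^ (-((n : ℝ) - 1)) * ρ y)‖ =
          |ψ x| * newtonPot (fun y => |b y|) x := by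
        intro x
        rw [newtonPot, ← integral_const_mul]
        refine integral_congr_ae (ae_of_all _ fun y => ?_)
        simp only [norm_mul, Real.norm_eq_abs, ρ,
          abs_of_nonneg (Real.rpow_nonneg (norm_nonneg _) _)]
      simp only [h1]
      have h2 : tsupport (fun x => |ψ x| * newtonPot (fun y => |b y|) x) ⊆ tsupport ψ := by
        refine closure_mono fun x hx hx' => hx ?_
        simp [hx']
      have h3 : Continuous fun x => |ψ x| * newtonPot (fun y => |b y|) x := by
        refine ContinuousOn.continuous_of_tsupport_subset ?_ isOpen_compl_singleton
          (h2.trans hψ0)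
        exact hψ.abs.continuousOn.mul (contDiffOn_one_newtonPot hn hb.norm
          (fun y hy => by simpa using hB y hy)).continuousOn
      exact h3.integrable_of_hasCompactSupport (hψc.mono' (subset_closure.trans h2))
  have h1 : ∀ x, ψ x * newtonPot b x = ∫ y, ψ x * (‖x - y‖ ^ (-((n : ℝ) - 1)) * ρ y) := fun x => by
    rw [newtonPot, integral_const_mul]
  simp only [h1]
  rw [integral_integral_swap hF]
  refine integral_congr_ae (ae_of_all _ fun y => ?_)
  simp only []
  rw [← integral_const_mul]
  refine integral_congr_ae (ae_of_all _ fun x => ?_)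
  simp only []
  rw [norm_sub_rev x y]
  ring

lemma newtonPot_zero (hn : 2 ≤ n) {b : EuclideanSpace ℝ (Fin (n + 1)) → ℝ}
    (hhom : ∀ t : ℝ, 0 < t → ∀ y, y ≠ 0 → b (t • y) = b y) : newtonPot b 0 = 0 := by
  have hn' : (2 : ℝ) ≤ n := by exact_mod_cast hn
  have h1 := newtonPot_smul hhom two_pos 0
  rw [smul_zero] at h1
  have h2 : (2 : ℝ) ^ (-(((n : ℝ) - 1) / 2)) < 1 :=
    Real.rpow_lt_one_of_one_lt_of_neg one_lt_two (by linarith)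
  have h3 : newtonPot b 0 * (1 - (2 : ℝ) ^ (-(((n : ℝ) - 1) / 2))) = 0 := by linarith
  rcases mul_eq_zero.1 h3 with h | h
  · exact h
  · linarith

lemma integral_mul_laplacian {A φ : EuclideanSpace ℝ (Fin (n + 1)) → ℝ} (hA : ContDiff ℝ 2 A)
    (hφ : ContDiff ℝ 2 φ) (hφc : HasCompactSupport φ) :
    ∫ y, A y * laplacian φ y = ∫ y, laplacian A y * φ y := by
  have hi : ∀ v, Integrable fun y => A y * fderiv ℝ (fun z => fderiv ℝ φ z v) y v := fun v =>
    (hA.continuous.mul (continuous_fderiv_fderiv_apply hφ v v)).integrable_of_hasCompactSupport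
      (((hφc.fderiv_apply ℝ v).fderiv_apply ℝ v).mul_left)
  have hi' : ∀ v, Integrable fun y => fderiv ℝ (fun z => fderiv ℝ A z v) y v * φ y := fun v =>
    ((continuous_fderiv_fderiv_apply hA v v).mul hφ.continuous).integrable_of_hasCompactSupport
      hφc.mul_left
  unfold laplacian
  simp only [Finset.mul_sum, Finset.sum_mul]
  rw [integral_finsetSum _ fun i _ => hi _, integral_finsetSum _ fun i _ => hi' _]
  exact Finset.sum_congr rfl fun i _ => integral_mul_fderiv_fderiv hA hφ hφc _

lemma laplacian_newtonPot (hn : 2 ≤ n) {b : EuclideanSpace ℝ (Fin (n + 1)) → ℝ}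
    (hb : ContDiffOn ℝ 1 b {(0 : EuclideanSpace ℝ (Fin (n + 1)))}ᶜ)
    (hhom : ∀ t : ℝ, 0 < t → ∀ y, y ≠ 0 → b (t • y) = b y)
    {x : EuclideanSpace ℝ (Fin (n + 1))} (hx : x ≠ 0) :
    laplacian (newtonPot b) x =
      -((n : ℝ) - 1) * omega_n n * (‖x‖ ^ (-(((n : ℝ) + 3) / 2)) * b x) := by
  have hbm := aestronglyMeasurable_of_continuousOn_compl hb.continuousOn
  obtain ⟨B, hB⟩ := exists_abs_le_of_degree_zero hb.continuousOn hhom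
  obtain ⟨_, _, hτ⟩ := exists_logCutoff
  obtain ⟨τ, hτC, hτ0, -, hτ1, -⟩ := hτ (|Real.log ‖x‖| + 1) (by linarith [abs_nonneg (Real.log ‖x‖)])
  set R := |Real.log ‖x‖| + 1 with hR
  set A : EuclideanSpace ℝ (Fin (n + 1)) → ℝ := fun z => τ (Real.log ‖z‖) * newtonPot b z with hAdef
  have hA : ContDiff ℝ 2 A :=
    contDiff_radial_mul hτC hτ0 (contDiffOn_two_newtonPot hn hb hhom) (newtonPot_zero hn hhom)
  have hlogc : ContinuousOn (fun z : EuclideanSpace ℝ (Fin (n + 1)) => |Real.log ‖z‖|) {0}ᶜ :=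
    (continuous_norm.continuousOn.log fun z hz => norm_ne_zero_iff.2 hz).abs
  set V : Set (EuclideanSpace ℝ (Fin (n + 1))) := {0}ᶜ ∩ (fun z => |Real.log ‖z‖|) ⁻¹' Iio R
  have hV : IsOpen V := hlogc.isOpen_inter_preimage isOpen_compl_singleton isOpen_Iio
  have hAU : ∀ z ∈ V, A z = newtonPot b z := fun z hz => by
    rw [hAdef]; simp only []; rw [(hτ1 _ hz.2).1, one_mul]
  have hρc : ContinuousOn (fun z : EuclideanSpace ℝ (Fin (n + 1)) =>
      -((n : ℝ) - 1) * omega_n n * (‖z‖ ^ (-(((n : ℝ) + 3) / 2)) * b z)) V :=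
    ((continuousOn_const.mul ((continuous_norm.continuousOn.rpow_const fun z hz =>
      Or.inl (norm_ne_zero_iff.2 hz)).mul hb.continuousOn))).mono inter_subset_left
  have hdc : ContinuousOn (fun z => laplacian A z -
      -((n : ℝ) - 1) * omega_n n * (‖z‖ ^ (-(((n : ℝ) + 3) / 2)) * b z)) V :=
    (continuous_laplacian hA).continuousOn.sub hρc
  have hae : ∀ᵐ z, z ∈ V → laplacian A z -
      -((n : ℝ) - 1) * omega_n n * (‖z‖ ^ (-(((n : ℝ) + 3) / 2)) * b z) = 0 := by
    refine hV.ae_eq_zero_of_integral_contDiff_smul_eq_zero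
      (hdc.locallyIntegrableOn hV.measurableSet) fun φ hφ hφc hφV => ?_
    have hφ2 : ContDiff ℝ 2 φ := hφ.of_le (WithTop.coe_le_coe.2 le_top)
    have hls : tsupport (laplacian φ) ⊆ tsupport φ := tsupport_laplacian_subset
    have h1 := integral_mul_laplacian hA hφ2 hφc
    have h2 := integral_mul_newtonPot hn hbm hB (continuous_laplacian hφ2)
      (hasCompactSupport_laplacian hφc) (hls.trans (hφV.trans inter_subset_left))
    have h3 : ∫ z, A z * laplacian φ z = ∫ z, laplacian φ z * newtonPot b z := by
      refine integral_congr_ae (ae_of_all _ fun z => ?_)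
      by_cases hz : z ∈ tsupport φ
      · simp only [hAU z (hφV hz), mul_comm]
      · simp only [image_eq_zero_of_notMem_tsupport fun h => hz (hls h), mul_zero, zero_mul]
    simp only [integral_riesz_mul_laplacian (by omega) hφ2 hφc] at h2
    have h4 : ∀ z, φ z • (laplacian A z -
        -((n : ℝ) - 1) * omega_n n * (‖z‖ ^ (-(((n : ℝ) + 3) / 2)) * b z)) =
        laplacian A z * φ z - ‖z‖ ^ (-(((n : ℝ) + 3) / 2)) * b z *
          (-((n : ℝ) - 1) * omega_n n * φ z) := fun z => by
      rw [smul_eq_mul]; ring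
    simp only [h4]
    have hc : Continuous fun z => ‖z‖ ^ (-(((n : ℝ) + 3) / 2)) * b z *
          (-((n : ℝ) - 1) * omega_n n * φ z) := by
      refine ContinuousOn.continuous_of_tsupport_subset (s := V) ?_ hV
        (Subset.trans (closure_mono ?_) hφV)
      · refine (hρc.mul hφ.continuous.continuousOn).congr fun z _ => ?_
        simp only [Pi.mul_apply]
        ring
      · intro z hz hz'
        simp [hz'] at hz
    rw [integral_sub, ← h1, h3, h2, sub_self]
    · exact ((continuous_laplacian hA).mul hφ.continuous).integrable_of_hasCompactSupport
        hφc.mul_left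
    · exact hc.integrable_of_hasCompactSupport (hφc.mul_left.mul_left)
  have hxV : x ∈ V := ⟨hx, by simp [hR]⟩
  have h5 := Measure.eqOn_open_of_ae_eq (μ := volume) (g := fun _ => (0 : ℝ))
    ((ae_restrict_iff' hV.measurableSet).2 hae) hV hdc continuousOn_const hxV
  rw [laplacian_congr (v := A)]
  · simpa [sub_eq_zero] using h5
  · filter_upwards [hV.mem_nhds hxV] with z hz using (hAU z hz).symm

end PoissonEquation

section SpherePotential

open Filter Topology InnerProductGeometry

variable {n : ℕ} {b : EuclideanSpace ℝ (Fin (n + 1)) → ℝ}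

/-- The degree-zero potential inverting `(n - 1)² / 4 - Δ` on the unit sphere. -/
noncomputable def spherePot (b : EuclideanSpace ℝ (Fin (n + 1)) → ℝ)
    (x : EuclideanSpace ℝ (Fin (n + 1))) : ℝ :=
  (((n : ℝ) - 1) * omega_n n)⁻¹ * (‖x‖ ^ (((n : ℝ) - 1) / 2) * newtonPot b x)

lemma spherePot_scale_pos (hn : 2 ≤ n) : 0 < ((n : ℝ) - 1) * omega_n n := by
  have hn' : (2 : ℝ) ≤ n := by exact_mod_cast hn
  exact mul_pos (by linarith) (omega_n_pos n)

lemma spherePot_smul (hhom : ∀ t : ℝ, 0 < t → ∀ y, y ≠ 0 → b (t • y) = b y) {t : ℝ} (ht : 0 < t)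
    (x : EuclideanSpace ℝ (Fin (n + 1))) : spherePot b (t • x) = spherePot b x := by
  unfold spherePot
  rw [newtonPot_smul hhom ht, norm_smul, Real.norm_eq_abs, abs_of_pos ht,
    Real.mul_rpow ht.le (norm_nonneg x), Real.rpow_neg ht.le]
  have : t ^ (((n : ℝ) - 1) / 2) ≠ 0 := (Real.rpow_pos_of_pos ht _).ne'
  field_simp

lemma contDiffOn_norm_rpow {k : WithTop ℕ∞} (p : ℝ) :
    ContDiffOn ℝ k (fun x : EuclideanSpace ℝ (Fin (n + 1)) => ‖x‖ ^ p) {0}ᶜ :=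
  fun _ hx => ((contDiffAt_norm ℝ hx).rpow_const_of_ne (norm_ne_zero_iff.2 hx)).contDiffWithinAt

lemma contDiffOn_one_spherePot (hn : 2 ≤ n) {B : ℝ} (hb : AEStronglyMeasurable b)
    (hB : ∀ y, y ≠ 0 → |b y| ≤ B) :
    ContDiffOn ℝ 1 (spherePot b) {(0 : EuclideanSpace ℝ (Fin (n + 1)))}ᶜ :=
  contDiffOn_const.mul ((contDiffOn_norm_rpow _).mul (contDiffOn_one_newtonPot hn hb hB))

lemma contDiffOn_two_spherePot (hn : 2 ≤ n)
    (hb : ContDiffOn ℝ 1 b {(0 : EuclideanSpace ℝ (Fin (n + 1)))}ᶜ)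
    (hhom : ∀ t : ℝ, 0 < t → ∀ y, y ≠ 0 → b (t • y) = b y) :
    ContDiffOn ℝ 2 (spherePot b) {(0 : EuclideanSpace ℝ (Fin (n + 1)))}ᶜ :=
  contDiffOn_const.mul ((contDiffOn_norm_rpow _).mul (contDiffOn_two_newtonPot hn hb hhom))

lemma laplacian_const_mul {m : ℕ} (c : ℝ) {u : EuclideanSpace ℝ (Fin m) → ℝ}
    {x : EuclideanSpace ℝ (Fin m)} (hu : ContDiffAt ℝ 2 u x) :
    laplacian (fun y => c * u y) x = c * laplacian u x := by
  unfold laplacian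
  rw [Finset.mul_sum]
  refine Finset.sum_congr rfl fun i _ => ?_
  have h1 : (fun y => fderiv ℝ (fun y => c * u y) y (EuclideanSpace.single i 1)) =ᶠ[𝓝 x]
      fun y => c * fderiv ℝ u y (EuclideanSpace.single i 1) := by
    filter_upwards [hu.eventually (by simp)] with y hy
    rw [fderiv_const_mul (hy.differentiableAt two_ne_zero)]
    rfl
  have h2 : DifferentiableAt ℝ (fun y => fderiv ℝ u y (EuclideanSpace.single i (1 : ℝ))) x :=
    (differentiableAt_fderiv_of_contDiffAt_two hu).clm_apply (differentiableAt_const _)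
  rw [h1.fderiv_eq, fderiv_const_mul h2]
  rfl

lemma laplacian_spherePot (hn : 2 ≤ n)
    (hb : ContDiffOn ℝ 1 b {(0 : EuclideanSpace ℝ (Fin (n + 1)))}ᶜ)
    (hhom : ∀ t : ℝ, 0 < t → ∀ y, y ≠ 0 → b (t • y) = b y)
    {x : EuclideanSpace ℝ (Fin (n + 1))} (hx : ‖x‖ = 1) :
    laplacian (spherePot b) x = ((n : ℝ) - 1) ^ 2 / 4 * spherePot b x - b x := by
  have hx0 : x ≠ 0 := norm_ne_zero_iff.1 (by rw [hx]; exact one_ne_zero)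
  have hκ := spherePot_scale_pos hn
  set κ := ((n : ℝ) - 1) * omega_n n with hκd
  set k : ℝ := -(((n : ℝ) - 1) / 2) with hk
  have hS := contDiffOn_two_spherePot hn hb hhom
  have hs : ∀ y ≠ 0, fderiv ℝ (spherePot b) y y = 0 * spherePot b y := fun y hy =>
    fderiv_self_of_homogeneous (fun t ht y _ => by rw [spherePot_smul hhom ht, Real.rpow_zero,
      one_mul]) hy ((hS.contDiffAt (isOpen_compl_singleton.mem_nhds hy)).differentiableAt
        two_ne_zero)
  have hτ : ContDiff ℝ 2 fun t : ℝ => Real.exp (k * t) := by fun_prop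
  have hd : ∀ a : ℝ, deriv (fun t : ℝ => a * Real.exp (k * t)) = fun t => a * k * Real.exp (k * t) := by
    intro a
    funext t
    have h : HasDerivAt (fun t : ℝ => Real.exp (k * t)) (Real.exp (k * t) * k) t := by
      simpa using ((hasDerivAt_id t).const_mul k).exp
    rw [(h.const_mul a).deriv]; ring
  have hd1 : deriv (fun t : ℝ => Real.exp (k * t)) = fun t => k * Real.exp (k * t) := by
    simpa using hd 1
  have h1 := laplacian_radial_mul hτ hS hs hx0
  rw [hd1, hd, hx, Real.log_one] at h1
  simp only [mul_zero, Real.exp_zero, mul_one, one_mul, one_pow, inv_one] at h1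
  have h2 : (fun z => Real.exp (k * Real.log ‖z‖) * spherePot b z) =ᶠ[𝓝 x]
      fun z => κ⁻¹ * newtonPot b z := by
    filter_upwards [isOpen_compl_singleton.mem_nhds hx0] with z hz
    have hz' : 0 < ‖z‖ := norm_pos_iff.2 hz
    rw [mul_comm k, ← Real.rpow_def_of_pos hz', hk, Real.rpow_neg hz'.le, spherePot]
    have := (Real.rpow_pos_of_pos hz' (((n : ℝ) - 1) / 2)).ne'
    field_simp
    rw [← hκd]
    field_simp
  rw [laplacian_congr h2, laplacian_const_mul _ ((contDiffOn_two_newtonPot hn hb hhom).contDiffAt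
    (isOpen_compl_singleton.mem_nhds hx0)), laplacian_newtonPot hn hb hhom hx0, hx,
    Real.one_rpow, one_mul, neg_mul, neg_mul, ← hκd, neg_mul, mul_neg, inv_mul_cancel_left₀ hκ.ne'] at h1
  rw [hk] at h1
  linarith

lemma spherePot_one (hn : 2 ≤ n) {x : EuclideanSpace ℝ (Fin (n + 1))} (hx : x ≠ 0) :
    spherePot (fun _ => 1) x = (((n : ℝ) - 1) ^ 2 / 4)⁻¹ := by
  have hn' : (2 : ℝ) ≤ n := by exact_mod_cast hn
  set e : EuclideanSpace ℝ (Fin (n + 1)) := EuclideanSpace.single 0 1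
  have he : ‖e‖ = 1 := by simp [e]
  have h0 : ∀ z : EuclideanSpace ℝ (Fin (n + 1)), z ≠ 0 →
      spherePot (fun _ => 1) z = spherePot (fun _ => 1) e := by
    intro z hz
    have hz' : 0 < ‖z‖ := norm_pos_iff.2 hz
    obtain ⟨R, hR⟩ := exists_linearIsometryEquiv_apply_eq (x := e) (y := ‖z‖⁻¹ • z)
      (by rw [he, norm_smul, norm_inv, norm_norm, inv_mul_cancel₀ hz'.ne'])
    rw [← spherePot_smul (fun _ _ _ _ => rfl) (inv_pos.2 hz') z, ← hR, spherePot, spherePot,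
      newtonPot_map, R.norm_map]
  have h1 := laplacian_spherePot hn (b := fun _ => 1) contDiffOn_const (fun _ _ _ _ => rfl) he
  have h2 : laplacian (spherePot fun _ => 1) e = 0 := by
    rw [laplacian_congr (v := fun _ => spherePot (fun _ => 1) e)]
    · simp [laplacian]
    · filter_upwards [isOpen_compl_singleton.mem_nhds
        (norm_ne_zero_iff.1 (by rw [he]; exact one_ne_zero))] with z hz using h0 z hz
  rw [h0 x hx]
  rw [h2] at h1
  exact eq_inv_of_mul_eq_one_right (by linarith)

lemma spherePot_add_const_mul (hn : 2 ≤ n) {b' : EuclideanSpace ℝ (Fin (n + 1)) → ℝ} {B B' : ℝ}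
    (hb : AEStronglyMeasurable b) (hB : ∀ y, y ≠ 0 → |b y| ≤ B)
    (hb' : AEStronglyMeasurable b') (hB' : ∀ y, y ≠ 0 → |b' y| ≤ B') (a : ℝ)
    {x : EuclideanSpace ℝ (Fin (n + 1))} (hx : x ≠ 0) :
    spherePot (fun y => b y + a * b' y) x = spherePot b x + a * spherePot b' x := by
  have h := integral_add (integrable_newtonPot hn hb hB hx)
    ((integrable_newtonPot hn hb' hB' hx).const_mul a)
  rw [integral_const_mul] at h
  have h' : newtonPot (fun y => b y + a * b' y) x = newtonPot b x + a * newtonPot b' x := by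
    rw [newtonPot, newtonPot, newtonPot, ← h]
    exact integral_congr_ae (ae_of_all _ fun y => by simp only []; ring)
  rw [spherePot, spherePot, spherePot, h']
  ring

lemma spherePot_const_mul (a : ℝ) (x : EuclideanSpace ℝ (Fin (n + 1))) :
    spherePot (fun y => a * b y) x = a * spherePot b x := by
  have h' : newtonPot (fun y => a * b y) x = a * newtonPot b x := by
    rw [newtonPot, newtonPot, ← integral_const_mul]
    exact integral_congr_ae (ae_of_all _ fun y => by simp only []; ring)
  rw [spherePot, spherePot, h']
  ring

lemma spherePot_mono (hn : 2 ≤ n) {b' : EuclideanSpace ℝ (Fin (n + 1)) → ℝ} {B B' : ℝ}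
    (hb : AEStronglyMeasurable b) (hB : ∀ y, y ≠ 0 → |b y| ≤ B)
    (hb' : AEStronglyMeasurable b') (hB' : ∀ y, y ≠ 0 → |b' y| ≤ B')
    (h : ∀ y, y ≠ 0 → b y ≤ b' y) {x : EuclideanSpace ℝ (Fin (n + 1))} (hx : x ≠ 0) :
    spherePot b x ≤ spherePot b' x := by
  refine mul_le_mul_of_nonneg_left (mul_le_mul_of_nonneg_left ?_
    (Real.rpow_nonneg (norm_nonneg _) _)) (inv_pos.2 (spherePot_scale_pos hn)).le
  refine integral_mono_ae (integrable_newtonPot hn hb hB hx) (integrable_newtonPot hn hb' hB' hx) ?_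
  filter_upwards [ae_ne_euclidean 0] with y hy
  exact mul_le_mul_of_nonneg_left (mul_le_mul_of_nonneg_left (h y hy)
    (Real.rpow_nonneg (norm_nonneg _) _)) (Real.rpow_nonneg (norm_nonneg _) _)

lemma spherePot_le (hn : 2 ≤ n) {B A : ℝ} (hb : AEStronglyMeasurable b)
    (hB : ∀ y, y ≠ 0 → |b y| ≤ B) (h : ∀ y, y ≠ 0 → b y ≤ A)
    {x : EuclideanSpace ℝ (Fin (n + 1))} (hx : x ≠ 0) :
    spherePot b x ≤ A * (((n : ℝ) - 1) ^ 2 / 4)⁻¹ := by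
  rw [← spherePot_one hn hx, ← spherePot_const_mul]
  exact spherePot_mono hn hb hB aestronglyMeasurable_const (B' := |A|) (by simp)
    (by simpa using h) hx

lemma le_spherePot (hn : 2 ≤ n) {B A : ℝ} (hb : AEStronglyMeasurable b)
    (hB : ∀ y, y ≠ 0 → |b y| ≤ B) (h : ∀ y, y ≠ 0 → A ≤ b y)
    {x : EuclideanSpace ℝ (Fin (n + 1))} (hx : x ≠ 0) :
    A * (((n : ℝ) - 1) ^ 2 / 4)⁻¹ ≤ spherePot b x := by
  rw [← spherePot_one hn hx, ← spherePot_const_mul]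
  exact spherePot_mono hn aestronglyMeasurable_const (B := |A|) (by simp) hb hB
    (by simpa using h) hx

lemma spherePot_pos (hn : 2 ≤ n) (hb : ContinuousOn b {0}ᶜ)
    (hhom : ∀ t : ℝ, 0 < t → ∀ y, y ≠ 0 → b (t • y) = b y) (h : ∀ y, y ≠ 0 → 0 ≤ b y)
    {z : EuclideanSpace ℝ (Fin (n + 1))} (hz : z ≠ 0) (hbz : b z ≠ 0)
    {x : EuclideanSpace ℝ (Fin (n + 1))} (hx : x ≠ 0) : 0 < spherePot b x := by
  have hbm := aestronglyMeasurable_of_continuousOn_compl hb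
  obtain ⟨B, hB⟩ := exists_abs_le_of_degree_zero hb hhom
  refine mul_pos (inv_pos.2 (spherePot_scale_pos hn)) (mul_pos
    (Real.rpow_pos_of_pos (norm_pos_iff.2 hx) _) ?_)
  have h0 : 0 ≤ᵐ[volume] fun y => ‖x - y‖ ^ (-((n : ℝ) - 1)) * (‖y‖ ^ (-(((n : ℝ) + 3) / 2)) * b y) := by
    filter_upwards [ae_ne_euclidean 0] with y hy
    exact mul_nonneg (Real.rpow_nonneg (norm_nonneg _) _) (mul_nonneg
      (Real.rpow_nonneg (norm_nonneg _) _) (h y hy))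
  refine lt_of_le_of_ne (integral_nonneg_of_ae h0) fun h1 => hbz ?_
  have h2 := (integral_eq_zero_iff_of_nonneg_ae h0 (integrable_newtonPot hn hbm hB hx)).1 h1.symm
  have h3 : b =ᵐ[volume.restrict {0}ᶜ] fun _ => 0 := by
    refine ae_restrict_of_ae ?_
    filter_upwards [h2, ae_ne_euclidean 0, ae_ne_euclidean x] with y hy hy0 hyx
    have hy1 := (Real.rpow_pos_of_pos (norm_pos_iff.2 hy0) (-(((n : ℝ) + 3) / 2))).ne'
    have hy2 := (Real.rpow_pos_of_pos (norm_pos_iff.2 (sub_ne_zero.2 (Ne.symm hyx)))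
      (-((n : ℝ) - 1))).ne'
    simpa only [Pi.zero_apply, mul_eq_zero, hy1, hy2, false_or] using hy
  exact Measure.eqOn_open_of_ae_eq h3 isOpen_compl_singleton hb continuousOn_const hz

lemma exists_abs_spherePot_sub_le (hn : 2 ≤ n) :
    ∃ C : ℝ, 0 ≤ C ∧ ∀ (b : EuclideanSpace ℝ (Fin (n + 1)) → ℝ) (B : ℝ),
      AEStronglyMeasurable b → (∀ y, y ≠ 0 → |b y| ≤ B) →
      ∀ x y, ‖x‖ = 1 → ‖y‖ = 1 → |spherePot b y - spherePot b x| ≤ C * B * ‖y - x‖ := by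
  obtain ⟨C, hC0, hC⟩ := exists_norm_fderiv_newtonPot_le (n := n) hn
  have hκ := spherePot_scale_pos hn
  refine ⟨(((n : ℝ) - 1) * omega_n n)⁻¹ * (C * Real.pi), by positivity, ?_⟩
  intro b B hb hB x y hx hy
  have hB0 : 0 ≤ B := (abs_nonneg _).trans (hB x (norm_ne_zero_iff.1 (by rw [hx]; exact one_ne_zero)))
  have h1 := abs_sub_le_mul_angle (by omega) (f := newtonPot b) (G := C * B)
    (fun z hz => (hasFDerivAt_newtonPot hn hb hB hz).differentiableAt)
    (fun z v hz hv _ => by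
      have := (fderiv ℝ (newtonPot b) z).le_opNorm v
      rw [hv, mul_one, Real.norm_eq_abs] at this
      exact this.trans (hC b B hb hB z hz)) hx hy
  have h2 := angle_le_pi_mul_norm_sub hy (y := x) (norm_ne_zero_iff.1 (by rw [hx]; exact one_ne_zero))
  unfold spherePot
  rw [hx, hy, Real.one_rpow, one_mul, one_mul, ← mul_sub, abs_mul, abs_of_pos (inv_pos.2 hκ),
    mul_assoc, mul_assoc]
  refine mul_le_mul_of_nonneg_left (h1.trans ?_) (inv_pos.2 hκ).le
  calc C * B * angle x y ≤ C * B * (Real.pi * ‖x - y‖) := by gcongr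
    _ = C * Real.pi * (B * ‖y - x‖) := by rw [norm_sub_rev]; ring

end SpherePotential

section PerronSubsolutions

open Filter Topology

variable {n : ℕ} {C : ℝ}

/-- Degree-zero homogeneous functions with values in `[0, 1]` which are `C`-Lipschitz on the unit
sphere. -/
def IsLipProfile (C : ℝ) (w : EuclideanSpace ℝ (Fin (n + 1)) → ℝ) : Prop :=
  (∀ t : ℝ, 0 < t → ∀ y, y ≠ 0 → w (t • y) = w y) ∧ (∀ y, y ≠ 0 → 0 ≤ w y ∧ w y ≤ 1) ∧
    ∀ x y, ‖x‖ = 1 → ‖y‖ = 1 → |w y - w x| ≤ C * ‖y - x‖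

lemma apply_inv_norm_smul {w : EuclideanSpace ℝ (Fin (n + 1)) → ℝ}
    (hw : ∀ t : ℝ, 0 < t → ∀ y, y ≠ 0 → w (t • y) = w y) {y : EuclideanSpace ℝ (Fin (n + 1))}
    (hy : y ≠ 0) : w (‖y‖⁻¹ • y) = w y :=
  hw _ (inv_pos.2 (norm_pos_iff.2 hy)) _ hy

lemma norm_inv_norm_smul {y : EuclideanSpace ℝ (Fin (n + 1))} (hy : y ≠ 0) :
    ‖‖y‖⁻¹ • y‖ = 1 := by
  rw [norm_smul, norm_inv, norm_norm, inv_mul_cancel₀ (norm_ne_zero_iff.2 hy)]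

lemma ne_zero_of_norm_eq_one {x : EuclideanSpace ℝ (Fin (n + 1))} (hx : ‖x‖ = 1) : x ≠ 0 :=
  norm_ne_zero_iff.1 (by rw [hx]; exact one_ne_zero)

lemma continuousOn_of_degree_zero {w : EuclideanSpace ℝ (Fin (n + 1)) → ℝ}
    (hw : ∀ t : ℝ, 0 < t → ∀ y, y ≠ 0 → w (t • y) = w y)
    (hc : ContinuousOn w (sphere 0 1)) : ContinuousOn w {0}ᶜ := by
  have h1 : ContinuousOn (fun y : EuclideanSpace ℝ (Fin (n + 1)) => ‖y‖⁻¹ • y) {0}ᶜ :=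
    (continuous_norm.continuousOn.inv₀ fun y hy => norm_ne_zero_iff.2 hy).smul continuousOn_id
  exact (hc.comp h1 fun y hy => mem_sphere_zero_iff_norm.2 (norm_inv_norm_smul hy)).congr
    fun y hy => (apply_inv_norm_smul hw hy).symm

lemma IsLipProfile.continuousOn {w : EuclideanSpace ℝ (Fin (n + 1)) → ℝ} (hw : IsLipProfile C w) :
    ContinuousOn w {0}ᶜ := by
  refine continuousOn_of_degree_zero hw.1 ?_
  refine (LipschitzOnWith.of_dist_le_mul (K := C.toNNReal) fun x hx y hy => ?_).continuousOn
  rw [Real.dist_eq, dist_eq_norm]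
  refine (hw.2.2 y x (mem_sphere_zero_iff_norm.1 hy) (mem_sphere_zero_iff_norm.1 hx)).trans ?_
  gcongr
  exact Real.le_coe_toNNReal C

lemma exists_unit_forall_le {w : EuclideanSpace ℝ (Fin (n + 1)) → ℝ}
    (hw : ∀ t : ℝ, 0 < t → ∀ y, y ≠ 0 → w (t • y) = w y) (hc : ContinuousOn w {0}ᶜ) :
    ∃ x, ‖x‖ = 1 ∧ ∀ y, y ≠ 0 → w y ≤ w x := by
  obtain ⟨x, hx, hmax⟩ := (isCompact_sphere (0 : EuclideanSpace ℝ (Fin (n + 1))) 1).exists_isMaxOn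
    (NormedSpace.sphere_nonempty.2 zero_le_one)
    (hc.mono fun x hx => ne_zero_of_norm_eq_one (mem_sphere_zero_iff_norm.1 hx))
  refine ⟨x, mem_sphere_zero_iff_norm.1 hx, fun y hy => ?_⟩
  rw [← apply_inv_norm_smul hw hy]
  exact hmax (mem_sphere_zero_iff_norm.2 (norm_inv_norm_smul hy))

lemma exists_tendsto_isLipProfile {w : ℕ → EuclideanSpace ℝ (Fin (n + 1)) → ℝ}
    (hw : ∀ k, IsLipProfile C (w k)) :
    ∃ φ : ℕ → ℕ, StrictMono φ ∧ ∃ v, IsLipProfile C v ∧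
      ∀ ε, 0 < ε → ∀ᶠ k in atTop, ∀ y, y ≠ 0 → |w (φ k) y - v y| ≤ ε := by
  let S := sphere (0 : EuclideanSpace ℝ (Fin (n + 1))) 1
  have hS : ∀ s : S, ‖(s : EuclideanSpace ℝ (Fin (n + 1)))‖ = 1 := fun s =>
    mem_sphere_zero_iff_norm.1 s.2
  have hS0 : ∀ s : S, (s : EuclideanSpace ℝ (Fin (n + 1))) ≠ 0 := fun s =>
    ne_zero_of_norm_eq_one (hS s)
  let g : ℕ → BoundedContinuousFunction S ℝ := fun k =>
    BoundedContinuousFunction.mkOfCompact ⟨fun s => w k s,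
      continuousOn_iff_continuous_domRestrict.1 ((hw k).continuousOn.mono fun s hs => hS0 ⟨s, hs⟩)⟩
  have hg : ∀ k s, g k s = w k s := fun _ _ => rfl
  have hcpt : IsCompact (closure (range g)) := by
    refine BoundedContinuousFunction.arzela_ascoli (Icc 0 1) isCompact_Icc _ ?_ ?_
    · rintro _ s ⟨k, rfl⟩
      exact (hw k).2.1 s (hS0 s)
    · refine equicontinuous_of_continuity_modulus (fun t => C * t) ?_ _ ?_
      · have : Tendsto (fun t : ℝ => C * t) (𝓝 0) (𝓝 (C * 0)) := tendsto_const_nhds.mul tendsto_id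
        simpa using this
      · rintro x y ⟨_, k, rfl⟩
        rw [Real.dist_eq, Subtype.dist_eq, dist_eq_norm]
        exact (hw k).2.2 _ _ (hS y) (hS x)
  obtain ⟨G, -, φ, hφ, hlim⟩ := hcpt.tendsto_subseq fun k => subset_closure (mem_range_self k)
  let v : EuclideanSpace ℝ (Fin (n + 1)) → ℝ := fun y =>
    if hy : y = 0 then 0 else G ⟨‖y‖⁻¹ • y, mem_sphere_zero_iff_norm.2 (norm_inv_norm_smul hy)⟩
  have hv : ∀ y (hy : y ≠ 0),
      v y = G ⟨‖y‖⁻¹ • y, mem_sphere_zero_iff_norm.2 (norm_inv_norm_smul hy)⟩ := fun y hy =>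
    dif_neg hy
  have hunif : ∀ ε, 0 < ε → ∀ᶠ k in atTop, ∀ y, y ≠ 0 → |w (φ k) y - v y| ≤ ε := by
    intro ε hε
    filter_upwards [Metric.tendsto_nhds.1 hlim ε hε] with k hk y hy
    rw [hv y hy, ← apply_inv_norm_smul (hw (φ k)).1 hy,
      ← hg _ ⟨‖y‖⁻¹ • y, mem_sphere_zero_iff_norm.2 (norm_inv_norm_smul hy)⟩, ← Real.dist_eq]
    exact (BoundedContinuousFunction.dist_coe_le_dist _).trans hk.le
  have hpt : ∀ y, y ≠ 0 → Tendsto (fun k => w (φ k) y) atTop (𝓝 (v y)) := by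
    intro y hy
    rw [Metric.tendsto_nhds]
    intro ε hε
    filter_upwards [hunif (ε / 2) (half_pos hε)] with k hk
    rw [Real.dist_eq]
    exact (hk y hy).trans_lt (half_lt_self hε)
  refine ⟨φ, hφ, v, ⟨fun t ht y hy => ?_, fun y hy => ⟨?_, ?_⟩, fun x y hx hy => ?_⟩, hunif⟩
  · refine tendsto_nhds_unique (hpt _ (smul_ne_zero ht.ne' hy)) ?_
    simpa only [(hw _).1 t ht y hy] using hpt y hy
  · exact ge_of_tendsto' (hpt y hy) fun k => ((hw _).2.1 y hy).1
  · exact le_of_tendsto' (hpt y hy) fun k => ((hw _).2.1 y hy).2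
  · exact le_of_tendsto' ((hpt y (ne_zero_of_norm_eq_one hy)).sub
      (hpt x (ne_zero_of_norm_eq_one hx))).abs fun k => (hw _).2.2 x y hx hy

/-- Normalized Lipschitz functions `w` with `w ≤ spherePot ((k - lam * F) * w)`. -/
def IsPerronSub (C k : ℝ) (F : EuclideanSpace ℝ (Fin (n + 1)) → ℝ) (lam : ℝ)
    (w : EuclideanSpace ℝ (Fin (n + 1)) → ℝ) : Prop :=
  IsLipProfile C w ∧ (∃ x, ‖x‖ = 1 ∧ w x = 1) ∧
    ∀ x, x ≠ 0 → w x ≤ spherePot (fun y => (k - lam * F y) * w y) x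

variable {F : EuclideanSpace ℝ (Fin (n + 1)) → ℝ} {k m M : ℝ}

lemma exists_isPerronSub_of_tendsto (hn : 2 ≤ n) (hF : ContinuousOn F {0}ᶜ)
    (hFhom : ∀ t : ℝ, 0 < t → ∀ y, y ≠ 0 → F (t • y) = F y)
    {lam : ℕ → ℝ} {l : ℝ} (hl : Tendsto lam atTop (𝓝 l))
    (h : ∀ j, ∃ w, IsPerronSub C k F (lam j) w) : ∃ w, IsPerronSub C k F l w := by
  have hn' : (2 : ℝ) ≤ n := by exact_mod_cast hn
  choose w hw using h
  obtain ⟨φ, hφ, v, hv, hunif⟩ := exists_tendsto_isLipProfile fun j => (hw j).1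
  obtain ⟨B, hB⟩ := exists_abs_le_of_degree_zero hF hFhom
  have hB0 : 0 ≤ B := by
    obtain ⟨x, hx, -⟩ := exists_unit_forall_le hFhom hF
    exact (abs_nonneg _).trans (hB x (ne_zero_of_norm_eq_one hx))
  have hcont : ∀ (a : ℝ) {u : EuclideanSpace ℝ (Fin (n + 1)) → ℝ}, IsLipProfile C u →
      ContinuousOn (fun y => (k - a * F y) * u y) {0}ᶜ := fun a u hu =>
    (continuousOn_const.sub (continuousOn_const.mul hF)).mul hu.continuousOn
  have hhom : ∀ (a : ℝ) {u : EuclideanSpace ℝ (Fin (n + 1)) → ℝ}, IsLipProfile C u →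
      ∀ t : ℝ, 0 < t → ∀ y, y ≠ 0 → (k - a * F (t • y)) * u (t • y) = (k - a * F y) * u y :=
    fun a u hu t ht y hy => by rw [hFhom t ht y hy, hu.1 t ht y hy]
  refine ⟨v, hv, ?_, fun x hx => ?_⟩
  · obtain ⟨x, hx, hmax⟩ := exists_unit_forall_le hv.1 hv.continuousOn
    refine ⟨x, hx, le_antisymm (hv.2.1 x (ne_zero_of_norm_eq_one hx)).2 ?_⟩
    refine le_of_forall_pos_le_add fun ε hε => ?_
    obtain ⟨j, hj⟩ := (hunif ε hε).exists
    obtain ⟨z, hz, hwz⟩ := (hw (φ j)).2.1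
    have hz0 := ne_zero_of_norm_eq_one hz
    have h1 := hmax z hz0
    have h2 := le_of_abs_le (hj z hz0)
    linarith
  · set c : ℝ := ((n : ℝ) - 1) ^ 2 / 4 with hc
    have hc0 : 0 < c := by rw [hc]; nlinarith
    set D : ℝ := 1 + (|k| + |l| * B + B) * c⁻¹ with hD
    have hD0 : 0 < D := by rw [hD]; positivity
    refine le_of_forall_pos_le_add fun δ hδ => ?_
    set ε := δ / D with hε
    have hε0 : 0 < ε := div_pos hδ hD0
    obtain ⟨j, hj, hlj⟩ := ((hunif ε hε0).and ((hl.comp hφ.tendsto_atTop).eventually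
      (Metric.closedBall_mem_nhds l hε0))).exists
    have hlj : |lam (φ j) - l| ≤ ε := by simpa [Real.dist_eq] using hlj
    have hwj := hw (φ j)
    have hm1 := aestronglyMeasurable_of_continuousOn_compl (hcont (lam (φ j)) hwj.1)
    obtain ⟨B1, hB1⟩ := exists_abs_le_of_degree_zero (hcont (lam (φ j)) hwj.1) (hhom _ hwj.1)
    have hm2 := aestronglyMeasurable_of_continuousOn_compl (hcont l hv)
    obtain ⟨B2, hB2⟩ := exists_abs_le_of_degree_zero (hcont l hv) (hhom _ hv)
    set A : ℝ := (|k| + |l| * B + B) * ε with hA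
    have hle : ∀ y, y ≠ 0 → (k - lam (φ j) * F y) * w (φ j) y ≤ (k - l * F y) * v y + A * 1 := by
      intro y hy
      have e1 : (k - lam (φ j) * F y) * w (φ j) y - (k - l * F y) * v y =
          k * (w (φ j) y - v y) - l * F y * (w (φ j) y - v y) -
            (lam (φ j) - l) * (F y * w (φ j) y) := by ring
      have a1 : |k * (w (φ j) y - v y)| ≤ |k| * ε := by
        rw [abs_mul]; exact mul_le_mul_of_nonneg_left (hj y hy) (abs_nonneg _)
      have a2 : |l * F y * (w (φ j) y - v y)| ≤ |l| * B * ε := by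
        rw [abs_mul, abs_mul]
        exact mul_le_mul (mul_le_mul_of_nonneg_left (hB y hy) (abs_nonneg _)) (hj y hy)
          (abs_nonneg _) (by positivity)
      have a3 : |(lam (φ j) - l) * (F y * w (φ j) y)| ≤ ε * B := by
        rw [abs_mul, abs_mul]
        refine mul_le_mul hlj ?_ (by positivity) hε0.le
        obtain ⟨hw0, hw1⟩ := hwj.1.2.1 y hy
        rw [abs_of_nonneg hw0]
        exact (mul_le_of_le_one_right (abs_nonneg _) hw1).trans (hB y hy)
      rw [abs_le] at a1 a2 a3
      rw [hA]
      linarith [a1.2, a2.1, a3.1]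
    have hadd := spherePot_add_const_mul hn hm2 hB2 (b' := fun _ => (1 : ℝ)) (B' := 1)
      aestronglyMeasurable_const (by simp) A hx
    rw [spherePot_one hn hx, ← hc] at hadd
    have hmono := spherePot_mono hn hm1 hB1
      (b' := fun y => (k - l * F y) * v y + A * 1) (B' := B2 + |A|)
      (hm2.add aestronglyMeasurable_const)
      (fun y hy => (abs_add_le _ _).trans (by rw [mul_one]; linarith [hB2 y hy])) hle hx
    have h1 := hwj.2.2 x hx
    have h2 := (abs_le.1 (hj x hx)).1
    have h3 : δ = ε + A * c⁻¹ := by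
      have : δ = ε * D := by rw [hε]; field_simp
      rw [this, hD, hA]; ring
    linarith

end PerronSubsolutions

section PerronEigenfunction

open Filter Topology

variable {n : ℕ} {C k m M l : ℝ} {F w : EuclideanSpace ℝ (Fin (n + 1)) → ℝ}

lemma IsPerronSub.mul_le (hn : 2 ≤ n) (hw : IsPerronSub C k F l w) (hF : ContinuousOn F {0}ᶜ)
    (hFhom : ∀ t : ℝ, 0 < t → ∀ y, y ≠ 0 → F (t • y) = F y) (hl : 0 ≤ l)
    (hm : ∀ y, y ≠ 0 → m ≤ F y) (hk : ∀ y, y ≠ 0 → l * F y ≤ k) :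
    l * m ≤ k - ((n : ℝ) - 1) ^ 2 / 4 := by
  have hn' : (2 : ℝ) ≤ n := by exact_mod_cast hn
  obtain ⟨x, hx, hwx⟩ := hw.2.1
  have hc : ContinuousOn (fun y => (k - l * F y) * w y) {0}ᶜ :=
    (continuousOn_const.sub (continuousOn_const.mul hF)).mul hw.1.continuousOn
  obtain ⟨B, hB⟩ := exists_abs_le_of_degree_zero hc fun t ht y hy => by
    rw [hFhom t ht y hy, hw.1.1 t ht y hy]
  have h1 := spherePot_le hn (A := k - l * m) (aestronglyMeasurable_of_continuousOn_compl hc) hB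
    (fun y hy => by
      obtain ⟨h0, h1⟩ := hw.1.2.1 y hy
      have h2 := hk y hy
      have h3 := mul_le_mul_of_nonneg_left (hm y hy) hl
      nlinarith) (ne_zero_of_norm_eq_one hx)
  have h2 := hw.2.2 x (ne_zero_of_norm_eq_one hx)
  have hc0 : 0 < ((n : ℝ) - 1) ^ 2 / 4 := by nlinarith
  rw [hwx] at h2
  have h3 := h2.trans h1
  rw [← div_eq_mul_inv, le_div_iff₀ hc0] at h3
  linarith

/-- A Perron subsolution which is not a solution is one for all slightly larger parameters. -/
lemma IsPerronSub.exists_pos_forall (hn : 2 ≤ n)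
    {C₀ : ℝ} (hC₀ : ∀ (b : EuclideanSpace ℝ (Fin (n + 1)) → ℝ) (B : ℝ),
      AEStronglyMeasurable b → (∀ y, y ≠ 0 → |b y| ≤ B) →
      ∀ x y, ‖x‖ = 1 → ‖y‖ = 1 → |spherePot b y - spherePot b x| ≤ C₀ * B * ‖y - x‖)
    (hw : IsPerronSub (C₀ * k) k F l w) (hF : ContinuousOn F {0}ᶜ)
    (hFhom : ∀ t : ℝ, 0 < t → ∀ y, y ≠ 0 → F (t • y) = F y) (hl : 0 ≤ l) (hM : 0 < M)
    (hF0 : ∀ y, y ≠ 0 → 0 ≤ F y) (hFM : ∀ y, y ≠ 0 → F y ≤ M) (hk : ∀ y, y ≠ 0 → l * F y < k)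
    {x₀ : EuclideanSpace ℝ (Fin (n + 1))} (hx₀ : x₀ ≠ 0)
    (hne : w x₀ ≠ spherePot (fun y => (k - l * F y) * w y) x₀) :
    ∃ δ, 0 < δ ∧ ∀ δ', 0 ≤ δ' → δ' ≤ δ → ∃ w', IsPerronSub (C₀ * k) k F (l + δ') w' := by
  have hn' : (2 : ℝ) ≤ n := by exact_mod_cast hn
  set c : ℝ := ((n : ℝ) - 1) ^ 2 / 4 with hc
  have hc0 : 0 < c := by rw [hc]; nlinarith
  have hq : ContinuousOn (fun y => k - l * F y) {0}ᶜ :=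
    continuousOn_const.sub (continuousOn_const.mul hF)
  have hqw : ContinuousOn (fun y => (k - l * F y) * w y) {0}ᶜ := hq.mul hw.1.continuousOn
  have hqwh : ∀ t : ℝ, 0 < t → ∀ y, y ≠ 0 →
      (k - l * F (t • y)) * w (t • y) = (k - l * F y) * w y := fun t ht y hy => by
    rw [hFhom t ht y hy, hw.1.1 t ht y hy]
  have hqwk : ∀ y, y ≠ 0 → |(k - l * F y) * w y| ≤ k := fun y hy => by
    obtain ⟨h0, h1⟩ := hw.1.2.1 y hy
    have h2 := hk y hy
    have h3 := mul_nonneg hl (hF0 y hy)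
    rw [abs_of_nonneg (mul_nonneg (by linarith) h0)]
    nlinarith
  have hqwm := aestronglyMeasurable_of_continuousOn_compl hqw
  set w1 := spherePot (fun y => (k - l * F y) * w y) with hw1
  have hw1c : ContinuousOn w1 {0}ᶜ := (contDiffOn_one_spherePot hn hqwm hqwk).continuousOn
  have hw1h : ∀ t : ℝ, 0 < t → ∀ y, y ≠ 0 → w1 (t • y) = w1 y := fun t ht y _ =>
    spherePot_smul hqwh ht y
  have hw1w : ∀ y, y ≠ 0 → w y ≤ w1 y := hw.2.2
  have hqd : ContinuousOn (fun y => (k - l * F y) * (w1 y - w y)) {0}ᶜ :=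
    hq.mul (hw1c.sub hw.1.continuousOn)
  have hqdh : ∀ t : ℝ, 0 < t → ∀ y, y ≠ 0 →
      (k - l * F (t • y)) * (w1 (t • y) - w (t • y)) = (k - l * F y) * (w1 y - w y) :=
    fun t ht y hy => by rw [hFhom t ht y hy, hw.1.1 t ht y hy, hw1h t ht y hy]
  have hqw1 : ContinuousOn (fun y => (k - l * F y) * w1 y) {0}ᶜ := hq.mul hw1c
  have hqw1h : ∀ t : ℝ, 0 < t → ∀ y, y ≠ 0 →
      (k - l * F (t • y)) * w1 (t • y) = (k - l * F y) * w1 y := fun t ht y hy => by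
    rw [hFhom t ht y hy, hw1h t ht y hy]
  have hFw1 : ContinuousOn (fun y => F y * w1 y) {0}ᶜ := hF.mul hw1c
  have hFw1h : ∀ t : ℝ, 0 < t → ∀ y, y ≠ 0 → F (t • y) * w1 (t • y) = F y * w1 y :=
    fun t ht y hy => by rw [hFhom t ht y hy, hw1h t ht y hy]
  obtain ⟨B1, hB1⟩ := exists_abs_le_of_degree_zero hqw1 hqw1h
  obtain ⟨B2, hB2⟩ := exists_abs_le_of_degree_zero hFw1 hFw1h
  have hqw1m := aestronglyMeasurable_of_continuousOn_compl hqw1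
  have hFw1m := aestronglyMeasurable_of_continuousOn_compl hFw1
  obtain ⟨Bd, hBd⟩ := exists_abs_le_of_degree_zero hqd hqdh
  have hgap : ∃ ε, 0 < ε ∧ ∀ y, y ≠ 0 →
      ε ≤ spherePot (fun y => (k - l * F y) * (w1 y - w y)) y := by
    obtain ⟨z, hz, hmin⟩ := exists_unit_forall_le
      (w := fun y => -spherePot (fun y => (k - l * F y) * (w1 y - w y)) y)
      (fun t ht y _ => by rw [spherePot_smul hqdh ht])
      (contDiffOn_one_spherePot hn (aestronglyMeasurable_of_continuousOn_compl hqd)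
        hBd).continuousOn.neg
    refine ⟨_, spherePot_pos hn hqd hqdh (fun y hy => mul_nonneg (by linarith [hk y hy])
      (by linarith [hw1w y hy])) hx₀ (mul_ne_zero (by linarith [hk x₀ hx₀] : (0 : ℝ) < _).ne'
      (sub_ne_zero.2 hne.symm)) (ne_zero_of_norm_eq_one hz), fun y hy => ?_⟩
    exact neg_le_neg_iff.1 (hmin y hy)
  obtain ⟨ε, hε, hgap⟩ := hgap
  have hgap' : ∀ y, y ≠ 0 → w1 y + ε ≤ spherePot (fun y => (k - l * F y) * w1 y) y := by
    intro y hy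
    have h1 := spherePot_add_const_mul hn hqw1m hB1 hqwm hqwk (-1) hy
    have h2 : (fun y => (k - l * F y) * w1 y + -1 * ((k - l * F y) * w y)) =
        fun y => (k - l * F y) * (w1 y - w y) := funext fun y => by ring
    rw [h2] at h1
    have := hgap y hy
    rw [h1, ← hw1] at this
    linarith
  obtain ⟨x1, hx1, hmax⟩ := exists_unit_forall_le hw1h hw1c
  obtain ⟨xw, hxw, hwxw⟩ := hw.2.1
  set μ := w1 x1 with hμ
  have hμ1 : 1 ≤ μ := by
    have h1 := hw1w xw (ne_zero_of_norm_eq_one hxw)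
    have h2 := hmax xw (ne_zero_of_norm_eq_one hxw)
    linarith
  have hμ0 : 0 < μ := by linarith
  refine ⟨ε * c / (M * μ), by positivity, fun δ' hδ'0 hδ' => ⟨fun y => μ⁻¹ * w1 y,
    ⟨fun t ht y hy => ?_, fun y hy => ⟨?_, ?_⟩, fun x y hx hy => ?_⟩, ⟨x1, hx1, ?_⟩,
    fun x hx => ?_⟩⟩
  · simp only [hw1h t ht y hy]
  · exact mul_nonneg (inv_pos.2 hμ0).le ((hw.1.2.1 y hy).1.trans (hw1w y hy))
  · rw [inv_mul_le_iff₀ hμ0, mul_one]; exact hmax y hy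
  · rw [← mul_sub, abs_mul, abs_of_pos (inv_pos.2 hμ0)]
    exact (mul_le_of_le_one_left (abs_nonneg _) (inv_le_one_of_one_le₀ hμ1)).trans
      (hC₀ _ k hqwm hqwk x y hx hy)
  · exact inv_mul_cancel₀ hμ0.ne'
  · have h1 : (fun y => (k - (l + δ') * F y) * (μ⁻¹ * w1 y)) =
        fun y => μ⁻¹ * ((k - l * F y) * w1 y + -δ' * (F y * w1 y)) := funext fun y => by ring
    rw [h1, spherePot_const_mul, spherePot_add_const_mul hn hqw1m hB1 hFw1m hB2 _ hx]
    refine mul_le_mul_of_nonneg_left ?_ (inv_pos.2 hμ0).le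
    have h2 := hgap' x hx
    have h3 := spherePot_le hn (A := M * μ) hFw1m hB2 (fun y hy =>
      mul_le_mul (hFM y hy) (hmax y hy) ((hw.1.2.1 y hy).1.trans (hw1w y hy)) hM.le) hx
    have h4 : δ' * spherePot (fun y => F y * w1 y) x ≤ ε := by
      calc _ ≤ δ' * (M * μ * c⁻¹) := mul_le_mul_of_nonneg_left h3 hδ'0
        _ ≤ ε * c / (M * μ) * (M * μ * c⁻¹) := by gcongr
        _ = ε := by field_simp
    linarith

/-- Existence of a positive degree-zero eigenfunction for the weighted problem on the sphere. -/
theorem exists_sphere_eigenfunction (hn : 2 ≤ n)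
    (hF : ContDiffOn ℝ 1 F {0}ᶜ) (hFhom : ∀ t : ℝ, 0 < t → ∀ y, y ≠ 0 → F (t • y) = F y)
    (hm : 0 < m) (hmF : ∀ y, y ≠ 0 → m ≤ F y) (hFM : ∀ y, y ≠ 0 → F y ≤ M)
    (hmM : n * (M / m - 1) < ((n : ℝ) - 1) ^ 2 / 4) :
    ∃ lam w, 0 < lam ∧ lam * m ≤ n ∧ ContDiffOn ℝ 2 w {(0 : EuclideanSpace ℝ (Fin (n + 1)))}ᶜ ∧
      (∀ t : ℝ, 0 < t → ∀ y, y ≠ 0 → w (t • y) = w y) ∧ (∀ y, y ≠ 0 → 0 < w y) ∧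
      ∀ x, ‖x‖ = 1 → laplacian w x = (lam * F x - n) * w x := by
  have hn' : (2 : ℝ) ≤ n := by exact_mod_cast hn
  set c : ℝ := ((n : ℝ) - 1) ^ 2 / 4 with hc
  have hc0 : 0 < c := by rw [hc]; nlinarith
  have hmMle : m ≤ M := by
    have h0 : (EuclideanSpace.single 0 1 : EuclideanSpace ℝ (Fin (n + 1))) ≠ 0 :=
      ne_zero_of_norm_eq_one (by simp)
    exact (hmF _ h0).trans (hFM _ h0)
  have hM : 0 < M := hm.trans_le hmMle
  have hF0 : ∀ y, y ≠ 0 → 0 ≤ F y := fun y hy => hm.le.trans (hmF y hy)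
  obtain ⟨C₀, hC₀0, hC₀⟩ := exists_abs_spherePot_sub_le (n := n) hn
  set k : ℝ := c + n with hk
  obtain ⟨l1, hl1, hl1'⟩ : ∃ l1, (n : ℝ) / m < l1 ∧ l1 < k / M := by
    refine exists_between ?_
    rw [div_lt_div_iff₀ hm hM, hk]
    have : n * (M / m - 1) * m = n * M - n * m := by field_simp
    nlinarith
  have hkl : ∀ l, l ≤ l1 → ∀ y, y ≠ 0 → l * F y < k := by
    intro l hl y hy
    have h1 := (lt_div_iff₀ hM).1 hl1'
    have h2 : l * F y ≤ l1 * F y := mul_le_mul_of_nonneg_right hl (hF0 y hy)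
    have h3 : l1 * F y ≤ l1 * M := mul_le_mul_of_nonneg_left (hFM y hy)
      ((div_pos (by linarith) hm).trans hl1).le
    linarith
  set Λ : Set ℝ := {l | (n : ℝ) / M ≤ l ∧ l ≤ l1 ∧ ∃ w, IsPerronSub (C₀ * k) k F l w} with hΛ
  have hnM : 0 < (n : ℝ) / M := div_pos (by linarith) hM
  have hΛm : ∀ l ∈ Λ, l * m ≤ n := by
    rintro l ⟨hl0, hl, w, hw⟩
    have := hw.mul_le hn hF.continuousOn hFhom (hnM.le.trans hl0) hmF fun y hy => (hkl l hl y hy).le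
    rw [← hc, hk] at this
    linarith
  have hne : Λ.Nonempty := by
    refine ⟨n / M, le_rfl, (div_le_div_of_nonneg_left (by linarith) hm hmMle).trans hl1.le,
      fun _ => 1, ⟨fun _ _ _ _ => rfl, fun _ _ => ⟨zero_le_one, le_rfl⟩, fun x y _ _ => ?_⟩,
      ⟨EuclideanSpace.single 0 1, by simp, rfl⟩, fun x hx => ?_⟩
    · rw [sub_self, abs_zero]
      positivity
    · have hq : ContinuousOn (fun y => (k - n / M * F y) * 1) {0}ᶜ :=
        (continuousOn_const.sub (continuousOn_const.mul hF.continuousOn)).mul continuousOn_const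
      obtain ⟨B, hB⟩ := exists_abs_le_of_degree_zero hq fun t ht y hy => by rw [hFhom t ht y hy]
      have h1 := le_spherePot hn (A := c) (aestronglyMeasurable_of_continuousOn_compl hq) hB
        (fun y hy => by
          have h2 : n / M * F y ≤ n / M * M := mul_le_mul_of_nonneg_left (hFM y hy) hnM.le
          rw [div_mul_cancel₀ _ hM.ne'] at h2
          rw [hk]; linarith) hx
      rwa [← hc, mul_inv_cancel₀ hc0.ne'] at h1
  have hbdd : BddAbove Λ := ⟨l1, fun l hl => hl.2.1⟩
  obtain ⟨s, -, hs, hsΛ⟩ := exists_seq_tendsto_sSup hne hbdd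
  set lam := sSup Λ with hlam
  have hlamΛ : lam ∈ Λ := ⟨ge_of_tendsto' hs fun j => (hsΛ j).1, le_of_tendsto' hs fun j => (hsΛ j).2.1,
    exists_isPerronSub_of_tendsto hn hF.continuousOn hFhom hs fun j => (hsΛ j).2.2⟩
  have hlam0 : 0 < lam := hnM.trans_le hlamΛ.1
  have hlamm := hΛm lam hlamΛ
  have hlamlt : lam < l1 := ((le_div_iff₀ hm).2 hlamm).trans_lt hl1
  obtain ⟨w, hw⟩ := hlamΛ.2.2
  have hfix : ∀ x, x ≠ 0 → w x = spherePot (fun y => (k - lam * F y) * w y) x := by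
    by_contra! hcon
    obtain ⟨x₀, hx₀, hne₀⟩ := hcon
    obtain ⟨δ, hδ, hall⟩ := hw.exists_pos_forall hn hC₀ hF.continuousOn hFhom hlam0.le hM hF0 hFM
      (hkl lam hlamΛ.2.1) hx₀ hne₀
    have h1 : lam + min δ (l1 - lam) ∈ Λ := by
      refine ⟨?_, ?_, hall _ (le_min hδ.le (by linarith)) (min_le_left _ _)⟩
      · have := le_min hδ.le (by linarith : 0 ≤ l1 - lam)
        linarith [hlamΛ.1]
      · linarith [min_le_right δ (l1 - lam)]
    have h2 := le_csSup hbdd h1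
    have h3 := lt_min hδ (by linarith : 0 < l1 - lam)
    linarith
  have hqC : ContDiffOn ℝ 1 (fun y => k - lam * F y) {0}ᶜ :=
    contDiffOn_const.sub (contDiffOn_const.mul hF)
  have hqwc : ContinuousOn (fun y => (k - lam * F y) * w y) {0}ᶜ :=
    hqC.continuousOn.mul hw.1.continuousOn
  have hqwh : ∀ t : ℝ, 0 < t → ∀ y, y ≠ 0 →
      (k - lam * F (t • y)) * w (t • y) = (k - lam * F y) * w y := fun t ht y hy => by
    rw [hFhom t ht y hy, hw.1.1 t ht y hy]
  obtain ⟨B, hB⟩ := exists_abs_le_of_degree_zero hqwc hqwh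
  have hwC1 : ContDiffOn ℝ 1 w {0}ᶜ := (contDiffOn_one_spherePot hn
    (aestronglyMeasurable_of_continuousOn_compl hqwc) hB).congr hfix
  have hqwC1 : ContDiffOn ℝ 1 (fun y => (k - lam * F y) * w y) {0}ᶜ := hqC.mul hwC1
  refine ⟨lam, w, hlam0, hlamm, (contDiffOn_two_spherePot hn hqwC1 hqwh).congr hfix, hw.1.1,
    fun y hy => ?_, fun x hx => ?_⟩
  · obtain ⟨z, hz, hwz⟩ := hw.2.1
    have hz0 := ne_zero_of_norm_eq_one hz
    rw [hfix y hy]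
    refine spherePot_pos hn hqwc hqwh (fun y hy => mul_nonneg
      (by linarith [hkl lam hlamΛ.2.1 y hy]) (hw.1.2.1 y hy).1) hz0 ?_ hy
    rw [hwz, mul_one]
    exact (sub_pos.2 (hkl lam hlamΛ.2.1 z hz0)).ne'
  · have hx0 := ne_zero_of_norm_eq_one hx
    rw [laplacian_congr (v := spherePot fun y => (k - lam * F y) * w y)
      (by filter_upwards [isOpen_compl_singleton.mem_nhds hx0] with z hz using hfix z hz),
      laplacian_spherePot hn hqwC1 hqwh hx, ← hfix x hx0, ← hc, hk]
    ring

end PerronEigenfunction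

section ConvexSolution

open Filter Topology InnerProductGeometry

variable {n : ℕ} {m M G : ℝ} {f : EuclideanSpace ℝ (Fin (n + 1)) → ℝ}

lemma mul_laplacian_smul {u : EuclideanSpace ℝ (Fin (n + 1)) → ℝ} (hu : ContDiffOn ℝ 2 u {0}ᶜ)
    (hhom : ∀ t : ℝ, 0 < t → ∀ y, y ≠ 0 → u (t • y) = t * u y) {t : ℝ} (ht : 0 < t)
    {y : EuclideanSpace ℝ (Fin (n + 1))} (hy : y ≠ 0) :
    t * laplacian u (t • y) = laplacian u y := by
  have hC : ∀ z, z ≠ 0 → ContDiffAt ℝ 2 u z := fun z hz =>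
    hu.contDiffAt (isOpen_compl_singleton.mem_nhds hz)
  have h1 : ∀ v z, z ≠ 0 → fderiv ℝ u (t • z) v = 1 * fderiv ℝ u z v := fun v z hz => by
    have := fderiv_smul_of_homogeneous (hhom t ht) hz ((hC z hz).differentiableAt (by norm_num)) v
    rw [one_mul]
    exact mul_left_cancel₀ ht.ne' this
  rw [laplacian, laplacian, Finset.mul_sum]
  refine Finset.sum_congr rfl fun i _ => ?_
  rw [fderiv_smul_of_homogeneous (h1 _) hy
    ((differentiableAt_fderiv_of_contDiffAt_two (hC y hy)).clm_apply (differentiableAt_const _)),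
    one_mul]

lemma abs_sub_le_mul_of_log_sub_log_le {a b W δ : ℝ} (ha : 0 < a) (hb : 0 < b) (haW : a ≤ W)
    (hbW : b ≤ W) (hab : Real.log a - Real.log b ≤ δ) (hba : Real.log b - Real.log a ≤ δ) :
    |a - b| ≤ W * δ := by
  have key : ∀ {a b : ℝ}, 0 < a → 0 < b → a ≤ W → Real.log a - Real.log b ≤ δ →
      Real.log b - Real.log a ≤ δ → a - b ≤ W * δ := by
    intro a b ha hb haW hab hba
    have h1 := Real.one_sub_inv_le_log_of_pos (div_pos ha hb)
    rw [inv_div, Real.log_div ha.ne' hb.ne'] at h1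
    have h2 : a * (1 - b / a) = a - b := by field_simp
    calc a - b = a * (1 - b / a) := h2.symm
      _ ≤ a * δ := mul_le_mul_of_nonneg_left (h1.trans hab) ha.le
      _ ≤ W * δ := mul_le_mul_of_nonneg_right haW (by linarith)
  rw [abs_sub_le_iff]
  exact ⟨key ha hb haW hab hba, key hb ha hbW hba hab⟩

/-- Existence of a convex solution when the spherical oscillation of `f` is small. -/
theorem exists_isL2Solution (hn : 2 ≤ n) (hf_C1 : ContDiffOn ℝ 1 f {0}ᶜ)
    (hf_hom : ∀ t : ℝ, 0 < t → ∀ y, y ≠ 0 → f (t • y) = t ^ (-(2 : ℝ)) * f y)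
    (hm : 0 < m) (hmf : ∀ x, ‖x‖ = 1 → m ≤ f x) (hfM : ∀ x, ‖x‖ = 1 → f x ≤ M) (hG0 : 0 ≤ G)
    (hG : ∀ x y, ‖x‖ = 1 → ‖y‖ = 1 → |f y - f x| ≤ G * angle x y)
    (hosc : M - m ≤ Real.pi * G)
    (hcond : (1 + (n / (n - 1) : ℝ) * (M / m)) * Real.exp ((n * Real.pi / (n - 1)) * (G / m)) * G ≤
      gammaConst n 1 * m) : ∃ lam : ℝ, 0 < lam ∧ ∃ u, IsL2Solution n f lam u := by
  have hn' : (2 : ℝ) ≤ n := by exact_mod_cast hn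
  have hn1 : (0 : ℝ) < n - 1 := by linarith
  have hx₁ : ‖(EuclideanSpace.single 0 1 : EuclideanSpace ℝ (Fin (n + 1)))‖ = 1 := by simp
  have hmM : m ≤ M := (hmf _ hx₁).trans (hfM _ hx₁)
  have hM : 0 < M := hm.trans_le hmM
  set F : EuclideanSpace ℝ (Fin (n + 1)) → ℝ := fun y => ‖y‖ ^ 2 * f y with hF
  have hF1 : ∀ x, ‖x‖ = 1 → F x = f x := fun x hx => by simp [hF, hx]
  have hFhom : ∀ t : ℝ, 0 < t → ∀ y, y ≠ 0 → F (t • y) = F y := fun t ht y hy => by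
    simp only [hF]
    rw [hf_hom t ht y hy, norm_smul, Real.norm_of_nonneg ht.le, Real.rpow_neg ht.le,
      show (2 : ℝ) = (2 : ℕ) by norm_num, Real.rpow_natCast]
    field_simp
  have hFC : ContDiffOn ℝ 1 F {0}ᶜ := ((contDiff_norm_sq ℝ).contDiffOn).mul hf_C1
  have hFs : ∀ y, y ≠ 0 → F y = f (‖y‖⁻¹ • y) := fun y hy => by
    rw [← hF1 _ (norm_inv_norm_smul hy), apply_inv_norm_smul hFhom hy]
  obtain ⟨lam, w, hlam, hlamm, hwC, hwhom, hwpos, hwlap⟩ := exists_sphere_eigenfunction hn hFC hFhom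
    hm (fun y hy => (hmf _ (norm_inv_norm_smul hy)).trans_eq (hFs y hy).symm)
    (fun y hy => (hFs y hy).trans_le (hfM _ (norm_inv_norm_smul hy)))
    (mul_ratio_sub_one_lt hn hm hmM hG0 hosc hcond)
  have hwlap' : ∀ x, ‖x‖ = 1 → laplacian w x = (lam * f x - n) * w x := fun x hx => by
    rw [hwlap x hx, hF1 x hx]
  set u : EuclideanSpace ℝ (Fin (n + 1)) → ℝ := fun y => ‖y‖ * w y with hu
  have huhom : ∀ t : ℝ, 0 < t → ∀ y, y ≠ 0 → u (t • y) = t * u y := fun t ht y hy => by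
    simp only [hu]
    rw [hwhom t ht y hy, norm_smul, Real.norm_of_nonneg ht.le, mul_assoc]
  have huC : ContDiffOn ℝ 2 u {0}ᶜ := contDiffOn_norm_compl.mul hwC
  have hu1 : ∀ x, ‖x‖ = 1 → u x = w x := fun x hx => by simp [hu, hx]
  have hulap1 : ∀ x, ‖x‖ = 1 → laplacian u x = lam * f x * u x := fun x hx => by
    have hx0 := ne_zero_of_norm_eq_one hx
    have h1 := laplacian_radial_mul (τ := Real.exp) (s := 0) Real.contDiff_exp hwC
      (fun y hy => fderiv_self_of_homogeneous
        (fun t ht z hz => by rw [Real.rpow_zero, one_mul, hwhom t ht z hz]) hy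
        ((hwC.contDiffAt (isOpen_compl_singleton.mem_nhds hy)).differentiableAt (by norm_num))) hx0
    have h2 : (fun z => Real.exp (Real.log ‖z‖) * w z) =ᶠ[𝓝 x] u := by
      filter_upwards [isOpen_compl_singleton.mem_nhds hx0] with z hz
      rw [Real.exp_log (norm_pos_iff.2 hz)]
    rw [laplacian_congr h2, hwlap' x hx, hx] at h1
    rw [h1, hu1 x hx]
    simp
    ring
  have hfu : ∀ t : ℝ, 0 < t → ∀ y, y ≠ 0 →
      lam * f (t • y) * u (t • y) = t⁻¹ * (lam * f y * u y) := fun t ht y hy => by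
    rw [hf_hom t ht y hy, huhom t ht y hy, Real.rpow_neg ht.le,
      show (2 : ℝ) = (2 : ℕ) by norm_num, Real.rpow_natCast]
    field_simp
  have hulap : ∀ y, y ≠ 0 → laplacian u y = lam * f y * u y := fun y hy => by
    have hy' : 0 < ‖y‖⁻¹ := inv_pos.2 (norm_pos_iff.2 hy)
    rw [← mul_laplacian_smul huC huhom hy' hy, hulap1 _ (norm_inv_norm_smul hy), hfu _ hy' y hy]
    field_simp
  obtain ⟨x₀, hx₀, hmax⟩ := exists_unit_forall_le hwhom hwC.continuousOn
  have hW : 0 < w x₀ := hwpos _ (ne_zero_of_norm_eq_one hx₀)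
  set L := lam * G / (n - 1) with hL
  have hlog : ∀ x y, ‖x‖ = 1 → ‖y‖ = 1 → Real.log (w y) - Real.log (w x) ≤ L * angle x y :=
    fun x y hx hy => log_sub_log_le hn hwC hwpos hwhom hwlap' hlam.le hG0 hG hx hy
  have hlamle : lam ≤ n / m := (le_div_iff₀ hm).2 hlamm
  have hL0 : 0 ≤ L := by positivity
  have hLle : L ≤ n / (n - 1) * (G / m) := by
    calc L ≤ n / m * G / (n - 1) := by rw [hL]; gcongr
      _ = _ := by field_simp
  refine ⟨lam, hlam, u, convexOn_of_lipschitz_laplacian (g := fun y => lam * f y * u y)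
    (G := lam * (w x₀ * (G * (1 + n / (n - 1) * (M / m))))) hn huC (by simp [hu]) huhom hulap hfu
    (fun x y hx hy => ?_) (fun x hx => ?_) (fun x hx => ?_),
    fun y hy => mul_pos (norm_pos_iff.2 hy) (hwpos y hy), huhom, huC, hulap⟩
  · have hx0 := ne_zero_of_norm_eq_one hx
    have hy0 := ne_zero_of_norm_eq_one hy
    have h1 := abs_sub_le_mul_of_log_sub_log_le (hwpos y hy0) (hwpos x hx0) (hmax y hy0)
      (hmax x hx0) (hlog x y hx hy) (angle_comm x y ▸ hlog y x hy hx)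
    have h2 := hG x y hx hy
    have h3 : 0 ≤ angle x y := angle_nonneg x y
    have h4 : L ≤ n / (n - 1) / m * G := hLle.trans_eq (by field_simp)
    simp only [hu1 x hx, hu1 y hy]
    rw [show lam * f y * w y - lam * f x * w x =
      lam * ((f y - f x) * w y + f x * (w y - w x)) by ring, abs_mul, abs_of_pos hlam,
      mul_assoc lam, angle_comm y x]
    refine mul_le_mul_of_nonneg_left ?_ hlam.le
    calc |(f y - f x) * w y + f x * (w y - w x)|
        ≤ |f y - f x| * w y + f x * |w y - w x| := by
          refine (abs_add_le _ _).trans_eq ?_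
          rw [abs_mul, abs_mul, abs_of_pos (hwpos y hy0), abs_of_pos (hm.trans_le (hmf x hx))]
      _ ≤ G * angle x y * w x₀ + M * (w x₀ * (n / (n - 1) / m * G * angle x y)) := by
          have h5 : |w y - w x| ≤ w x₀ * (n / (n - 1) / m * G * angle x y) := h1.trans (by gcongr)
          have h6 := hmax y hy0
          have h7 := hfM x hx
          have h8 := (hwpos y hy0).le
          gcongr
      _ = _ := by field_simp
  · simp only [hu1 x hx]
    have := hwpos x (ne_zero_of_norm_eq_one hx)
    have := hm.trans_le (hmf x hx)
    positivity
  · simp only [hu1 x hx]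
    have hwx := hwpos x (ne_zero_of_norm_eq_one hx)
    have h1 : w x₀ ≤ w x * Real.exp (n * Real.pi / (n - 1) * (G / m)) := by
      rw [← Real.log_le_log_iff hW (by positivity), Real.log_mul hwx.ne' (Real.exp_pos _).ne',
        Real.log_exp]
      have h2 := hlog x x₀ hx hx₀
      have h3 : L * angle x x₀ ≤ n / (n - 1) * (G / m) * Real.pi :=
        mul_le_mul hLle (angle_le_pi x x₀) (angle_nonneg x x₀) (by positivity)
      have h4 : n / (n - 1) * (G / m) * Real.pi = n * Real.pi / (n - 1) * (G / m) := by ring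
      linarith
    have hγ : 0 ≤ gammaConst n 1 := by
      refine nonneg_of_mul_nonneg_left (le_trans ?_ hcond) hm
      positivity
    calc lam * (w x₀ * (G * (1 + n / (n - 1) * (M / m))))
        ≤ lam * (w x * Real.exp (n * Real.pi / (n - 1) * (G / m)) *
            (G * (1 + n / (n - 1) * (M / m)))) := by gcongr
      _ = lam * (w x * ((1 + n / (n - 1) * (M / m)) *
            Real.exp (n * Real.pi / (n - 1) * (G / m)) * G)) := by ring
      _ ≤ lam * (w x * (gammaConst n 1 * m)) := by gcongr
      _ ≤ lam * (w x * (gammaConst n 1 * f x)) := by have := hmf x hx; gcongr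
      _ = _ := by ring

end ConvexSolution

section Assembly

open Filter Topology InnerProductGeometry

variable {n : ℕ} {f u : EuclideanSpace ℝ (Fin (n + 1)) → ℝ} {lam : ℝ}

lemma IsL2Solution.apply_zero (hu : IsL2Solution n f lam u) : u 0 = 0 := by
  obtain ⟨hconv, -, hhom, -, -⟩ := hu
  have hc : Continuous u := continuousOn_univ.1 (hconv.continuousOn isOpen_univ)
  set e : EuclideanSpace ℝ (Fin (n + 1)) := EuclideanSpace.single 0 1
  have he : e ≠ 0 := ne_zero_of_norm_eq_one (by simp [e])
  have h1 : Tendsto (fun t : ℝ => u (t • e)) (𝓝[>] 0) (𝓝 (u ((0 : ℝ) • e))) :=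
    ((hc.comp (continuous_id.smul continuous_const)).tendsto 0).mono_left nhdsWithin_le_nhds
  have h2 : Tendsto (fun t : ℝ => t * u e) (𝓝[>] 0) (𝓝 (0 * u e)) :=
    ((continuous_id.mul continuous_const).tendsto (0 : ℝ)).mono_left nhdsWithin_le_nhds
  rw [zero_smul] at h1
  rw [zero_mul] at h2
  refine tendsto_nhds_unique h1 (h2.congr' ?_)
  filter_upwards [self_mem_nhdsWithin] with t ht using (hhom t ht e he).symm

lemma IsL2Solution.eigenvalue_le {v : EuclideanSpace ℝ (Fin (n + 1)) → ℝ} {lam' : ℝ}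
    (hf : ∀ y, y ≠ 0 → 0 < f y) (hu : IsL2Solution n f lam u) (hv : IsL2Solution n f lam' v) :
    lam ≤ lam' := by
  obtain ⟨-, hupos, huhom, huC, hulap⟩ := hu
  obtain ⟨-, hvpos, hvhom, hvC, hvlap⟩ := hv
  obtain ⟨x, hx, hle⟩ := exists_sphere_laplacian_div_le (by omega) huC hvC hupos hvpos huhom hvhom
    hulap hvlap
  exact le_of_mul_le_mul_right hle (hf x (ne_zero_of_norm_eq_one (mem_sphere_zero_iff_norm.1 hx)))

lemma bddAbove_norm_sphereGrad (hf : ContDiffOn ℝ 1 f {0}ᶜ) :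
    BddAbove ((fun x => ‖sphereGrad f x‖) '' sphere (0 : EuclideanSpace ℝ (Fin (n + 1))) 1) := by
  have h1 : ContinuousOn (gradient f) {0}ᶜ :=
    (InnerProductSpace.toDual ℝ _).symm.continuous.comp_continuousOn
      (hf.continuousOn_fderiv_of_isOpen isOpen_compl_singleton le_rfl)
  have h2 : ContinuousOn (fun x => gradient f x - ⟪gradient f x, x⟫ • x) {0}ᶜ := by
    fun_prop
  exact (isCompact_sphere 0 1).bddAbove_image (h2.norm.mono fun x hx =>
    ne_zero_of_norm_eq_one (mem_sphere_zero_iff_norm.1 hx))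

lemma abs_sub_le_sSup_sphereGrad_mul_angle (hn : 1 ≤ n) (hf : ContDiffOn ℝ 1 f {0}ᶜ)
    {x y : EuclideanSpace ℝ (Fin (n + 1))} (hx : ‖x‖ = 1) (hy : ‖y‖ = 1) :
    |f y - f x| ≤
      sSup ((fun x => ‖sphereGrad f x‖) '' sphere (0 : EuclideanSpace ℝ (Fin (n + 1))) 1) *
        angle x y := by
  refine abs_sub_le_mul_angle hn (fun z hz => (hf.contDiffAt
    (isOpen_compl_singleton.mem_nhds hz)).differentiableAt one_ne_zero) (fun z v hz hv hzv => ?_)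
    hx hy
  rw [fderiv_eq_inner_sphereGrad hzv]
  refine (abs_real_inner_le_norm _ _).trans ?_
  rw [hv, mul_one]
  exact le_csSup (bddAbove_norm_sphereGrad hf) (mem_image_of_mem _ (mem_sphere_zero_iff_norm.2 hz))

end Assembly

/-- the eigenvalue version (`p = 2`) of the `L_p` Christoffel problem. -/
theorem stmt_17 (n : ℕ) (hn : 2 ≤ n)
    (f : EuclideanSpace ℝ (Fin (n + 1)) → ℝ)
    (hf_pos : ∀ y : EuclideanSpace ℝ (Fin (n + 1)), y ≠ 0 → 0 < f y)
    (hf_C1 : ContDiffOn ℝ 1 f {(0 : EuclideanSpace ℝ (Fin (n + 1)))}ᶜ)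
    (hf_hom : ∀ t : ℝ, 0 < t → ∀ y : EuclideanSpace ℝ (Fin (n + 1)), y ≠ 0 →
      f (t • y) = t ^ (-(2 : ℝ)) * f y)
    (hcond :
      (1 + (n / (n - 1) : ℝ) *
          (sSup (f '' sphere (0 : EuclideanSpace ℝ (Fin (n + 1))) 1) /
            sInf (f '' sphere (0 : EuclideanSpace ℝ (Fin (n + 1))) 1))) *
        Real.exp ((n * Real.pi / (n - 1)) *
          (sSup ((fun x => ‖sphereGrad f x‖) '' sphere (0 : EuclideanSpace ℝ (Fin (n + 1))) 1) /
            sInf (f '' sphere (0 : EuclideanSpace ℝ (Fin (n + 1))) 1))) *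
        sSup ((fun x => ‖sphereGrad f x‖) '' sphere (0 : EuclideanSpace ℝ (Fin (n + 1))) 1) ≤
      gammaConst n 1 * sInf (f '' sphere (0 : EuclideanSpace ℝ (Fin (n + 1))) 1)) :
    ∃ lam : ℝ, 0 < lam ∧
      (∃ u, IsL2Solution n f lam u) ∧
      (∀ lam' : ℝ, 0 < lam' → (∃ u, IsL2Solution n f lam' u) → lam' = lam) ∧
      (∀ u v, IsL2Solution n f lam u → IsL2Solution n f lam v →
        ∃ c : ℝ, 0 < c ∧ ∀ x, v x = c * u x) := by

  have hne : ∀ x ∈ sphere (0 : EuclideanSpace ℝ (Fin (n + 1))) 1, x ≠ 0 := fun x hx =>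
    ne_zero_of_norm_eq_one (mem_sphere_zero_iff_norm.1 hx)
  have hS : (sphere (0 : EuclideanSpace ℝ (Fin (n + 1))) 1).Nonempty :=
    NormedSpace.sphere_nonempty.2 zero_le_one
  have hcont := hf_C1.continuousOn.mono hne
  have hcomp := isCompact_sphere (0 : EuclideanSpace ℝ (Fin (n + 1))) 1
  obtain ⟨a, ha, hma⟩ := hcomp.exists_sInf_image_eq hS hcont
  obtain ⟨b, hb, hMb⟩ := hcomp.exists_sSup_image_eq hS hcont
  have hLip := fun x y (hx : ‖x‖ = 1) (hy : ‖y‖ = 1) =>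
    abs_sub_le_sSup_sphereGrad_mul_angle (x := x) (y := y) (by omega) hf_C1 hx hy
  have hG0 : 0 ≤ sSup ((fun x => ‖sphereGrad f x‖) ''
      sphere (0 : EuclideanSpace ℝ (Fin (n + 1))) 1) :=
    Real.sSup_nonneg (by rintro _ ⟨x, -, rfl⟩; exact norm_nonneg _)
  obtain ⟨lam, hlam, u, hu⟩ := exists_isL2Solution hn hf_C1 hf_hom (hma ▸ hf_pos a (hne a ha))
    (fun x hx => csInf_le (hcomp.bddBelow_image hcont)
      (mem_image_of_mem _ (mem_sphere_zero_iff_norm.2 hx)))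
    (fun x hx => le_csSup (hcomp.bddAbove_image hcont)
      (mem_image_of_mem _ (mem_sphere_zero_iff_norm.2 hx))) hG0 hLip
    (by
      rw [hma, hMb, mul_comm]
      exact (le_abs_self _).trans ((hLip a b (mem_sphere_zero_iff_norm.1 ha)
        (mem_sphere_zero_iff_norm.1 hb)).trans
          (mul_le_mul_of_nonneg_left (InnerProductGeometry.angle_le_pi _ _) hG0))) hcond
  refine ⟨lam, hlam, ⟨u, hu⟩, fun lam' _ ⟨v, hv⟩ =>
    le_antisymm (hv.eigenvalue_le hf_pos hu) (hu.eigenvalue_le hf_pos hv), fun u v hu hv => ?_⟩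
  have hu0 := hu.apply_zero
  have hv0 := hv.apply_zero
  obtain ⟨-, hupos, huhom, huC, hulap⟩ := hu
  obtain ⟨-, hvpos, hvhom, hvC, hvlap⟩ := hv
  exact exists_eq_const_mul_of_laplacian_eq (by omega) huC hvC hupos hvpos hu0 hv0 huhom hvhom
    hulap hvlap
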